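/- There exist constants α > 0 and C < ∞ such that the following holds for all n = 2^{j₀}, m = 2^{−i₀}n as above. Let k₁ < k₂ with the x-coordinates of H_{k₁} contained in I_{j₁} and those of H_{k₂} contained in I_{j₂}, where 0 ≤ j₂ − j₁ ≤ 4, and let x₁, x₂ be the x-coordinates of the lower left vertices of H_{k₁}, H_{k₂}. If 2^{−i}n ≤ x₂ − x₁ < 2^{−i+1}n for some j₁ ≤ i ≤ i₀, then P(Q_n ∩ H_{k₁} ≠ ∅ and Q_n ∩ H_{k₂} ≠ ∅) ≤ C·(m/n)⁴·2^{2i+(1−α)j₁}. -/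

import Mathlib

/-!
Critical site percolation on the triangular lattice realized on `ℤ²`.
A configuration assigns to each site `true` (open) or `false` (closed),
and `P` is the product Bernoulli(1/2) measure, axiomatized by
`IsBernoulliHalf` below (finite cylinder events have product probability).
-/

open MeasureTheory
open scoped ENNReal

/-- Sites of the lattice: vertices of `ℤ²`. -/
abbrev Site : Type := ℤ × ℤ

/-- A percolation configuration: `true` = open, `false` = closed. -/
abbrev Config : Type := Site → Bool

/-- Adjacency for the triangular lattice realized on `ℤ²`:
the neighbors of `(x,y)` are `(x±1,y)`, `(x,y±1)`, `(x+1,y-1)`, `(x-1,y+1)`. -/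
def Adj (a b : Site) : Prop :=
  (b.1 - a.1, b.2 - a.2) ∈
    ({(1, 0), (-1, 0), (0, 1), (0, -1), (1, -1), (-1, 1)} : Set (ℤ × ℤ))

/-- A (nonempty, self-avoiding) lattice path: a list of distinct sites in which
consecutive sites are neighbors. -/
def IsPath (p : List Site) : Prop := p ≠ [] ∧ p.Nodup ∧ p.Chain' Adj

/-- A path all of whose vertices lie in the set `S`. -/
def PathIn (S : Set Site) (p : List Site) : Prop := IsPath p ∧ ∀ v ∈ p, v ∈ S

/-- All sites of `p` are open in `ω`. -/
def IsOpenOn (ω : Config) (p : List Site) : Prop := ∀ v ∈ p, ω v = true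

/-- All sites of `p` are closed in `ω`. -/
def IsClosedOn (ω : Config) (p : List Site) : Prop := ∀ v ∈ p, ω v = false

/-- The first vertex of `p` lies in `A`. -/
def FirstIn (A : Set Site) (p : List Site) : Prop := ∃ a ∈ A, p.head? = some a

/-- The last vertex of `p` lies in `A`. -/
def LastIn (A : Set Site) (p : List Site) : Prop := ∃ a ∈ A, p.getLast? = some a

/-- `μ` is the product Bernoulli(1/2) measure on configurations: a probability
measure for which every finite cylinder event has the product probability. -/
def IsBernoulliHalf (μ : Measure Config) : Prop :=
  IsProbabilityMeasure μ ∧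
    ∀ (S : Finset Site) (f : Site → Bool),
      μ {ω | ∀ v ∈ S, ω v = f v} = (1 / 2 : ℝ≥0∞) ^ S.card

/-- The lattice rectangle `[x₀,x₁] × [y₀,y₁]`. -/
def rect (x₀ x₁ y₀ y₁ : ℤ) : Set Site :=
  {v | x₀ ≤ v.1 ∧ v.1 ≤ x₁ ∧ y₀ ≤ v.2 ∧ v.2 ≤ y₁}

/-- The left side of a rectangle. -/
def rectLeft (x₀ x₁ y₀ y₁ : ℤ) : Set Site := {v ∈ rect x₀ x₁ y₀ y₁ | v.1 = x₀}

/-- The right side of a rectangle. -/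
def rectRight (x₀ x₁ y₀ y₁ : ℤ) : Set Site := {v ∈ rect x₀ x₁ y₀ y₁ | v.1 = x₁}

/-- The top side of a rectangle. -/
def rectTop (x₀ x₁ y₀ y₁ : ℤ) : Set Site := {v ∈ rect x₀ x₁ y₀ y₁ | v.2 = y₁}

/-- The bottom side of a rectangle. -/
def rectBot (x₀ x₁ y₀ y₁ : ℤ) : Set Site := {v ∈ rect x₀ x₁ y₀ y₁ | v.2 = y₀}

/-- A horizontal open crossing of the rectangle `[x₀,x₁] × [y₀,y₁]`:
an open path in the rectangle from its left side to its right side. -/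
def HorizCrossing (x₀ x₁ y₀ y₁ : ℤ) (ω : Config) (p : List Site) : Prop :=
  PathIn (rect x₀ x₁ y₀ y₁) p ∧ IsOpenOn ω p ∧
    FirstIn (rectLeft x₀ x₁ y₀ y₁) p ∧ LastIn (rectRight x₀ x₁ y₀ y₁) p

/-- `v` is a pivotal site for the box `B(n) = [-n,n]²`: some horizontal open
crossing of `B(n)` contains `v`, and there are two disjoint closed paths in
`B(n)` started from `v` (i.e. starting at a neighbor of `v`), one to the top
side and one to the bottom side of `B(n)`. -/
def Pivotal (n : ℤ) (ω : Config) (v : Site) : Prop :=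
  (∃ p, HorizCrossing (-n) n (-n) n ω p ∧ v ∈ p) ∧
    ∃ q₁ q₂ : List Site,
      PathIn (rect (-n) n (-n) n) q₁ ∧ IsClosedOn ω q₁ ∧
        FirstIn {w | Adj v w} q₁ ∧ LastIn (rectTop (-n) n (-n) n) q₁ ∧
      PathIn (rect (-n) n (-n) n) q₂ ∧ IsClosedOn ω q₂ ∧
        FirstIn {w | Adj v w} q₂ ∧ LastIn (rectBot (-n) n (-n) n) q₂ ∧
      List.Disjoint q₁ q₂

/-- `Q_n`: the set of pivotal sites for `B(n)`. -/
def Qset (n : ℤ) (ω : Config) : Set Site := {v | Pivotal n ω v}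

/-- The block `H_k`: `{(x,y) ∈ B(n) : -n+(k-1)m < x ≤ -n+km, -n ≤ y ≤ -n+m}`. -/
def Hblock (n m : ℤ) (k : ℕ) : Set Site :=
  {v | -n + ((k : ℤ) - 1) * m < v.1 ∧ v.1 ≤ -n + (k : ℤ) * m ∧
        -n ≤ v.2 ∧ v.2 ≤ -n + m}

/-- The dyadic interval `I_j` (for `n = 2^j₀`, `m = 2^{j₀-i₀}`):
`I_j = (n - 2^{-j}n, n - 2^{-j-1}n]` for `j < i₀` and `I_{i₀} = (n-m, n]`. -/
def Iset (j₀ i₀ j : ℕ) : Set ℤ :=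
  if j = i₀ then Set.Ioc ((2 : ℤ) ^ j₀ - 2 ^ (j₀ - i₀)) ((2 : ℤ) ^ j₀)
  else Set.Ioc ((2 : ℤ) ^ j₀ - 2 ^ (j₀ - j)) ((2 : ℤ) ^ j₀ - 2 ^ (j₀ - j - 1))

/-! ### Connectivity inside a set of sites -/

theorem adj_iff {a b : Site} : Adj a b ↔
    (b.1 = a.1 + 1 ∧ b.2 = a.2) ∨ (b.1 = a.1 - 1 ∧ b.2 = a.2) ∨
    (b.1 = a.1 ∧ b.2 = a.2 + 1) ∨ (b.1 = a.1 ∧ b.2 = a.2 - 1) ∨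
    (b.1 = a.1 + 1 ∧ b.2 = a.2 - 1) ∨ (b.1 = a.1 - 1 ∧ b.2 = a.2 + 1) := by
  simp only [Adj, Set.mem_insert_iff, Set.mem_singleton_iff, Prod.mk.injEq]
  omega

theorem adj_mk {a b c d : ℤ} (h : (c = a + 1 ∧ d = b) ∨ (c = a - 1 ∧ d = b) ∨
    (c = a ∧ d = b + 1) ∨ (c = a ∧ d = b - 1) ∨
    (c = a + 1 ∧ d = b - 1) ∨ (c = a - 1 ∧ d = b + 1)) : Adj (a, b) (c, d) :=
  adj_iff.2 h

theorem Adj.symm {a b : Site} (h : Adj a b) : Adj b a := by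
  rw [adj_iff] at *; omega

/-- `u` and `v` are joined by a lattice path inside `A`. -/
def Conn (A : Set Site) (u v : Site) : Prop :=
  u ∈ A ∧ Relation.ReflTransGen (fun a b => Adj a b ∧ b ∈ A) u v

namespace Conn

variable {A B : Set Site} {u v w : Site}

theorem refl (h : u ∈ A) : Conn A u u := ⟨h, .refl⟩

theorem left_mem (h : Conn A u v) : u ∈ A := h.1

theorem right_mem (h : Conn A u v) : v ∈ A := by
  rcases h with ⟨h1, h2⟩
  rcases h2.cases_tail with h | ⟨c, _, h⟩
  · exact h ▸ h1
  · exact h.2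

theorem tail (h : Conn A u v) (ha : Adj v w) (hw : w ∈ A) : Conn A u w :=
  ⟨h.1, h.2.tail ⟨ha, hw⟩⟩

theorem single (hu : u ∈ A) (ha : Adj u v) (hv : v ∈ A) : Conn A u v :=
  (refl hu).tail ha hv

theorem trans (h : Conn A u v) (h' : Conn A v w) : Conn A u w :=
  ⟨h.1, h.2.trans h'.2⟩

theorem mono (hAB : A ⊆ B) (h : Conn A u v) : Conn B u v :=
  ⟨hAB h.1, Relation.ReflTransGen.mono (fun _ _ hab => ⟨hab.1, hAB hab.2⟩) _ _ h.2⟩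

/-- Induction along the path, keeping track of the connection to the start. -/
theorem ind {P : Site → Prop} (h : Conn A u v) (h0 : P u)
    (hs : ∀ s t, Conn A u s → P s → Adj s t → t ∈ A → P t) : P v := by
  rcases h with ⟨h1, h2⟩
  induction h2 with
  | refl => exact h0
  | tail hab hbc ih => exact hs _ _ ⟨h1, hab⟩ ih hbc.1 hbc.2

theorem symm (h : Conn A u v) : Conn A v u := by
  refine h.ind (P := fun v => Conn A v u) (refl h.1) ?_
  intro s t _ hs hst ht
  exact (single ht hst.symm hs.1).trans hs

/-- A path only uses sites connected to its start. -/
theorem restrict (h : Conn A u v) : Conn {w | Conn A u w} u v := by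
  refine h.ind (P := fun v => Conn {w | Conn A u w} u v) (refl (refl h.1)) ?_
  intro s t hs hs' hst ht
  exact hs'.tail hst (hs.tail hst ht)

theorem restrict' (h : Conn A u v) (hB : ∀ w, Conn A u w → w ∈ B) : Conn B u v :=
  h.restrict.mono hB

/-- Last exit from `Q`. -/
theorem last_exit (h : Conn A u v) {Q : Set Site} (hu : u ∈ Q) (hv : v ∉ Q) :
    ∃ s t, s ∈ Q ∧ Conn A u s ∧ Adj s t ∧ Conn (A \ Q) t v := by
  revert hv
  refine h.ind (P := fun v => v ∉ Q → ∃ s t, s ∈ Q ∧ Conn A u s ∧ Adj s t ∧ Conn (A \ Q) t v)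
    (fun h => absurd hu h) ?_
  intro s t hs ih hst ht htQ
  by_cases hsQ : s ∈ Q
  · exact ⟨s, t, hsQ, hs, hst, refl ⟨ht, htQ⟩⟩
  · obtain ⟨a, b, h1, h2, h3, h4⟩ := ih hsQ
    exact ⟨a, b, h1, h2, h3, h4.tail hst ⟨ht, htQ⟩⟩

/-- First exit from `Q`. -/
theorem first_exit (h : Conn A u v) {Q : Set Site} (hu : u ∈ Q) (hv : v ∉ Q) :
    ∃ s t, t ∉ Q ∧ Conn (A ∩ Q) u s ∧ Adj s t ∧ Conn A t v := by
  obtain ⟨s, t, h1, h2, h3, h4⟩ := h.symm.last_exit (Q := Qᶜ) hv (fun h => h hu)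
  refine ⟨t, s, h1, h4.symm.mono ?_, h3.symm, h2.symm⟩
  intro x hx; exact ⟨hx.1, not_not.1 hx.2⟩

end Conn

/-- A function that changes by at most one along each lattice edge. -/
def Lip (g : Site → ℤ) : Prop := ∀ a b, Adj a b → g b ≤ g a + 1

theorem Conn.ring_lower {A : Set Site} {u w : Site} {g : Site → ℤ} (hg : Lip g)
    (h : Conn A u w) {p : ℤ} (hu : g u ≤ p) (hw : p ≤ g w) :
    ∃ u', g u' = p ∧ Conn A u u' ∧ Conn (A ∩ {v | p ≤ g v}) u' w := by
  by_cases hp : g u = p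
  · by_cases hw' : w ∈ {v | g v ≤ p}
    · exact ⟨w, le_antisymm hw' hw, h, .refl ⟨h.right_mem, hw⟩⟩
    · obtain ⟨s, t, h1, h2, h3, h4⟩ := h.last_exit (Q := {v | g v ≤ p}) hu hw'
      have h5 : ¬ g t ≤ p := h4.left_mem.2
      have h6 := hg _ _ h3
      have h1' : g s ≤ p := h1
      have hs : g s = p := by omega
      have hs1 : s ∈ A ∩ {v | p ≤ g v} := ⟨h2.right_mem, hs.ge⟩
      have ht1 : t ∈ A ∩ {v | p ≤ g v} := ⟨h4.left_mem.1, (by omega : p ≤ g t)⟩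
      refine ⟨s, hs, h2, (Conn.single hs1 h3 ht1).trans (h4.mono ?_)⟩
      rintro x ⟨hx1, hx2⟩
      refine ⟨hx1, ?_⟩
      have : ¬ g x ≤ p := hx2
      simp only [Set.mem_ofPred_eq]; omega
  · obtain ⟨s, t, h1, h2, h3, h4⟩ := h.last_exit (Q := {v | g v < p})
      (by simp only [Set.mem_ofPred_eq]; omega) (by simp only [Set.mem_ofPred_eq]; omega)
    have h5 : ¬ g t < p := h4.left_mem.2
    have h6 := hg _ _ h3
    have h1' : g s < p := h1
    refine ⟨t, by omega, h2.tail h3 h4.left_mem.1, h4.mono ?_⟩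
    rintro x ⟨hx1, hx2⟩
    exact ⟨hx1, (not_lt.1 hx2 : p ≤ g x)⟩

theorem Conn.ring_upper {A : Set Site} {u w : Site} {g : Site → ℤ} (hg : Lip g)
    (h : Conn A u w) {q : ℤ} (hu : g u ≤ q) (hw : q ≤ g w) :
    ∃ w', g w' = q ∧ Conn A w' w ∧ Conn (A ∩ {v | g v ≤ q}) u w' := by
  have hg' : Lip (fun v => - g v) := by
    intro a b hab
    have := hg _ _ hab.symm
    show - g b ≤ - g a + 1
    omega
  obtain ⟨w', h1, h2, h3⟩ := h.symm.ring_lower hg' (p := -q) (by simpa using hw) (by simpa using hu)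
  refine ⟨w', by omega, h2.symm, h3.symm.mono ?_⟩
  rintro x ⟨hx, hx2⟩
  have : -q ≤ - g x := hx2
  exact ⟨hx, (by omega : g x ≤ q)⟩

/-- A path crossing the annulus `{p ≤ g ≤ q}` contains a crossing of that annulus. -/
theorem Conn.ring {A : Set Site} {u w : Site} {g : Site → ℤ} (hg : Lip g)
    (h : Conn A u w) {p q : ℤ} (hpq : p ≤ q) (hu : g u ≤ p) (hw : q ≤ g w) :
    ∃ u' w', g u' = p ∧ g w' = q ∧ Conn A u u' ∧
      Conn (A ∩ {v | p ≤ g v ∧ g v ≤ q}) u' w' := by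
  obtain ⟨w', h1, h2, h3⟩ := h.ring_upper hg (hu.trans hpq) hw
  obtain ⟨u', h4, h5, h6⟩ := h3.ring_lower hg hu (hpq.trans h1.ge)
  refine ⟨u', w', h4, h1, h5.mono Set.inter_subset_left, h6.mono ?_⟩
  rintro x ⟨⟨hx1, hx2⟩, hx3⟩
  exact ⟨hx1, hx3, hx2⟩

/-! ### Two crossing paths meet -/

theorem parity_key (s t v v' : Site)
    (hst : (t.1 = s.1 + 1 ∧ t.2 = s.2) ∨ (t.1 = s.1 - 1 ∧ t.2 = s.2) ∨
      (t.1 = s.1 ∧ t.2 = s.2 + 1) ∨ (t.1 = s.1 ∧ t.2 = s.2 - 1) ∨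
      (t.1 = s.1 + 1 ∧ t.2 = s.2 - 1) ∨ (t.1 = s.1 - 1 ∧ t.2 = s.2 + 1))
    (hx : v'.1 = v.1 + 1) (hy : v'.2 = v.2 ∨ v'.2 = v.2 - 1)
    (e1 : ¬ (v.1 = s.1 ∧ v.2 = s.2)) (e2 : ¬ (v.1 = t.1 ∧ v.2 = t.2))
    (e3 : ¬ (v'.1 = s.1 ∧ v'.2 = s.2)) (e4 : ¬ (v'.1 = t.1 ∧ v'.2 = t.2)) :
    ((if s.1 = v.1 ∧ t.1 = v.1 + 1 ∧ s.2 < v.2 then (1 : ZMod 2) else 0) +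
      (if t.1 = v.1 ∧ s.1 = v.1 + 1 ∧ t.2 < v.2 then 1 else 0)) +
      ((if s.1 = v'.1 ∧ t.1 = v'.1 + 1 ∧ s.2 < v'.2 then 1 else 0) +
      (if t.1 = v'.1 ∧ s.1 = v'.1 + 1 ∧ t.2 < v'.2 then 1 else 0)) =
      (if s.1 = v'.1 ∧ s.2 < v'.2 then 1 else 0) +
      (if t.1 = v'.1 ∧ t.2 < v'.2 then 1 else 0) := by
  by_cases h0 : t.1 = s.1
  · rw [if_neg (by omega), if_neg (by omega), if_neg (by omega), if_neg (by omega),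
      if_congr (P := s.1 = v'.1 ∧ s.2 < v'.2) (Q := t.1 = v'.1 ∧ t.2 < v'.2) (by omega) rfl rfl,
      add_zero, add_zero, CharTwo.add_self_eq_zero]
  by_cases h1 : t.1 = s.1 + 1
  · rw [if_neg (by omega : ¬ (t.1 = v.1 ∧ s.1 = v.1 + 1 ∧ t.2 < v.2)),
      if_neg (by omega : ¬ (t.1 = v'.1 ∧ s.1 = v'.1 + 1 ∧ t.2 < v'.2)), add_zero, add_zero]
    by_cases h2 : s.1 = v.1
    · rw [if_neg (by omega : ¬ (s.1 = v'.1 ∧ t.1 = v'.1 + 1 ∧ s.2 < v'.2)),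
        if_neg (by omega : ¬ (s.1 = v'.1 ∧ s.2 < v'.2)), add_zero, zero_add]
      exact if_congr (by omega) rfl rfl
    · rw [if_neg (by omega : ¬ (s.1 = v.1 ∧ t.1 = v.1 + 1 ∧ s.2 < v.2)),
        if_neg (by omega : ¬ (t.1 = v'.1 ∧ t.2 < v'.2)), add_zero, zero_add]
      exact if_congr (by omega) rfl rfl
  · rw [if_neg (by omega : ¬ (s.1 = v.1 ∧ t.1 = v.1 + 1 ∧ s.2 < v.2)),
      if_neg (by omega : ¬ (s.1 = v'.1 ∧ t.1 = v'.1 + 1 ∧ s.2 < v'.2)), zero_add, zero_add]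
    by_cases h2 : t.1 = v.1
    · rw [if_neg (by omega : ¬ (t.1 = v'.1 ∧ s.1 = v'.1 + 1 ∧ t.2 < v'.2)),
        if_neg (by omega : ¬ (t.1 = v'.1 ∧ t.2 < v'.2)), add_zero, add_zero]
      exact if_congr (by omega) rfl rfl
    · rw [if_neg (by omega : ¬ (t.1 = v.1 ∧ s.1 = v.1 + 1 ∧ t.2 < v.2)),
        if_neg (by omega : ¬ (s.1 = v'.1 ∧ s.2 < v'.2)), zero_add, zero_add]
      exact if_congr (by omega) rfl rfl

theorem parity_key_top (s t b : Site)
    (hst : (t.1 = s.1 + 1 ∧ t.2 = s.2) ∨ (t.1 = s.1 - 1 ∧ t.2 = s.2) ∨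
      (t.1 = s.1 ∧ t.2 = s.2 + 1) ∨ (t.1 = s.1 ∧ t.2 = s.2 - 1) ∨
      (t.1 = s.1 + 1 ∧ t.2 = s.2 - 1) ∨ (t.1 = s.1 - 1 ∧ t.2 = s.2 + 1))
    (e1 : s.2 ≤ b.2) (e2 : t.2 ≤ b.2)
    (e3 : ¬ (b.1 = s.1 ∧ b.2 = s.2)) (e4 : ¬ (b.1 = t.1 ∧ b.2 = t.2)) :
    ((if s.1 = b.1 ∧ t.1 = b.1 + 1 ∧ s.2 < b.2 then (1 : ZMod 2) else 0) +
      (if t.1 = b.1 ∧ s.1 = b.1 + 1 ∧ t.2 < b.2 then 1 else 0)) =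
      (if b.1 < s.1 then 1 else 0) + (if b.1 < t.1 then 1 else 0) := by
  by_cases h1 : b.1 < s.1 <;> by_cases h2 : b.1 < t.1
  · rw [if_neg (by omega), if_neg (by omega), if_pos h1, if_pos h2]; rfl
  · rw [if_neg (by omega), if_pos (by omega), if_pos h1, if_neg h2]; rfl
  · rw [if_pos (by omega), if_neg (by omega), if_neg h1, if_pos h2]; rfl
  · rw [if_neg (by omega), if_neg (by omega), if_neg h1, if_neg h2]

theorem conn_parity {A : Set Site} {a0 a1 : Site} (h : Conn A a0 a1) :
    ∃ F : Site → ZMod 2,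
      (∀ v v' : Site, v ∉ A → v' ∉ A → v'.1 = v.1 → v'.2 = v.2 + 1 → F v = F v') ∧
      (∀ v v' : Site, v ∉ A → v' ∉ A → v'.1 = v.1 + 1 → (v'.2 = v.2 ∨ v'.2 = v.2 - 1) →
        F v + F v' = (if a0.1 = v'.1 ∧ a0.2 < v'.2 then 1 else 0) +
          (if a1.1 = v'.1 ∧ a1.2 < v'.2 then 1 else 0)) ∧
      (∀ b : Site, (∀ s ∈ A, b.2 ≤ s.2) → F b = 0) ∧
      (∀ b : Site, b ∉ A → (∀ s ∈ A, s.2 ≤ b.2) →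
        F b = (if b.1 < a0.1 then 1 else 0) + (if b.1 < a1.1 then 1 else 0)) := by
  refine h.ind (P := fun a1 => ∃ F : Site → ZMod 2,
      (∀ v v' : Site, v ∉ A → v' ∉ A → v'.1 = v.1 → v'.2 = v.2 + 1 → F v = F v') ∧
      (∀ v v' : Site, v ∉ A → v' ∉ A → v'.1 = v.1 + 1 → (v'.2 = v.2 ∨ v'.2 = v.2 - 1) →
        F v + F v' = (if a0.1 = v'.1 ∧ a0.2 < v'.2 then 1 else 0) +
          (if a1.1 = v'.1 ∧ a1.2 < v'.2 then 1 else 0)) ∧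
      (∀ b : Site, (∀ s ∈ A, b.2 ≤ s.2) → F b = 0) ∧
      (∀ b : Site, b ∉ A → (∀ s ∈ A, s.2 ≤ b.2) →
        F b = (if b.1 < a0.1 then 1 else 0) + (if b.1 < a1.1 then 1 else 0))) ?_ ?_
  · refine ⟨fun _ => 0, fun _ _ _ _ _ _ => rfl, ?_, fun _ _ => rfl, ?_⟩
    · intros; rw [CharTwo.add_self_eq_zero, CharTwo.add_self_eq_zero]
    · intros; rw [CharTwo.add_self_eq_zero]
  · rintro s t hs ⟨F, h1, h2, h3, h4⟩ hst ht
    have hsA := hs.right_mem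
    rw [adj_iff] at hst
    refine ⟨fun v => F v + ((if s.1 = v.1 ∧ t.1 = v.1 + 1 ∧ s.2 < v.2 then 1 else 0) +
      (if t.1 = v.1 ∧ s.1 = v.1 + 1 ∧ t.2 < v.2 then 1 else 0)), ?_, ?_, ?_, ?_⟩
    · intro v v' hv hv' hx hy
      have e1 : v ≠ s := fun e => hv (e ▸ hsA)
      have e2 : v ≠ t := fun e => hv (e ▸ ht)
      rw [Ne, Prod.ext_iff] at e1 e2
      simp only
      rw [h1 v v' hv hv' hx hy]
      congr 2
      · congr 1; rw [eq_iff_iff]; omega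
      · congr 1; rw [eq_iff_iff]; omega
    · intro v v' hv hv' hx hy
      have e1 : v ≠ s := fun e => hv (e ▸ hsA)
      have e2 : v ≠ t := fun e => hv (e ▸ ht)
      have e3 : v' ≠ s := fun e => hv' (e ▸ hsA)
      have e4 : v' ≠ t := fun e => hv' (e ▸ ht)
      rw [Ne, Prod.ext_iff] at e1 e2 e3 e4
      have h5 := h2 v v' hv hv' hx hy
      have key := parity_key s t v v' hst hx hy e1 e2 e3 e4
      have key2 : (if s.1 = v'.1 ∧ s.2 < v'.2 then (1 : ZMod 2) else 0) +
        (if s.1 = v'.1 ∧ s.2 < v'.2 then (1 : ZMod 2) else 0) = 0 := CharTwo.add_self_eq_zero _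
      linear_combination h5 + key + key2
    · intro b hb
      have e1 := hb _ hsA
      have e2 := hb _ ht
      simp only
      rw [h3 b hb, if_neg (by omega), if_neg (by omega)]; rfl
    · intro b hbA hb
      have e1 := hb _ hsA
      have e2 := hb _ ht
      have e3 : b ≠ s := fun e => hbA (e ▸ hsA)
      have e4 : b ≠ t := fun e => hbA (e ▸ ht)
      rw [Ne, Prod.ext_iff] at e3 e4
      simp only
      rw [h4 b hbA hb]
      have key := parity_key_top s t b hst e1 e2 e3 e4
      have key2 : (if b.1 < s.1 then (1 : ZMod 2) else 0) +
        (if b.1 < s.1 then (1 : ZMod 2) else 0) = 0 := CharTwo.add_self_eq_zero _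
      linear_combination key + key2

/-- A left-right path and a bottom-top path meet. -/
theorem conn_cross {A B : Set Site} {a0 a1 b0 b1 : Site} (hA : Conn A a0 a1)
    (hB : Conn B b0 b1) (hBx : ∀ v ∈ B, a0.1 ≤ v.1 ∧ v.1 ≤ a1.1)
    (hAy : ∀ v ∈ A, b0.2 ≤ v.2 ∧ v.2 ≤ b1.2) : ∃ v, v ∈ A ∧ v ∈ B := by
  by_contra hcon
  push Not at hcon
  set e : Site := (a1.1 + 1, a1.2) with he
  set A' : Set Site := insert e A with hA'
  have hA1 : Conn A' a0 e := (hA.mono (Set.subset_insert _ _)).tail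
    (by rw [adj_iff]; left; exact ⟨rfl, rfl⟩) (Set.mem_insert _ _)
  have hdis : ∀ v ∈ B, v ∉ A' := by
    intro v hv hv'
    rcases hv' with rfl | hv'
    · have := (hBx _ hv).2
      simp [he] at this
    · exact hcon v hv' hv
  obtain ⟨F, h1, h2, h3, h4⟩ := conn_parity hA1
  have hy : ∀ v ∈ A', b0.2 ≤ v.2 ∧ v.2 ≤ b1.2 := by
    rintro v (rfl | hv)
    · exact hAy a1 hA.right_mem
    · exact hAy v hv
  have hconst : F b0 = F b1 := by
    refine hB.restrict.ind (P := fun b => F b0 = F b) rfl ?_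
    intro s t hs ih hst ht
    rw [ih]
    have hsB : s ∈ B := hs.right_mem.right_mem
    have htB : t ∈ B := ht.right_mem
    have a1' := hdis _ hsB
    have a2' := hdis _ htB
    have b1' := hBx _ hsB
    have b2' := hBx _ htB
    rw [adj_iff] at hst
    have hor : ∀ s t : Site, s ∈ B → t ∈ B → t.1 = s.1 + 1 → (t.2 = s.2 ∨ t.2 = s.2 - 1) →
        F s = F t := by
      intro s t hs ht hx hy
      have := h2 s t (hdis _ hs) (hdis _ ht) hx hy
      have c1 := hBx _ hs
      have c2 := hBx _ ht
      rw [if_neg (by omega), if_neg (by simp only [he]; omega), add_zero] at this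
      exact CharTwo.add_eq_zero.1 this
    rcases hst with h | h | h | h | h | h
    · exact hor s t hsB htB (by omega) (by omega)
    · exact (hor t s htB hsB (by omega) (by omega)).symm
    · exact h1 s t a1' a2' h.1 h.2
    · exact (h1 t s a2' a1' (by omega) (by omega)).symm
    · exact hor s t hsB htB (by omega) (by omega)
    · exact (hor t s htB hsB (by omega) (by omega)).symm
  have e0 := h3 b0 (fun s hs => (hy s hs).1)
  have e1 := h4 b1 (hdis _ hB.right_mem) (fun s hs => (hy s hs).2)
  have c := hBx _ hB.right_mem
  rw [← hconst, e0, if_neg (by omega), if_pos (by simp only [he]; omega)] at e1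
  exact absurd e1 (by decide)

/-! ### The hexagonal duality of a box -/

theorem zmod_two_telescope (g : ℕ → ZMod 2) (N : ℕ) :
    ∑ i ∈ Finset.range N, (g i + g (i + 1)) = g 0 + g N := by
  induction N with
  | zero => simp [CharTwo.add_self_eq_zero]
  | succ n ih =>
    rw [Finset.sum_range_succ, ih]
    have := CharTwo.add_self_eq_zero (g n)
    linear_combination this

section Hex

variable (O : Set Site) (x0 x1 y0 y1 : ℤ)

open Classical in
/-- Indicator of the sites of `O` joined to the left side. -/
noncomputable def hexL (v : Site) : ZMod 2 :=
  if ∃ l : Site, l.1 = x0 ∧ Conn (O ∩ rect x0 x1 y0 y1) l v then 1 else 0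

open Classical in
/-- Indicator of the sites outside `O` joined to the top side. -/
noncomputable def hexT (v : Site) : ZMod 2 :=
  if ∃ l : Site, l.2 = y1 ∧ Conn (Oᶜ ∩ rect x0 x1 y0 y1) l v then 1 else 0

/-- Bichromatic edge indicator. -/
noncomputable def hexE (u v : Site) : ZMod 2 :=
  hexL O x0 x1 y0 y1 u * hexT O x0 x1 y0 y1 v + hexT O x0 x1 y0 y1 u * hexL O x0 x1 y0 y1 v

variable {O x0 x1 y0 y1}

theorem hexL_cases (v : Site) : (hexL O x0 x1 y0 y1 v = 1 ∧ v ∈ O ∩ rect x0 x1 y0 y1) ∨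
    hexL O x0 x1 y0 y1 v = 0 := by
  unfold hexL
  split_ifs with h
  · obtain ⟨l, _, hl⟩ := h; exact Or.inl ⟨rfl, hl.right_mem⟩
  · exact Or.inr rfl

theorem hexT_cases (v : Site) : (hexT O x0 x1 y0 y1 v = 1 ∧ v ∈ Oᶜ ∩ rect x0 x1 y0 y1) ∨
    hexT O x0 x1 y0 y1 v = 0 := by
  unfold hexT
  split_ifs with h
  · obtain ⟨l, _, hl⟩ := h; exact Or.inl ⟨rfl, hl.right_mem⟩
  · exact Or.inr rfl

theorem hexL_step {u v : Site} (hu : hexL O x0 x1 y0 y1 u = 1) (huv : Adj u v)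
    (hv : v ∈ rect x0 x1 y0 y1) (hO : v ∈ O) : hexL O x0 x1 y0 y1 v = 1 := by
  unfold hexL at *
  have h : ∃ l : Site, l.1 = x0 ∧ Conn (O ∩ rect x0 x1 y0 y1) l u := by
    by_contra h; rw [if_neg h] at hu; exact absurd hu (by decide)
  obtain ⟨l, h1, h2⟩ := h
  exact if_pos ⟨l, h1, h2.tail huv ⟨hO, hv⟩⟩

theorem hexT_step {u v : Site} (hu : hexT O x0 x1 y0 y1 u = 1) (huv : Adj u v)
    (hv : v ∈ rect x0 x1 y0 y1) (hO : v ∉ O) : hexT O x0 x1 y0 y1 v = 1 := by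
  unfold hexT at *
  have h : ∃ l : Site, l.2 = y1 ∧ Conn (Oᶜ ∩ rect x0 x1 y0 y1) l u := by
    by_contra h; rw [if_neg h] at hu; exact absurd hu (by decide)
  obtain ⟨l, h1, h2⟩ := h
  exact if_pos ⟨l, h1, h2.tail huv ⟨hO, hv⟩⟩

theorem hexL_left {v : Site} (hv : v ∈ O) (hr : v ∈ rect x0 x1 y0 y1) (hx : v.1 = x0) :
    hexL O x0 x1 y0 y1 v = 1 := if_pos ⟨v, hx, .refl ⟨hv, hr⟩⟩

theorem hexT_top {v : Site} (hv : v ∉ O) (hr : v ∈ rect x0 x1 y0 y1) (hx : v.2 = y1) :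
    hexT O x0 x1 y0 y1 v = 1 := if_pos ⟨v, hx, .refl ⟨hv, hr⟩⟩

theorem hexE_triangle {u v w : Site} (huv : Adj u v) (hvw : Adj v w) (huw : Adj u w)
    (hu : u ∈ rect x0 x1 y0 y1) (hv : v ∈ rect x0 x1 y0 y1) (hw : w ∈ rect x0 x1 y0 y1) :
    hexE O x0 x1 y0 y1 u v + hexE O x0 x1 y0 y1 v w + hexE O x0 x1 y0 y1 u w = 0 := by
  have state : ∀ v, (hexL O x0 x1 y0 y1 v = 1 ∧ hexT O x0 x1 y0 y1 v = 0 ∧ v ∈ O) ∨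
      (hexL O x0 x1 y0 y1 v = 0 ∧ hexT O x0 x1 y0 y1 v = 1 ∧ v ∉ O) ∨
      (hexL O x0 x1 y0 y1 v = 0 ∧ hexT O x0 x1 y0 y1 v = 0) := by
    intro v
    rcases hexL_cases (O := O) (x0 := x0) (x1 := x1) (y0 := y0) (y1 := y1) v with h | h <;>
    rcases hexT_cases (O := O) (x0 := x0) (x1 := x1) (y0 := y0) (y1 := y1) v with h' | h'
    · exact absurd h.2.1 h'.2.1
    · exact Or.inl ⟨h.1, h', h.2.1⟩
    · exact Or.inr (Or.inl ⟨h, h'.1, h'.2.1⟩)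
    · exact Or.inr (Or.inr ⟨h, h'⟩)
  have s1 := fun h => hexL_step (O := O) (x0 := x0) (x1 := x1) (y0 := y0) (y1 := y1) h huv hv
  have s2 := fun h => hexL_step (O := O) (x0 := x0) (x1 := x1) (y0 := y0) (y1 := y1) h huv.symm hu
  have s3 := fun h => hexL_step (O := O) (x0 := x0) (x1 := x1) (y0 := y0) (y1 := y1) h hvw hw
  have s4 := fun h => hexL_step (O := O) (x0 := x0) (x1 := x1) (y0 := y0) (y1 := y1) h hvw.symm hv
  have s5 := fun h => hexL_step (O := O) (x0 := x0) (x1 := x1) (y0 := y0) (y1 := y1) h huw hw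
  have s6 := fun h => hexL_step (O := O) (x0 := x0) (x1 := x1) (y0 := y0) (y1 := y1) h huw.symm hu
  have t1 := fun h => hexT_step (O := O) (x0 := x0) (x1 := x1) (y0 := y0) (y1 := y1) h huv hv
  have t2 := fun h => hexT_step (O := O) (x0 := x0) (x1 := x1) (y0 := y0) (y1 := y1) h huv.symm hu
  have t3 := fun h => hexT_step (O := O) (x0 := x0) (x1 := x1) (y0 := y0) (y1 := y1) h hvw hw
  have t4 := fun h => hexT_step (O := O) (x0 := x0) (x1 := x1) (y0 := y0) (y1 := y1) h hvw.symm hv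
  have t5 := fun h => hexT_step (O := O) (x0 := x0) (x1 := x1) (y0 := y0) (y1 := y1) h huw hw
  have t6 := fun h => hexT_step (O := O) (x0 := x0) (x1 := x1) (y0 := y0) (y1 := y1) h huw.symm hu
  unfold hexE
  rcases state u with ⟨u1, u2, u3⟩ | ⟨u1, u2, u3⟩ | ⟨u1, u2⟩ <;>
  rcases state v with ⟨v1, v2, v3⟩ | ⟨v1, v2, v3⟩ | ⟨v1, v2⟩ <;>
  rcases state w with ⟨w1, w2, w3⟩ | ⟨w1, w2, w3⟩ | ⟨w1, w2⟩ <;>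
  simp only [u1, u2, v1, v2, w1, w2] at s1 s2 s3 s4 s5 s6 t1 t2 t3 t4 t5 t6 ⊢ <;>
  first
  | rfl
  | (exfalso; by_cases hO : u ∈ O <;> simp_all)

/-- Either a left-right crossing of the box in `O` or a bottom-top crossing in the complement. -/
theorem hex_box (O : Set Site) {x0 x1 y0 y1 : ℤ} (hx : x0 ≤ x1) (hy : y0 ≤ y1) :
    (∃ l r : Site, l.1 = x0 ∧ r.1 = x1 ∧ Conn (O ∩ rect x0 x1 y0 y1) l r) ∨
    (∃ b t : Site, b.2 = y0 ∧ t.2 = y1 ∧ Conn (Oᶜ ∩ rect x0 x1 y0 y1) b t) := by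
  by_contra hcon
  push Not at hcon
  obtain ⟨hL, hT⟩ := hcon
  set A := hexL O x0 x1 y0 y1 with hA
  set T := hexT O x0 x1 y0 y1 with hTd
  have hright : ∀ v : Site, v.1 = x1 → A v = 0 := by
    intro v hv
    refine if_neg ?_
    rintro ⟨l, hl, hc⟩
    exact hL l v hl hv hc
  have hbot : ∀ v : Site, v.2 = y0 → T v = 0 := by
    intro v hv
    refine if_neg ?_
    rintro ⟨l, hl, hc⟩
    exact hT v l hv hl hc.symm
  obtain ⟨N, rfl⟩ : ∃ N : ℕ, x1 = x0 + N := ⟨(x1 - x0).toNat, by omega⟩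
  obtain ⟨M, rfl⟩ : ∃ M : ℕ, y1 = y0 + M := ⟨(y1 - y0).toNat, by omega⟩
  set P : ℕ → ℕ → Site := fun i j => (x0 + i, y0 + j) with hP
  set E := hexE O x0 (x0 + N) y0 (y0 + M) with hE
  have hmem : ∀ i j : ℕ, i ≤ N → j ≤ M → P i j ∈ rect x0 (x0 + N) y0 (y0 + M) := by
    intro i j hi hj
    simp only [hP, rect, Set.mem_ofPred_eq]
    omega
  have hcell : ∀ i j : ℕ, i < N → j < M →
      E (P i j) (P (i + 1) j) + E (P i j) (P i (j + 1)) =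
        E (P i (j + 1)) (P (i + 1) (j + 1)) + E (P (i + 1) j) (P (i + 1) (j + 1)) := by
    intro i j hi hj
    have a1 : Adj (P i j) (P (i + 1) j) := adj_mk (by omega)
    have a2 : Adj (P (i + 1) j) (P i (j + 1)) := adj_mk (by omega)
    have a3 : Adj (P i j) (P i (j + 1)) := adj_mk (by omega)
    have a4 : Adj (P (i + 1) j) (P (i + 1) (j + 1)) := adj_mk (by omega)
    have a5 : Adj (P i (j + 1)) (P (i + 1) (j + 1)) := adj_mk (by omega)
    have t1 := hexE_triangle (O := O) a1 a2 a3 (hmem i j (by omega) (by omega))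
      (hmem (i + 1) j (by omega) (by omega)) (hmem i (j + 1) (by omega) (by omega))
    have t2 := hexE_triangle (O := O) a2 a5 a4 (hmem (i + 1) j (by omega) (by omega))
      (hmem i (j + 1) (by omega) (by omega)) (hmem (i + 1) (j + 1) (by omega) (by omega))
    have c1 := CharTwo.add_self_eq_zero (E (P (i + 1) j) (P i (j + 1)))
    have c2 := CharTwo.add_self_eq_zero (E (P i (j + 1)) (P (i + 1) (j + 1)))
    have c3 := CharTwo.add_self_eq_zero (E (P (i + 1) j) (P (i + 1) (j + 1)))
    linear_combination t1 + t2 - c1 - c2 - c3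
  have hrow : ∀ j : ℕ, j < M → (∑ i ∈ Finset.range N, E (P i j) (P (i + 1) j)) =
      (∑ i ∈ Finset.range N, E (P i (j + 1)) (P (i + 1) (j + 1))) + E (P 0 j) (P 0 (j + 1)) := by
    intro j hj
    have h1 : ∑ i ∈ Finset.range N, (E (P i j) (P (i + 1) j) + E (P i j) (P i (j + 1))) =
        ∑ i ∈ Finset.range N, (E (P i (j + 1)) (P (i + 1) (j + 1)) +
          E (P (i + 1) j) (P (i + 1) (j + 1))) :=
      Finset.sum_congr rfl fun i hi => hcell i j (Finset.mem_range.1 hi) hj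
    have h2 := zmod_two_telescope (fun i => E (P i j) (P i (j + 1))) N
    have h3 : E (P N j) (P N (j + 1)) = 0 := by
      simp only [hE, hexE]
      rw [← hA, ← hTd, hright _ rfl, hright _ rfl]; simp
    simp only [Finset.sum_add_distrib, h3] at h1 h2
    have c2 := CharTwo.add_self_eq_zero
      (∑ i ∈ Finset.range N, E (P (i + 1) j) (P (i + 1) (j + 1)))
    have c4 := CharTwo.add_self_eq_zero (E (P 0 j) (P 0 (j + 1)))
    linear_combination h1 - h2 + c2 - c4
  have htot : ∀ j : ℕ, j ≤ M → (∑ i ∈ Finset.range N, E (P i 0) (P (i + 1) 0)) =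
      (∑ i ∈ Finset.range N, E (P i j) (P (i + 1) j)) +
        ∑ k ∈ Finset.range j, E (P 0 k) (P 0 (k + 1)) := by
    intro j
    induction j with
    | zero => intro _; simp
    | succ j ih =>
      intro hj
      rw [ih (by omega), hrow j (by omega), Finset.sum_range_succ]; ring
  have h0 : (∑ i ∈ Finset.range N, E (P i 0) (P (i + 1) 0)) = 0 := by
    refine Finset.sum_eq_zero fun i _ => ?_
    simp only [hE, hexE]
    rw [← hA, ← hTd, hbot _ (by simp [hP]), hbot _ (by simp [hP])]; simp
  have hleft : ∑ k ∈ Finset.range M, E (P 0 k) (P 0 (k + 1)) = T (P 0 0) + T (P 0 M) := by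
    rw [← zmod_two_telescope (fun k => T (P 0 k)) M]
    refine Finset.sum_congr rfl fun k hk => ?_
    have hk := Finset.mem_range.1 hk
    have m1 := hmem 0 k (by omega) (by omega)
    have m2 := hmem 0 (k + 1) (by omega) (by omega)
    have a3 : Adj (P 0 k) (P 0 (k + 1)) := adj_mk (by omega)
    simp only [hE, hexE]; rw [← hA, ← hTd]
    rcases hexT_cases (O := O) (x0 := x0) (x1 := x0 + N) (y0 := y0) (y1 := y0 + M) (P 0 k) with h | h <;>
    rcases hexT_cases (O := O) (x0 := x0) (x1 := x0 + N) (y0 := y0) (y1 := y0 + M) (P 0 (k + 1))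
      with h' | h'
    · rcases hexL_cases (O := O) (x0 := x0) (x1 := x0 + N) (y0 := y0) (y1 := y0 + M) (P 0 k) with g | g
      · exact absurd g.2.1 h.2.1
      rcases hexL_cases (O := O) (x0 := x0) (x1 := x0 + N) (y0 := y0) (y1 := y0 + M) (P 0 (k + 1))
        with g' | g'
      · exact absurd g'.2.1 h'.2.1
      simp only [hTd, hA, h.1, h'.1, g, g']; rfl
    · have hO : P 0 (k + 1) ∈ O := by
        by_contra hO
        have := hexT_step h.1 a3 m2 hO
        rw [h'] at this; exact absurd this (by decide)
      have := hexL_left hO m2 (by simp [hP])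
      simp only [hTd, hA, h.1, h', this]; simp
    · have hO : P 0 k ∈ O := by
        by_contra hO
        have := hexT_step h'.1 a3.symm m1 hO
        rw [h] at this; exact absurd this (by decide)
      have := hexL_left hO m1 (by simp [hP])
      simp only [hTd, hA, h, h'.1, this]; simp
    · simp only [hTd, h, h']; simp
  have htop : ∑ k ∈ Finset.range N, E (P k M) (P (k + 1) M) = A (P 0 M) + A (P N M) := by
    rw [← zmod_two_telescope (fun k => A (P k M)) N]
    refine Finset.sum_congr rfl fun k hk => ?_
    have hk := Finset.mem_range.1 hk
    have m1 := hmem k M (by omega) (by omega)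
    have m2 := hmem (k + 1) M (by omega) (by omega)
    have a3 : Adj (P k M) (P (k + 1) M) := adj_mk (by omega)
    simp only [hE, hexE]; rw [← hA, ← hTd]
    rcases hexL_cases (O := O) (x0 := x0) (x1 := x0 + N) (y0 := y0) (y1 := y0 + M) (P k M) with h | h <;>
    rcases hexL_cases (O := O) (x0 := x0) (x1 := x0 + N) (y0 := y0) (y1 := y0 + M) (P (k + 1) M)
      with h' | h'
    · rcases hexT_cases (O := O) (x0 := x0) (x1 := x0 + N) (y0 := y0) (y1 := y0 + M) (P k M) with g | g
      · exact absurd h.2.1 g.2.1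
      rcases hexT_cases (O := O) (x0 := x0) (x1 := x0 + N) (y0 := y0) (y1 := y0 + M) (P (k + 1) M)
        with g' | g'
      · exact absurd h'.2.1 g'.2.1
      simp only [hTd, hA, h.1, h'.1, g, g']; rfl
    · have hO : P (k + 1) M ∉ O := by
        intro hO
        have := hexL_step h.1 a3 m2 hO
        rw [h'] at this; exact absurd this (by decide)
      have := hexT_top hO m2 (by simp [hP])
      simp only [hTd, hA, h.1, h', this]; simp
    · have hO : P k M ∉ O := by
        intro hO
        have := hexL_step h'.1 a3.symm m1 hO
        rw [h] at this; exact absurd this (by decide)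
      have := hexT_top hO m1 (by simp [hP])
      simp only [hTd, hA, h, h'.1, this]; simp
    · simp only [hA, h, h']; simp
  have hfin := htot M le_rfl
  rw [h0, hleft, htop, hbot (P 0 0) (by simp [hP]), hright (P N M) (by simp [hP])] at hfin
  have m := hmem 0 M (by omega) (by omega)
  by_cases hO : P 0 M ∈ O
  · have e1 : A (P 0 M) = 1 := hexL_left hO m (by simp [hP])
    rcases hexT_cases (O := O) (x0 := x0) (x1 := x0 + N) (y0 := y0) (y1 := y0 + M) (P 0 M) with g | g
    · exact absurd hO g.2.1
    · rw [e1, hTd, g] at hfin; exact absurd hfin (by decide)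
  · have e1 : T (P 0 M) = 1 := hexT_top hO m (by simp [hP])
    rcases hexL_cases (O := O) (x0 := x0) (x1 := x0 + N) (y0 := y0) (y1 := y0 + M) (P 0 M) with g | g
    · exact absurd g.2.1 hO
    · rw [e1, hA, g] at hfin; exact absurd hfin (by decide)

end Hex

/-! ### Local events of the product measure -/

/-- `E` only depends on the coordinates in `A`. -/
def Dep (A : Set Site) (E : Set Config) : Prop :=
  ∀ ω ω' : Config, (∀ v ∈ A, ω v = ω' v) → ω ∈ E → ω' ∈ E

namespace Dep

variable {A B : Set Site} {E F : Set Config}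

theorem mono (h : Dep A E) (hAB : A ⊆ B) : Dep B E :=
  fun ω ω' h' => h ω ω' fun v hv => h' v (hAB hv)

theorem compl (h : Dep A E) : Dep A Eᶜ :=
  fun ω ω' h' hE hE' => hE (h ω' ω (fun v hv => (h' v hv).symm) hE')

theorem inter (h : Dep A E) (h' : Dep A F) : Dep A (E ∩ F) :=
  fun ω ω' hh hE => ⟨h ω ω' hh hE.1, h' ω ω' hh hE.2⟩

theorem univ : Dep A Set.univ := fun _ _ _ _ => trivial

end Dep

/-- Events which depend on finitely many sites. -/
def Loc (E : Set Config) : Prop := ∃ A : Set Site, A.Finite ∧ Dep A E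

theorem Dep.loc {A : Set Site} {E : Set Config} (h : Dep A E) (hA : A.Finite) : Loc E := ⟨A, hA, h⟩

namespace Loc

variable {E F : Set Config}

theorem compl (h : Loc E) : Loc Eᶜ := by
  obtain ⟨A, hA, h⟩ := h; exact ⟨A, hA, h.compl⟩

theorem inter (h : Loc E) (h' : Loc F) : Loc (E ∩ F) := by
  obtain ⟨A, hA, h⟩ := h; obtain ⟨B, hB, h'⟩ := h'
  exact ⟨A ∪ B, hA.union hB, (h.mono Set.subset_union_left).inter (h'.mono Set.subset_union_right)⟩

theorem union (h : Loc E) (h' : Loc F) : Loc (E ∪ F) := by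
  have := (h.compl.inter h'.compl).compl
  rwa [← Set.compl_union, compl_compl] at this

theorem univ : Loc Set.univ := ⟨∅, Set.finite_empty, Dep.univ⟩

end Loc

/-- The restriction of a configuration to a finite set. -/
def restr (A : Finset Site) (ω : Config) : A → Bool := fun v => ω v

/-- The extension by `false` of a partial configuration. -/
def extendFalse (A : Finset Site) (f : A → Bool) : Config :=
  fun v => if h : v ∈ A then f ⟨v, h⟩ else false

theorem extendFalse_restr_mem {A : Finset Site} {E : Set Config} (h : Dep A E) (ω : Config) :
    extendFalse A (restr A ω) ∈ E ↔ ω ∈ E := by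
  constructor
  · apply h; intro v hv; simp only [Finset.mem_coe] at hv; simp [extendFalse, restr, hv]
  · apply h; intro v hv; simp only [Finset.mem_coe] at hv; simp [extendFalse, restr, hv]

theorem measurable_restr (A : Finset Site) : Measurable (restr A) :=
  measurable_pi_iff.2 fun v => measurable_pi_apply (v : Site)

theorem Loc.measurableSet {E : Set Config} (h : Loc E) : MeasurableSet E := by
  obtain ⟨A, hA, h⟩ := h
  lift A to Finset Site using hA
  have : E = restr A ⁻¹' {f | extendFalse A f ∈ E} := by
    ext ω; exact (extendFalse_restr_mem h ω).symm
  rw [this]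
  exact measurable_restr A (Set.toFinite _).measurableSet

section Prob

variable {μ : Measure Config}

/-- Decomposition over the values of a local random variable. -/
theorem prob_partition [IsProbabilityMeasure μ] {ι : Type*} (S : Finset ι) (X : Config → ι)
    (hX : ∀ ω, X ω ∈ S) (hm : ∀ i ∈ S, MeasurableSet {ω | X ω = i}) {E : Set Config}
    (hE : MeasurableSet E) : μ.real E = ∑ i ∈ S, μ.real (E ∩ {ω | X ω = i}) := by
  rw [← measureReal_biUnion_finset]
  · congr 1; ext ω
    simp only [Set.mem_iUnion, Set.mem_inter_iff]
    exact ⟨fun h => ⟨X ω, hX ω, h, rfl⟩, fun ⟨_, _, h, _⟩ => h⟩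
  · intro i _ j _ hij
    rw [Function.onFun, Set.disjoint_left]
    rintro ω ⟨_, h1⟩ ⟨_, h2⟩
    exact hij (h1.symm.trans h2)
  · exact fun i hi => hE.inter (hm i hi)

theorem measurableSet_restr_eq (A : Finset Site) (f : A → Bool) :
    MeasurableSet {ω | restr A ω = f} :=
  measurable_restr A (measurableSet_singleton f)

theorem prob_cylinder (hμ : IsBernoulliHalf μ) (A : Finset Site) (f : A → Bool) :
    μ.real {ω | restr A ω = f} = (1 / 2) ^ A.card := by
  have h : {ω : Config | restr A ω = f} = {ω | ∀ v ∈ A, ω v = extendFalse A f v} := by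
    ext ω
    simp only [Set.mem_ofPred_eq]
    constructor
    · rintro rfl v hv; simp [extendFalse, restr, hv]
    · intro h; funext v; rw [restr, h v v.2]; simp [extendFalse]
  rw [h, measureReal_def, hμ.2]
  simp

open Classical in
/-- The probability of a local event counts configurations. -/
theorem prob_eq_count (hμ : IsBernoulliHalf μ) {A : Finset Site} {E : Set Config} (hE : Dep A E) :
    μ.real E = (1 / 2) ^ A.card * ∑ f : A → Bool, (if extendFalse A f ∈ E then (1 : ℝ) else 0) := by
  have := hμ.1
  rw [prob_partition Finset.univ (restr A) (fun _ => Finset.mem_univ _)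
    (fun f _ => measurableSet_restr_eq A f) (hE.loc A.finite_toSet).measurableSet, Finset.mul_sum]
  refine Finset.sum_congr rfl fun f _ => ?_
  split_ifs with h
  · rw [mul_one, ← prob_cylinder hμ A f]
    congr 1; ext ω
    simp only [Set.mem_inter_iff, Set.mem_ofPred_eq, and_iff_right_iff_imp]
    rintro rfl
    exact (extendFalse_restr_mem hE ω).1 h
  · rw [mul_zero]
    convert measureReal_empty
    rw [Set.eq_empty_iff_forall_notMem]
    rintro ω ⟨h1, rfl⟩
    exact h ((extendFalse_restr_mem hE ω).2 h1)

theorem prob_eq_of_isBernoulliHalf {ν : Measure Config} (hμ : IsBernoulliHalf μ)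
    (hν : IsBernoulliHalf ν) {E : Set Config} (hE : Loc E) : μ.real E = ν.real E := by
  obtain ⟨A, hA, h⟩ := hE
  lift A to Finset Site using hA
  rw [prob_eq_count hμ h, prob_eq_count hν h]

/-- Relabelling of the sites, possibly with exchange of the colours. -/
def relabel (φ : Equiv.Perm Site) (b : Bool) (ω : Config) : Config := fun v => xor b (ω (φ v))

theorem prob_relabel (hμ : IsBernoulliHalf μ) (φ : Equiv.Perm Site) (b : Bool) {E : Set Config}
    (hE : Loc E) : μ.real (relabel φ b ⁻¹' E) = μ.real E := by
  have := hμ.1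
  have hmeas : Measurable (relabel φ b) := by
    refine measurable_pi_iff.2 fun v => ?_
    exact (measurable_of_finite (fun c : Bool => xor b c)).comp (measurable_pi_apply (φ v))
  have hν : IsBernoulliHalf (μ.map (relabel φ b)) := by
    refine ⟨Measure.isProbabilityMeasure_map hmeas.aemeasurable, fun S f => ?_⟩
    have hS : MeasurableSet {ω : Config | ∀ v ∈ S, ω v = f v} := by
      refine Loc.measurableSet ⟨S, S.finite_toSet, ?_⟩
      intro ω ω' h h' v hv
      rw [← h v hv]; exact h' v hv
    rw [Measure.map_apply hmeas hS]
    have : relabel φ b ⁻¹' {ω : Config | ∀ v ∈ S, ω v = f v} =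
        {ω | ∀ u ∈ S.map φ.toEmbedding, ω u = xor b (f (φ.symm u))} := by
      ext ω
      simp only [Set.mem_preimage, Set.mem_ofPred_eq, Finset.mem_map, Equiv.coe_toEmbedding,
        forall_exists_index, and_imp, forall_apply_eq_imp_iff₂, Equiv.symm_apply_apply, relabel]
      refine forall₂_congr fun v _ => ?_
      cases b <;> cases ω (φ v) <;> cases f v <;> simp
    rw [this, hμ.2, Finset.card_map]
  rw [prob_eq_of_isBernoulliHalf hμ hν hE, measureReal_def, measureReal_def,
    Measure.map_apply hmeas hE.measurableSet]

/-- Events depending on disjoint sets of sites are independent. -/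
theorem prob_inter_of_disjoint (hμ : IsBernoulliHalf μ) {A B : Set Site} (hA : A.Finite)
    (hB : B.Finite) (hAB : Disjoint A B) {E F : Set Config} (hE : Dep A E) (hF : Dep B F) :
    μ.real (E ∩ F) = μ.real E * μ.real F := by
  classical
  have := hμ.1
  lift A to Finset Site using hA
  lift B to Finset Site using hB
  have hEm := (hE.loc A.finite_toSet).measurableSet
  have hFm := (hF.loc B.finite_toSet).measurableSet
  have hdis : Disjoint A B := by exact_mod_cast hAB
  have hcyl : ∀ (f : A → Bool) (g : B → Bool),
      μ.real ({ω | restr A ω = f} ∩ {ω | restr B ω = g}) = (1 / 2) ^ A.card * (1 / 2) ^ B.card := by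
    intro f g
    have h1 : {ω | restr A ω = f} ∩ {ω | restr B ω = g} = {ω | ∀ v ∈ A ∪ B, ω v =
        (if v ∈ A then extendFalse A f v else extendFalse B g v)} := by
      ext ω
      simp only [Set.mem_inter_iff, Set.mem_ofPred_eq]
      constructor
      · rintro ⟨rfl, rfl⟩ v hv
        split_ifs with h
        · simp [extendFalse, restr, h]
        · have : v ∈ B := (Finset.mem_union.1 hv).resolve_left h
          simp [extendFalse, restr, this]
      · intro h
        constructor
        · funext v
          rw [restr, h v (Finset.mem_union_left _ v.2), if_pos v.2]; simp [extendFalse]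
        · funext v
          rw [restr, h v (Finset.mem_union_right _ v.2),
            if_neg (Finset.disjoint_right.1 hdis v.2)]; simp [extendFalse]
    rw [h1, measureReal_def, hμ.2, Finset.card_union_of_disjoint hdis]
    simp [pow_add]
  have hmain : μ.real (E ∩ F) = ∑ f : A → Bool, ∑ g : B → Bool,
      μ.real (E ∩ F ∩ {ω | restr A ω = f} ∩ {ω | restr B ω = g}) := by
    rw [prob_partition Finset.univ (restr A) (fun _ => Finset.mem_univ _)
      (fun f _ => measurableSet_restr_eq A f) (hEm.inter hFm)]
    refine Finset.sum_congr rfl fun f _ => ?_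
    exact prob_partition Finset.univ (restr B) (fun _ => Finset.mem_univ _)
      (fun f _ => measurableSet_restr_eq B f) ((hEm.inter hFm).inter (measurableSet_restr_eq A f))
  rw [hmain, prob_eq_count hμ hE, prob_eq_count hμ hF]
  rw [mul_mul_mul_comm, Finset.sum_mul_sum, Finset.mul_sum]
  refine Finset.sum_congr rfl fun f _ => ?_
  rw [Finset.mul_sum]
  refine Finset.sum_congr rfl fun g _ => ?_
  by_cases h1 : extendFalse A f ∈ E
  · by_cases h2 : extendFalse B g ∈ F
    · rw [if_pos h1, if_pos h2, mul_one, mul_one, ← hcyl f g]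
      congr 1; ext ω
      simp only [Set.mem_inter_iff, Set.mem_ofPred_eq]
      constructor
      · rintro ⟨⟨_, h3⟩, h4⟩; exact ⟨h3, h4⟩
      · rintro ⟨rfl, rfl⟩
        exact ⟨⟨⟨(extendFalse_restr_mem hE ω).1 h1, (extendFalse_restr_mem hF ω).1 h2⟩, rfl⟩, rfl⟩
    · rw [if_neg h2, mul_zero, mul_zero]
      convert measureReal_empty
      rw [Set.eq_empty_iff_forall_notMem]
      rintro ω ⟨⟨⟨_, h3⟩, _⟩, rfl⟩
      exact h2 ((extendFalse_restr_mem hF ω).2 h3)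
  · rw [if_neg h1, zero_mul, mul_zero]
    convert measureReal_empty
    rw [Set.eq_empty_iff_forall_notMem]
    rintro ω ⟨⟨⟨h3, _⟩, rfl⟩, _⟩
    exact h1 ((extendFalse_restr_mem hE ω).2 h3)

/-- `E` is increasing in the coordinates of `A`. -/
def Inc (A : Set Site) (E : Set Config) : Prop :=
  ∀ ω ω' : Config, (∀ v ∈ A, ω v = true → ω' v = true) → (∀ v, v ∉ A → ω v = ω' v) →
    ω ∈ E → ω' ∈ E

/-- `E` is decreasing in the coordinates of `A`. -/
def Decr (A : Set Site) (E : Set Config) : Prop :=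
  ∀ ω ω' : Config, (∀ v ∈ A, ω v = false → ω' v = false) → (∀ v, v ∉ A → ω v = ω' v) →
    ω ∈ E → ω' ∈ E

theorem harris_aux (hμ : IsBernoulliHalf μ) {A : Finset Site} {E F : Set Config}
    (hE : Dep A E) (hF : Dep A F) (hEi : Inc A E) (hFi : Inc A F) :
    μ.real E * μ.real F ≤ μ.real (E ∩ F) := by
  classical
  have hmono : ∀ {E : Set Config}, Inc A E →
      Monotone (fun f : A → Bool => if extendFalse A f ∈ E then (1 : ℝ) else 0) := by
    intro E hE f g hfg
    simp only
    split_ifs with h1 h2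
    · exact le_rfl
    · refine absurd (hE _ _ ?_ ?_ h1) h2
      · intro v hv h
        have hv' : v ∈ A := hv
        simp only [extendFalse, hv', dif_pos] at h ⊢
        have := hfg ⟨v, hv'⟩
        rw [h] at this
        exact top_le_iff.1 this
      · intro v hv
        have hv' : v ∉ A := hv
        simp [extendFalse, hv']
    · exact zero_le_one
    · exact le_rfl
  have hnn : ∀ E : Set Config, (0 : (A → Bool) → ℝ) ≤ fun f => if extendFalse A f ∈ E then (1 : ℝ) else 0 := by
    intro E f; simp only [Pi.zero_apply]; split_ifs <;> simp
  have key := fkg (α := A → Bool) (μ := fun _ => (1 : ℝ)) (hμ₀ := fun _ => zero_le_one) (hf₀ := hnn E) (hg₀ := hnn F)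
    (hf := hmono hEi) (hg := hmono hFi) (hμ := fun _ _ => le_rfl)
  rw [prob_eq_count hμ hE, prob_eq_count hμ hF, prob_eq_count hμ (hE.inter hF)]
  have hcard : ∑ _a : A → Bool, (1 : ℝ) = 2 ^ A.card := by simp
  simp only [one_mul, hcard] at key
  have e : ∑ a : A → Bool, ((if extendFalse A a ∈ E then (1 : ℝ) else 0) * if extendFalse A a ∈ F then 1 else 0) =
      ∑ f : A → Bool, @ite ℝ (extendFalse A f ∈ E ∩ F) (Classical.propDecidable _) 1 0 := by
    refine Finset.sum_congr rfl fun f _ => ?_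
    by_cases h1 : extendFalse A f ∈ E <;> by_cases h2 : extendFalse A f ∈ F <;> simp [h1, h2]
  rw [e] at key
  have hp : (0 : ℝ) < (1 / 2) ^ A.card := by positivity
  have h2 : (1 / 2 : ℝ) ^ A.card * 2 ^ A.card = 1 := by rw [← mul_pow]; norm_num
  calc _ = (1 / 2 : ℝ) ^ A.card * (1 / 2) ^ A.card *
        ((∑ f : A → Bool, if extendFalse A f ∈ E then (1 : ℝ) else 0) *
          ∑ f : A → Bool, if extendFalse A f ∈ F then (1 : ℝ) else 0) := by ring
    _ ≤ (1 / 2 : ℝ) ^ A.card * (1 / 2) ^ A.card *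
        (2 ^ A.card * ∑ f : A → Bool, @ite ℝ (extendFalse A f ∈ E ∩ F) (Classical.propDecidable _) 1 0) := by gcongr
    _ = _ := by linear_combination ((1 / 2 : ℝ) ^ A.card *
        ∑ f : A → Bool, @ite ℝ (extendFalse A f ∈ E ∩ F) (Classical.propDecidable _) 1 0) * h2

/-- Harris' inequality, where one of the events may depend on further sites. -/
theorem harris (hμ : IsBernoulliHalf μ) {A : Set Site} (hA : A.Finite) {E F : Set Config}
    (hE : Loc E) (hF : Dep A F) (hEi : Inc A E) (hFi : Inc A F) :
    μ.real E * μ.real F ≤ μ.real (E ∩ F) := by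
  classical
  have := hμ.1
  obtain ⟨C, hC, hE⟩ := hE
  lift A to Finset Site using hA
  lift C to Finset Site using hC
  set B : Finset Site := C \ A with hB
  have hEm := (hE.loc C.finite_toSet).measurableSet
  have hFm := (hF.loc A.finite_toSet).measurableSet
  set ov : (B → Bool) → Config → Config := fun f ω v => if v ∈ B then extendFalse B f v else ω v with hov
  have hfix : ∀ ω, ov (restr B ω) ω = ω := by
    intro ω; funext v
    simp only [hov]
    split_ifs with h
    · simp [extendFalse, restr, h]
    · rfl
  have hdep : ∀ f, Dep A (ov f ⁻¹' E) := by
    intro f ω ω' h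
    apply hE
    intro v hv
    simp only [hov]
    split_ifs with h'
    · rfl
    · refine h v ?_
      simp only [hB, Finset.mem_sdiff, not_and, not_not] at h'
      exact h' hv
  have hdepB : ∀ f : B → Bool, Dep B {ω | restr B ω = f} := by
    rintro f ω ω' h rfl
    funext v
    exact (h v v.2).symm
  have hdis : Disjoint (A : Set Site) B := by
    rw [Finset.disjoint_coe]; exact Finset.disjoint_sdiff
  have hinc : ∀ f, Inc A (ov f ⁻¹' E) := by
    intro f ω ω' h1 h2
    apply hEi
    · intro v hv
      have : v ∉ B := fun h => Set.disjoint_left.1 hdis hv h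
      simp only [hov, if_neg this]; exact h1 v hv
    · intro v hv
      simp only [hov]
      split_ifs
      · rfl
      · exact h2 v hv
  have e1 : ∀ (f : B → Bool), E ∩ {ω | restr B ω = f} = (ov f ⁻¹' E) ∩ {ω | restr B ω = f} := by
    intro f; ext ω
    simp only [Set.mem_inter_iff, Set.mem_ofPred_eq, Set.mem_preimage]
    refine and_congr_left ?_
    rintro rfl; rw [hfix]
  rw [prob_partition Finset.univ (restr B) (fun _ => Finset.mem_univ _)
      (fun f _ => measurableSet_restr_eq B f) hEm,
    prob_partition Finset.univ (restr B) (fun _ => Finset.mem_univ _)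
      (fun f _ => measurableSet_restr_eq B f) (hEm.inter hFm), Finset.sum_mul]
  refine Finset.sum_le_sum fun f _ => ?_
  have e2 : E ∩ F ∩ {ω | restr B ω = f} = (ov f ⁻¹' E ∩ F) ∩ {ω | restr B ω = f} := by
    rw [Set.inter_right_comm, e1, Set.inter_right_comm]
  rw [e1, e2, prob_inter_of_disjoint hμ A.finite_toSet B.finite_toSet hdis (hdep f) (hdepB f),
    prob_inter_of_disjoint hμ A.finite_toSet B.finite_toSet hdis ((hdep f).inter hF) (hdepB f)]
  have := harris_aux hμ (hdep f) hF (hinc f) hFi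
  have h0 : 0 ≤ μ.real {ω | restr B ω = f} := measureReal_nonneg
  nlinarith

theorem harris_decr (hμ : IsBernoulliHalf μ) {A : Set Site} (hA : A.Finite) {E F : Set Config}
    (hE : Loc E) (hF : Dep A F) (hEi : Decr A E) (hFi : Decr A F) :
    μ.real E * μ.real F ≤ μ.real (E ∩ F) := by
  have hFl := hF.loc hA
  have hr : ∀ ω v, relabel (Equiv.refl Site) true ω v = !(ω v) := by intro ω v; simp [relabel]
  have hdep : ∀ {A : Set Site} {E : Set Config}, Dep A E →
      Dep A (relabel (Equiv.refl Site) true ⁻¹' E) := by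
    intro A E hE ω ω' h
    apply hE; intro v hv; rw [hr, hr, h v hv]
  have hinc : ∀ {E : Set Config}, Decr A E → Inc A (relabel (Equiv.refl Site) true ⁻¹' E) := by
    intro E hE ω ω' h1 h2
    apply hE
    · intro v hv; rw [hr, hr]; simpa using h1 v hv
    · intro v hv; rw [hr, hr, h2 v hv]
  have hEl : Loc (relabel (Equiv.refl Site) true ⁻¹' E) := by
    obtain ⟨C, hC, h⟩ := hE; exact ⟨C, hC, hdep h⟩
  have := harris hμ hA hEl (hdep hF) (hinc hEi) (hinc hFi)
  rwa [← Set.preimage_inter, prob_relabel hμ _ _ hE, prob_relabel hμ _ _ hFl,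
    prob_relabel hμ _ _ (hE.inter hFl)] at this

end Prob

/-- Closed sites. -/
def cl (ω : Config) : Set Site := {v | ω v = false}

/-- Open sites. -/
def op (ω : Config) : Set Site := {v | ω v = true}

theorem mem_cl {ω : Config} {v : Site} : v ∈ cl ω ↔ ω v = false := Iff.rfl

theorem mem_op {ω : Config} {v : Site} : v ∈ op ω ↔ ω v = true := Iff.rfl

theorem not_mem_cl {ω : Config} {v : Site} : v ∉ cl ω ↔ v ∈ op ω := by
  rw [mem_cl, mem_op]; simp

theorem dep_cl (R : Set Site) (Q : Set Site → Prop) : Dep R {ω | Q (cl ω ∩ R)} := by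
  intro ω ω' h hQ
  have : cl ω ∩ R = cl ω' ∩ R := by
    ext v
    simp only [Set.mem_inter_iff, mem_cl, and_congr_left_iff]
    intro hv; rw [h v hv]
  simpa only [Set.mem_ofPred_eq, this] using hQ

theorem dep_op (R : Set Site) (Q : Set Site → Prop) : Dep R {ω | Q (op ω ∩ R)} := by
  intro ω ω' h hQ
  have : op ω ∩ R = op ω' ∩ R := by
    ext v
    simp only [Set.mem_inter_iff, mem_op, and_congr_left_iff]
    intro hv; rw [h v hv]
  simpa only [Set.mem_ofPred_eq, this] using hQ

theorem rect_finite (x0 x1 y0 y1 : ℤ) : (rect x0 x1 y0 y1).Finite := by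
  refine ((Set.finite_Icc x0 x1).prod (Set.finite_Icc y0 y1)).subset ?_
  rintro ⟨x, y⟩ ⟨h1, h2, h3, h4⟩
  exact ⟨⟨h1, h2⟩, ⟨h3, h4⟩⟩

theorem Conn.map {A B : Set Site} {u v : Site} {φ : Site → Site}
    (hφ : ∀ a b, Adj a b → Adj (φ a) (φ b)) (h : Conn A u v) (hAB : ∀ a ∈ A, φ a ∈ B) :
    Conn B (φ u) (φ v) := by
  refine h.ind (P := fun v => Conn B (φ u) (φ v)) (.refl (hAB _ h.left_mem)) ?_
  intro s t _ ih hst ht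
  exact ih.tail (hφ _ _ hst) (hAB _ ht)

theorem adj_add (d : Site) (a b : Site) (h : Adj a b) : Adj (a + d) (b + d) := by
  rw [adj_iff] at *; simp only [Prod.fst_add, Prod.snd_add]; omega

/-- A horizontal segment is connected. -/
theorem conn_row {A : Set Site} {x x' y : ℤ} (hx : x ≤ x')
    (hA : ∀ z, x ≤ z → z ≤ x' → (z, y) ∈ A) : Conn A (x, y) (x', y) := by
  obtain ⟨N, rfl⟩ : ∃ N : ℕ, x' = x + N := ⟨(x' - x).toNat, by omega⟩
  induction N with
  | zero => simpa using Conn.refl (hA x le_rfl (by simp))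
  | succ N ih =>
    refine (ih (by omega) fun z h1 h2 => hA z h1 (by push_cast; omega)).tail ?_
      (hA _ hx le_rfl)
    exact adj_mk (by omega)

/-- A vertical segment is connected. -/
theorem conn_col {A : Set Site} {x y y' : ℤ} (hy : y ≤ y')
    (hA : ∀ z, y ≤ z → z ≤ y' → (x, z) ∈ A) : Conn A (x, y) (x, y') := by
  obtain ⟨N, rfl⟩ : ∃ N : ℕ, y' = y + N := ⟨(y' - y).toNat, by omega⟩
  induction N with
  | zero => simpa using Conn.refl (hA y le_rfl (by simp))
  | succ N ih =>
    refine (ih (by omega) fun z h1 h2 => hA z h1 (by push_cast; omega)).tail ?_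
      (hA _ hy le_rfl)
    exact adj_mk (by omega)

/-! ### Exploration of the closed clusters of a set -/

/-- The union of the closed clusters in `D` of the sites of `Z`. -/
def clusters (D Z : Set Site) (ω : Config) : Set Site :=
  {v | ∃ z ∈ Z, Conn (cl ω ∩ D) z v}

/-- Sites inspected by an exploration from `Z` that found the set `K`. -/
def inspected (D Z K : Set Site) : Set Site :=
  (Z ∩ D) ∪ K ∪ {v | v ∈ D ∧ ∃ k ∈ K, Adj k v}

theorem clusters_subset {D Z : Set Site} {ω : Config} : clusters D Z ω ⊆ cl ω ∩ D := by
  rintro v ⟨z, _, h⟩; exact h.right_mem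

theorem inspected_subset {D Z K : Set Site} (hK : K ⊆ D) : inspected D Z K ⊆ D := by
  rintro v ((h | h) | h)
  · exact h.2
  · exact hK h
  · exact h.1

theorem clusters_eq_of_agree {D Z : Set Site} {ω ω' : Config}
    (h : ∀ v ∈ inspected D Z (clusters D Z ω), ω v = ω' v) :
    clusters D Z ω' = clusters D Z ω := by
  apply Set.Subset.antisymm
  · rintro v ⟨z, hz, hc⟩
    refine hc.ind (P := fun v => v ∈ clusters D Z ω) ?_ ?_
    · have h1 := hc.left_mem
      have h2 : z ∈ cl ω ∩ D := by
        refine ⟨?_, h1.2⟩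
        rw [mem_cl, h z (Or.inl (Or.inl ⟨hz, h1.2⟩))]; exact h1.1
      exact ⟨z, hz, .refl h2⟩
    · rintro s t _ ⟨z', hz', hs⟩ hst ht
      refine ⟨z', hz', hs.tail hst ⟨?_, ht.2⟩⟩
      rw [mem_cl, h t (Or.inr ⟨ht.2, s, ⟨z', hz', hs⟩, hst⟩)]; exact ht.1
  · rintro v ⟨z, hz, hc⟩
    refine ⟨z, hz, hc.restrict' fun w hw => ⟨?_, hw.right_mem.2⟩⟩
    rw [mem_cl, ← h w (Or.inl (Or.inr ⟨z, hz, hw⟩))]; exact hw.right_mem.1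

theorem dep_clusters_eq (D Z K : Set Site) : Dep (inspected D Z K) {ω | clusters D Z ω = K} := by
  rintro ω ω' h rfl
  exact clusters_eq_of_agree h

/-- Inspected sites which are not in a closed cluster are open. -/
theorem open_of_inspected {D Z : Set Site} {ω : Config} {v : Site}
    (h : v ∈ inspected D Z (clusters D Z ω)) (h' : v ∉ clusters D Z ω) : v ∈ op ω := by
  by_contra ho
  rw [← not_mem_cl, not_not] at ho
  rcases h with (h | h) | ⟨h, k, ⟨z, hz, hk⟩, hkv⟩
  · exact h' ⟨v, h.1, .refl ⟨ho, h.2⟩⟩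
  · exact h' h
  · exact h' ⟨z, hz, hk.tail hkv ⟨ho, h⟩⟩

theorem prob_partition_clusters {μ : Measure Config} (hμ : IsBernoulliHalf μ) {D : Set Site}
    (hD : D.Finite) (Z : Set Site) {E : Set Config} (hE : Loc E) :
    μ.real E = ∑ K ∈ hD.finite_subsets.toFinset, μ.real (E ∩ {ω | clusters D Z ω = K}) := by
  have := hμ.1
  refine prob_partition _ (clusters D Z) ?_ ?_ hE.measurableSet
  · intro ω
    simp only [Set.Finite.mem_toFinset, Set.mem_ofPred_eq]
    exact clusters_subset.trans Set.inter_subset_right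
  · intro K hK
    simp only [Set.Finite.mem_toFinset, Set.mem_ofPred_eq] at hK
    exact ((dep_clusters_eq D Z K).loc (hD.subset (inspected_subset hK))).measurableSet

/-! ### Russo–Seymour–Welsh in strips -/

/-- Twice the Euclidean abscissa of a site of the triangular lattice. -/
def hor (v : Site) : ℤ := 2 * v.1 + v.2

/-- The set of sites with `0 ≤ y ≤ h` and `a ≤ 2x + y ≤ b`. -/
def strip (a b h : ℤ) : Set Site := {v | 0 ≤ v.2 ∧ v.2 ≤ h ∧ a ≤ hor v ∧ hor v ≤ b}

theorem strip_finite (a b h : ℤ) : (strip a b h).Finite := by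
  refine (rect_finite (-(|a| + |h|)) (|b| + |h|) 0 h).subset ?_
  rintro ⟨x, y⟩ ⟨h1, h2, h3, h4⟩
  simp only [hor] at *
  have := neg_abs_le a; have := le_abs_self b; have := le_abs_self h; have := abs_nonneg b
  have := abs_nonneg a
  refine ⟨?_, ?_, h1, h2⟩ <;> dsimp only <;> omega

/-- The reflection of the triangular lattice preserving horizontal lines. -/
def reflX : Equiv.Perm Site where
  toFun v := (-v.1 - v.2, v.2)
  invFun v := (-v.1 - v.2, v.2)
  left_inv v := by ext <;> simp
  right_inv v := by ext <;> simp

@[simp] theorem reflX_reflX (v : Site) : reflX (reflX v) = v := by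
  ext <;> simp [reflX]

@[simp] theorem reflX_snd (v : Site) : (reflX v).2 = v.2 := rfl

theorem reflX_fst (v : Site) : (reflX v).1 = -v.1 - v.2 := rfl

@[simp] theorem hor_reflX (v : Site) : hor (reflX v) = - hor v := by
  simp only [hor, reflX_snd, reflX_fst]; ring

theorem adj_reflX {a b : Site} (h : Adj a b) : Adj (reflX a) (reflX b) := by
  rw [adj_iff] at *; simp only [reflX_snd, reflX_fst]; omega

/-- Translation of the lattice. -/
def shift (d : Site) : Equiv.Perm Site := Equiv.addRight d

@[simp] theorem shift_apply (d v : Site) : shift d v = v + d := rfl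

/-- `A` contains a crossing of the strip `{a ≤ 2x + y ≤ b, 0 ≤ y ≤ h}` from left to right. -/
def StripLR (a b h : ℤ) (A : Set Site) : Prop :=
  ∃ l r, hor l ≤ a + 1 ∧ b - 1 ≤ hor r ∧ Conn (A ∩ strip a b h) l r

theorem strip_cross {a b h : ℤ} {A B : Set Site} {l r s t : Site} (hA : Conn A l r)
    (hl : hor l ≤ a + 1) (hr : b - 1 ≤ hor r) (hAy : ∀ v ∈ A, 0 ≤ v.2 ∧ v.2 ≤ h)
    (hB : Conn B s t) (hs : s.2 = 0) (ht : t.2 = h) (hBs : B ⊆ strip a b h) :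
    ∃ v, v ∈ A ∧ v ∈ B := by
  set M : ℤ := |a| + |b| + |h| + |l.1| + |r.1| + 2 with hM
  have ha := abs_nonneg a; have hb := abs_nonneg b; have hh := abs_nonneg h
  have h1 := abs_nonneg l.1; have h2 := abs_nonneg r.1
  have h3 := neg_abs_le l.1; have h4 := le_abs_self r.1
  have h5 := neg_abs_le a; have h6 := le_abs_self b; have h7 := le_abs_self h
  have h3' := le_abs_self l.1; have h4' := neg_abs_le r.1
  set A' : Set Site := A ∪ {v | (0 ≤ v.2 ∧ v.2 ≤ h) ∧ (hor v < a ∨ b < hor v)} with hA'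
  have hlA := hAy _ hA.left_mem
  have hrA := hAy _ hA.right_mem
  obtain ⟨lx, ly⟩ := l
  obtain ⟨rx, ry⟩ := r
  simp only [hor] at *
  have c1 : Conn A' (-M, ly) (lx - 1, ly) := conn_row (by omega) fun z hz hz' =>
    Or.inr ⟨hlA, Or.inl (by simp only [hor]; omega)⟩
  have c2 : Conn A' (rx + 1, ry) (M, ry) := conn_row (by omega) fun z hz hz' =>
    Or.inr ⟨hrA, Or.inr (by simp only [hor]; omega)⟩
  have c3 : Conn A' (lx, ly) (rx, ry) := hA.mono Set.subset_union_left
  have c4 : Conn A' (-M, ly) (M, ry) :=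
    ((c1.tail (adj_mk (by omega)) c3.left_mem).trans c3).trans
      ((Conn.single c3.right_mem (adj_mk (by omega)) c2.left_mem).trans c2)
  obtain ⟨v, hv1, hv2⟩ := conn_cross c4 hB
    (by
      intro v hv
      obtain ⟨q1, q2, q3, q4⟩ := hBs hv
      simp only [hor] at q3 q4
      constructor <;> dsimp only <;> omega)
    (by
      rintro v (hv | hv)
      · rw [hs, ht]; exact hAy v hv
      · rw [hs, ht]; exact hv.1)
  refine ⟨v, ?_, hv2⟩
  rcases hv1 with hv1 | hv1
  · exact hv1
  · obtain ⟨q1, q2, q3, q4⟩ := hBs hv2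
    simp only [hor] at q3 q4
    have := hv1.2
    simp only [hor] at this
    omega

theorem adj_hor {s t : Site} (h : Adj s t) : hor t ≤ hor s + 2 ∧ hor s ≤ hor t + 2 := by
  rw [adj_iff] at h; simp only [hor]; omega

/-- A path from the left of a strip to the right contains a crossing of the strip. -/
theorem strip_of_path {A : Set Site} {l r : Site} {a b : ℤ} (hA : Conn A l r)
    (hab : a + 2 ≤ b) (hl : hor l ≤ a + 1) (hr : b - 1 ≤ hor r) :
    ∃ l' r', hor l' ≤ a + 1 ∧ b - 1 ≤ hor r' ∧
      Conn (A ∩ {v | a ≤ hor v ∧ hor v ≤ b}) l' r' := by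
  have single : ∀ v ∈ A, a ≤ hor v → hor v ≤ a + 1 → b - 1 ≤ hor v →
      ∃ l' r', hor l' ≤ a + 1 ∧ b - 1 ≤ hor r' ∧
        Conn (A ∩ {v | a ≤ hor v ∧ hor v ≤ b}) l' r' := fun v hv h1 h2 h3 =>
    ⟨v, v, h2, h3, .refl ⟨hv, h1, (by omega : hor v ≤ b)⟩⟩
  by_cases hr' : hor r ≤ a + 1
  · exact single r hA.right_mem (by omega) hr' hr
  obtain ⟨s, t, h1, h2, h3, h4⟩ := hA.last_exit (Q := {v | hor v ≤ a + 1}) hl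
    (by simp only [Set.mem_ofPred_eq]; omega)
  have h5 : ¬ hor t ≤ a + 1 := h4.left_mem.2
  have h1' : hor s ≤ a + 1 := h1
  have h6 := adj_hor h3
  have h7 : Conn (A ∩ {v | a ≤ hor v}) s r := by
    have hs : s ∈ A ∩ {v | a ≤ hor v} := ⟨h2.right_mem, (by omega : a ≤ hor s)⟩
    have ht : t ∈ A ∩ {v | a ≤ hor v} := ⟨h4.left_mem.1, (by omega : a ≤ hor t)⟩
    refine (Conn.single hs h3 ht).trans (h4.mono ?_)
    · rintro x ⟨hx, hx2⟩
      have : ¬ hor x ≤ a + 1 := hx2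
      exact ⟨hx, (by omega : a ≤ hor x)⟩
  by_cases hs' : b - 1 ≤ hor s
  · exact single s h2.right_mem (by omega) h1' hs'
  obtain ⟨s', t', k1, k2, k3, k4⟩ := h7.first_exit (Q := {v | hor v < b - 1})
    (by simp only [Set.mem_ofPred_eq]; omega) (by simp only [Set.mem_ofPred_eq]; omega)
  have k5 : hor s' < b - 1 := k2.right_mem.2
  have k6 : ¬ hor t' < b - 1 := k1
  have k7 := adj_hor k3
  refine ⟨s, t', h1', by omega, (k2.mono ?_).tail k3 ?_⟩
  · rintro x ⟨⟨hx, hx2⟩, hx3⟩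
    have h8 : hor x < b - 1 := hx3
    exact ⟨hx, hx2, (by omega : hor x ≤ b)⟩
  · exact ⟨k4.left_mem.1, k4.left_mem.2, (by omega : hor t' ≤ b)⟩

/-! #### The explored part of the left half of a strip -/

section Explore

variable {U h : ℤ} {W K : Set Site}

/-- The bottom line. -/
def row0 : Set Site := {v | v.2 = 0}

/-- The boundary of the explored set `K`. -/
def bdry (W K : Set Site) : Set Site := inspected W row0 K \ K

/-- The unexplored part above the boundary. -/
def above (h : ℤ) (W K : Set Site) : Set Site :=
  {v | ∃ t : Site, t.2 = h ∧ Conn (W \ bdry W K) v t}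

theorem above_subset : above h W K ⊆ W := by
  rintro v ⟨t, _, hc⟩; exact hc.left_mem.1

theorem above_disjoint (hK : ∀ v ∈ K, v.2 ≠ h) :
    Disjoint (above h W K) (inspected W row0 K) := by
  rw [Set.disjoint_left]
  rintro v ⟨t, ht, hc⟩ hv
  have hvK : v ∈ K := by
    by_contra hvK
    exact hc.left_mem.2 (Set.mem_sdiff_of_mem hv hvK)
  obtain ⟨s, s', h1, h2, h3, h4⟩ := hc.last_exit (Q := K) hvK (fun h' => hK t h' ht)
  exact h4.left_mem.1.2 ⟨Or.inr ⟨h4.left_mem.1.1, s, h1, h3⟩, h4.left_mem.2⟩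

theorem mem_bdry_of_adj_above {v w : Site} (hv : v ∈ above h W K) (hw : w ∈ W)
    (hwv : Adj w v) (hw' : w ∉ above h W K) : w ∈ bdry W K := by
  by_contra hcon
  obtain ⟨t, ht, hc⟩ := hv
  have hw2 : w ∈ W \ bdry W K := ⟨hw, hcon⟩
  exact hw' ⟨t, ht, (Conn.single hw2 hwv hc.left_mem).trans hc⟩

theorem mem_bdry_of_top {w : Site} (hw : w ∈ W) (hwh : w.2 = h)
    (hw' : w ∉ above h W K) : w ∈ bdry W K := by
  by_contra hcon
  exact hw' ⟨w, hwh, .refl ⟨hw, hcon⟩⟩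

theorem bdry_crossing {a b : ℤ} (hh : 0 ≤ h) (hab : a + 1 ≤ b) (hK : ∀ v ∈ K, v.2 ≠ h)
    (hKW : K ⊆ strip a b h) :
    ∃ g₀ g₁, hor g₀ ≤ a + 1 ∧ b - 1 ≤ hor g₁ ∧ Conn (bdry (strip a b h) K) g₀ g₁ := by
  set W := strip a b h with hW
  have hGW : bdry W K ⊆ W := fun v hv => inspected_subset hKW hv.1
  set M : ℤ := |a| + |b| + |h| + 1 with hM
  have ha := abs_nonneg a; have hb := abs_nonneg b; have hh' := abs_nonneg h
  have h5 := neg_abs_le a; have h6 := le_abs_self b; have h7 := le_abs_self h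
  set O : Set Site := bdry W K ∪ {v | hor v < a ∨ b < hor v} with hO
  rcases hex_box O (show -M ≤ M by omega) hh with ⟨l, r, hl, hr, hc⟩ | ⟨s, t, hs, ht, hc⟩
  · have hly := hc.left_mem.2
    have hry := hc.right_mem.2
    have hl1 : hor l < a := by obtain ⟨_, _, h3, h4⟩ := hly; simp only [hor]; omega
    have hr1 : b < hor r := by obtain ⟨_, _, h3, h4⟩ := hry; simp only [hor]; omega
    obtain ⟨s, t, k1, k2, k3, k4⟩ := hc.last_exit (Q := {v | hor v < a}) hl1
      (by simp only [Set.mem_ofPred_eq]; omega)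
    have k5 := adj_hor k3
    have k6 : hor s < a := k1
    by_cases htb : hor t ≤ b
    · obtain ⟨s', t', m1, m2, m3, m4⟩ := k4.first_exit (Q := {v | hor v ≤ b}) htb
        (by simp only [Set.mem_ofPred_eq]; omega)
      have m5 := adj_hor m3
      have m6 : ¬ hor t' ≤ b := m1
      refine ⟨t, s', by omega, by omega, m2.mono ?_⟩
      rintro x ⟨⟨⟨hx | hx, _⟩, hx2⟩, hx3⟩
      · exact hx
      · have hx2' : ¬ hor x < a := hx2
        have hx3' : hor x ≤ b := hx3
        have hx' : hor x < a ∨ b < hor x := hx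
        omega
    · omega
  · exfalso
    have hc' : Conn (W \ bdry W K) s t := by
      refine hc.mono ?_
      rintro x ⟨hx, hx1, hx2, hx3, hx4⟩
      have hx' : x ∉ bdry W K ∧ ¬ (hor x < a ∨ b < hor x) := by
        constructor
        · exact fun h => hx (Or.inl h)
        · exact fun h => hx (Or.inr h)
      exact ⟨⟨hx3, hx4, by omega, by omega⟩, hx'.1⟩
    exact Set.disjoint_left.1 (above_disjoint hK) ⟨t, ht, hc'⟩
      (Or.inl (Or.inl ⟨hs, hc'.left_mem.1⟩))

end Explore

/-- Duality for a strip with the four boundary arcs: left half of the bottom, left end and left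
half of the top, and their mirror images. -/
theorem quad_duality {U h : ℤ} (hU : 2 ≤ U) (hh : 0 ≤ h) (hev : 2 ∣ h) (O : Set Site) :
    (∃ a c, a.2 = 0 ∧ hor a ≤ 0 ∧ (c.2 = h ∧ 0 ≤ hor c ∨ U - 1 ≤ hor c) ∧
      Conn (O ∩ strip (-U) U h) a c) ∨
    (∃ a c, a.2 = 0 ∧ 0 ≤ hor a ∧ (c.2 = h ∧ hor c ≤ 0 ∨ hor c ≤ -U + 1) ∧
      Conn (strip (-U) U h \ O) a c) := by
  set V := strip (-U) U h with hV
  have memV : ∀ v, v ∈ V ↔ 0 ≤ v.2 ∧ v.2 ≤ h ∧ -U ≤ hor v ∧ hor v ≤ U := fun v => Iff.rfl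
  set M : ℤ := U + h + 2 with hM
  set O' : Set Site := (O ∩ V) ∪ {v | v ∉ V ∧ (v.2 < 0 ∧ hor v < 0 ∨ 0 ≤ v.2 ∧ 0 < hor v)} with hO'
  rcases hex_box O' (show -M ≤ M by omega) (show (-1 : ℤ) ≤ h + 1 by omega) with
    ⟨l, r, hl, hr, hc⟩ | ⟨b, t, hb, ht, hc⟩
  · left
    have hlV : l ∉ V := by
      rintro ⟨_, q2, q3, _⟩
      simp only [hor] at q3; omega
    have hrV : r ∉ V := by
      rintro ⟨q1, q2, _, q3⟩
      simp only [hor] at q3; omega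
    have hl2 : l.2 < 0 := by
      rcases hc.left_mem with ⟨hx | ⟨_, hx⟩, hx1, hx2, hx3, hx4⟩
      · exact absurd hx.2 hlV
      · simp only [hor] at hx; omega
    have hr2 : 0 ≤ r.2 := by
      rcases hc.right_mem with ⟨hx | ⟨_, hx⟩, hx1, hx2, hx3, hx4⟩
      · exact absurd hx.2 hrV
      · simp only [hor] at hx; omega
    obtain ⟨s, t, h1, h2, h3, h4⟩ := hc.last_exit (Q := {v | v ∉ V ∧ v.2 < 0}) ⟨hlV, hl2⟩
      (fun hx => by have := hx.2; omega)
    have hs : s.2 = -1 ∧ hor s < 0 := by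
      rcases h2.right_mem with ⟨hx | ⟨_, hx⟩, hx1, hx2, hx3, hx4⟩
      · exact absurd hx.2 h1.1
      · have := h1.2; omega
    have htc : t ∈ V ∧ t.2 = 0 ∧ hor t ≤ 0 := by
      have ht1 := h4.left_mem.2
      rw [adj_iff] at h3
      rcases h4.left_mem.1 with ⟨hx | ⟨hx0, hx⟩, hx1, hx2, hx3, hx4⟩
      · have := ((memV t).1 hx.2).1
        refine ⟨hx.2, ?_, ?_⟩ <;> simp only [hor] at * <;> omega
      · have : ¬ t.2 < 0 := fun hq => ht1 ⟨hx0, hq⟩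
        simp only [hor] at *; omega
    obtain ⟨s', t', k1, k2, k3, k4⟩ := h4.first_exit (Q := V) htc.1 hrV
    refine ⟨t, s', htc.2.1, htc.2.2, ?_, k2.mono ?_⟩
    · have hs' := (memV s').1 k2.right_mem.2
      have ht' : ¬ (0 ≤ t'.2 ∧ t'.2 ≤ h ∧ -U ≤ hor t' ∧ hor t' ≤ U) := k1
      have ht1 := k4.left_mem.2
      rw [adj_iff] at k3
      rcases k4.left_mem.1 with ⟨hx | ⟨hx0, hx⟩, hx1, hx2, hx3, hx4⟩
      · exact absurd hx.2 k1
      · have : ¬ t'.2 < 0 := fun hq => ht1 ⟨hx0, hq⟩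
        simp only [hor] at *; omega
    · rintro x ⟨⟨⟨hx | ⟨hx0, hx⟩, _⟩, _⟩, hxV⟩
      · exact hx
      · exact absurd hxV hx0
  · right
    have hbV : b ∉ V := by
      rintro ⟨q2, _⟩; omega
    have htV : t ∉ V := by
      rintro ⟨_, q2, _⟩; omega
    obtain ⟨s, t1, h1, h2, h3, h4⟩ := hc.last_exit (Q := {v | v.2 < 0})
      (show b.2 < 0 by omega) (by simp only [Set.mem_ofPred_eq]; omega)
    have hs : s.2 = -1 ∧ 0 ≤ hor s := by
      have h1' : s.2 < 0 := h1
      obtain ⟨hx, hx1, hx2, hx3, hx4⟩ := h2.right_mem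
      refine ⟨by omega, ?_⟩
      by_contra hcon
      exact hx (Or.inr ⟨fun hq => by have := hq.1; omega, Or.inl ⟨h1', by omega⟩⟩)
    have ht1 : t1 ∈ V ∧ t1.2 = 0 ∧ 0 ≤ hor t1 := by
      have e1 : ¬ t1.2 < 0 := h4.left_mem.2
      rw [adj_iff] at h3
      have e2 : t1.2 = 0 ∧ 0 ≤ hor t1 := by simp only [hor] at *; omega
      refine ⟨?_, e2⟩
      by_contra hcon
      refine h4.left_mem.1.1 (Or.inr ⟨hcon, Or.inr ⟨by omega, ?_⟩⟩)
      have hcon' : ¬ (0 ≤ t1.2 ∧ t1.2 ≤ h ∧ -U ≤ hor t1 ∧ hor t1 ≤ U) := hcon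
      omega
    obtain ⟨s', t', k1, k2, k3, k4⟩ := h4.first_exit (Q := V) ht1.1 htV
    refine ⟨t1, s', ht1.2.1, ht1.2.2, ?_, k2.mono ?_⟩
    · have hs' := (memV s').1 k2.right_mem.2
      have ht' : ¬ (0 ≤ t'.2 ∧ t'.2 ≤ h ∧ -U ≤ hor t' ∧ hor t' ≤ U) := k1
      have e1 : ¬ t'.2 < 0 := k4.left_mem.2
      have e2 : ¬ 0 < hor t' := fun hq =>
        k4.left_mem.1.1 (Or.inr ⟨k1, Or.inr ⟨by omega, hq⟩⟩)
      rw [adj_iff] at k3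
      simp only [hor] at *; omega
    · rintro x ⟨⟨⟨hx, _⟩, _⟩, hxV⟩
      exact ⟨hxV, fun hq => hx (Or.inl ⟨hq, hxV⟩)⟩

section Doubling

variable {U h : ℤ}

/-- A path in the strip from its left end to its right end or to the right half of its top. -/
def HalfArc (U h : ℤ) (A : Set Site) : Prop :=
  ∃ l r, hor l ≤ -U + 1 ∧ (r.2 = h ∧ 0 ≤ hor r ∨ U - 1 ≤ hor r) ∧ Conn (A ∩ strip (-U) U h) l r

theorem reflX_mem_strip {v : Site} : reflX v ∈ strip (-U) U h ↔ v ∈ strip (-U) U h := by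
  simp only [strip, Set.mem_ofPred_eq, reflX_snd, hor_reflX]
  constructor <;> rintro ⟨h1, h2, h3, h4⟩ <;> refine ⟨h1, h2, ?_, ?_⟩ <;> omega

/-- The symmetrized colouring: full on `W \ T`, random on `T` and its mirror image. -/
def symCol (W T : Set Site) (A : Set Site) : Set Site :=
  (W \ T) ∪ ((T ∪ {v | reflX v ∈ T}) ∩ A)

/-- A path from the left half of the bottom to the right part in the symmetrized colouring. -/
def SymArc (U h : ℤ) (T A : Set Site) : Prop :=
  ∃ a c, a.2 = 0 ∧ hor a ≤ 0 ∧ (c.2 = h ∧ 0 ≤ hor c ∨ U - 1 ≤ hor c) ∧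
    Conn (symCol (strip (-U) 0 h) T A ∩ strip (-U) U h) a c

theorem dep_symArc (U h : ℤ) (T : Set Site) :
    Dep (T ∪ {v | reflX v ∈ T}) {ω | SymArc U h T (op ω)} := by
  have := dep_op (T ∪ {v | reflX v ∈ T}) (fun A => SymArc U h T A)
  convert this using 3
  simp only [SymArc, symCol, Set.inter_comm _ (op _ ∩ _), Set.inter_assoc, Set.inter_self]
  simp only [Set.inter_comm]

theorem half_le_symArc {μ : Measure Config} (hμ : IsBernoulliHalf μ) (hU : 2 ≤ U) (hh : 0 ≤ h)
    (hev : 2 ∣ h) {T : Set Site} (hT : T ⊆ strip (-U) 0 h) :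
    1 / 2 ≤ μ.real {ω | SymArc U h T (op ω)} := by
  have := hμ.1
  set W := strip (-U) 0 h with hW
  set E := {ω | SymArc U h T (op ω)} with hE
  have hTf : (T ∪ {v | reflX v ∈ T}).Finite := by
    have h1 := (strip_finite (-U) 0 h).subset hT
    exact h1.union (h1.preimage reflX.injective.injOn)
  have hloc : Loc E := (dep_symArc U h T).loc hTf
  have key : Eᶜ ⊆ relabel reflX true ⁻¹' E := by
    intro ω hω
    rcases quad_duality hU hh hev (symCol W T (op ω)) with hq | ⟨a, c, ha, ha', hc, hp⟩
    · exact absurd hq hω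
    · refine ⟨reflX a, reflX c, by simpa using ha, by simpa using ha', ?_, ?_⟩
      · simp only [hor_reflX, reflX_snd]; omega
      · refine hp.map (fun _ _ => adj_reflX) ?_
        rintro v ⟨hvV, hv⟩
        refine ⟨?_, reflX_mem_strip.2 hvV⟩
        by_cases hvT : v ∈ T ∪ {v | reflX v ∈ T}
        · right
          refine ⟨?_, ?_⟩
          · rcases hvT with hvT | hvT
            · right; simpa using hvT
            · left; exact hvT
          · have : v ∉ op ω := fun ho => hv (Or.inr ⟨hvT, ho⟩)
            rw [← not_mem_cl, not_not, mem_cl] at this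
            simp [mem_op, relabel, this]
        · left
          have h1 : v ∉ T := fun h => hvT (Or.inl h)
          have h2 : reflX v ∉ T := fun h => hvT (Or.inr h)
          refine ⟨?_, h2⟩
          have h3 : v ∉ W := fun h3 => hv (Or.inl ⟨h3, h1⟩)
          have h3' : ¬ (0 ≤ v.2 ∧ v.2 ≤ h ∧ -U ≤ hor v ∧ hor v ≤ 0) := h3
          obtain ⟨q1, q2, q3, q4⟩ := hvV
          refine ⟨q1, q2, ?_, ?_⟩ <;> rw [hor_reflX] <;> omega
  have h1 : μ.real Eᶜ ≤ μ.real E := by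
    rw [← prob_relabel hμ reflX true hloc]
    exact measureReal_mono key
  rw [probReal_compl_eq_one_sub hloc.measurableSet] at h1
  linarith

/-- The symmetrized arc and the explored boundary produce a half arc. -/
theorem halfArc_of_symArc {K : Set Site} {A : Set Site} (hU : 2 ≤ U) (hh : 0 ≤ h)
    (hKW : K ⊆ strip (-U) 0 h) (hK : ∀ v ∈ K, v.2 ≠ h)
    (hKr : ∀ k ∈ K, ∃ z, z.2 = 0 ∧ Conn K z k)
    (hA : bdry (strip (-U) 0 h) K ⊆ A)
    (hs : SymArc U h (above h (strip (-U) 0 h) K) A) : HalfArc U h A := by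
  set W := strip (-U) 0 h with hW
  set V := strip (-U) U h with hV
  set T := above h W K with hT
  have hWV : W ⊆ V := fun v hv => ⟨hv.1, hv.2.1, hv.2.2.1, by have := hv.2.2.2; omega⟩
  have hTW : T ⊆ W := above_subset
  have hGW : bdry W K ⊆ W := fun v hv => inspected_subset hKW hv.1
  have hTS := above_disjoint (W := W) (K := K) (h := h) hK
  obtain ⟨g₀, g₁, hg0, hg1, hg⟩ := bdry_crossing (a := -U) (b := 0) hh (by omega) hK hKW
  -- sites of the boundary that see the upper part belong to the crossing
  have hΓ : ∀ s ∈ bdry W K, (s.2 = h ∨ ∃ t ∈ T, Adj s t) → Conn (bdry W K) g₀ s := by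
    intro s hs hs'
    obtain ⟨z, hz, hzs⟩ : ∃ z : Site, z.2 = 0 ∧ Conn (K ∪ {s}) z s := by
      rcases hs.1 with (hx | hx) | ⟨_, k, hk, hks⟩
      · exact ⟨s, hx.1, .refl (Or.inr rfl)⟩
      · exact absurd hx hs.2
      · obtain ⟨z, hz, hzk⟩ := hKr k hk
        exact ⟨z, hz, (hzk.mono Set.subset_union_left).tail hks (Or.inr rfl)⟩
    obtain ⟨w, hw, hsw⟩ : ∃ w : Site, w.2 = h ∧ Conn (T ∪ {s}) s w := by
      rcases hs' with hs' | ⟨t, ⟨w, hw, hc⟩, hst⟩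
      · exact ⟨s, hs', .refl (Or.inr rfl)⟩
      · refine ⟨w, hw, ?_⟩
        have h1 : Conn T t w := hc.restrict' fun x hx => ⟨w, hw, hx.symm.trans hc⟩
        exact (Conn.single (Or.inr rfl) hst (Or.inl h1.left_mem)).trans
          (h1.mono Set.subset_union_left)
    have hB : Conn (K ∪ {s} ∪ T) z w :=
      (hzs.mono Set.subset_union_left).trans (hsw.mono (by
        rintro x (hx | hx)
        · exact Or.inr hx
        · exact Or.inl (Or.inr hx)))
    obtain ⟨v, hv1, hv2⟩ := strip_cross (a := -U) (b := 0) (h := h) hg.restrict hg0 hg1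
      (fun v hv => by
        have := hGW hv.right_mem; exact ⟨this.1, this.2.1⟩) hB hz hw (by
        rintro x ((hx | hx) | hx)
        · exact hKW hx
        · rw [Set.mem_singleton_iff.1 hx]; exact hGW hs
        · exact hTW hx)
    have hv3 : Conn (bdry W K) g₀ v := hv1
    rcases hv2 with (hx | hx) | hx
    · exact absurd hx hv3.right_mem.2
    · rwa [Set.mem_singleton_iff.1 hx] at hv3
    · exact absurd hv3.right_mem.1 (Set.disjoint_left.1 hTS hx)
  have hGA : ∀ {s}, Conn (bdry W K) g₀ s → Conn (A ∩ V) g₀ s := fun hs =>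
    hs.mono fun x hx => ⟨hA hx, hWV (hGW hx)⟩
  obtain ⟨a, c, ha, ha', hc, hp⟩ := hs
  have haQ : a ∈ W \ T := by
    have h1 := hp.left_mem.2
    have h2 : a ∈ W := ⟨h1.1, h1.2.1, h1.2.2.1, ha'⟩
    exact ⟨h2, fun h3 => Set.disjoint_left.1 hTS h3 (Or.inl (Or.inl ⟨ha, h2⟩))⟩
  by_cases hcQ : c ∈ W \ T
  · have h1 : c.2 = h ∧ 0 ≤ hor c := by
      have := hcQ.1.2.2.2; omega
    exact ⟨g₀, c, hg0, hc, hGA (hΓ c (mem_bdry_of_top hcQ.1 h1.1 hcQ.2) (Or.inl h1.1))⟩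
  · obtain ⟨s, t, h1, h2, h3, h4⟩ := hp.last_exit haQ hcQ
    have h5 : Conn (A ∩ V) t c := h4.mono (by
      rintro x ⟨⟨hx | hx, hxV⟩, hx2⟩
      · exact absurd hx hx2
      · exact ⟨hx.2, hxV⟩)
    have hts : ∃ t' ∈ T, Adj s t' := by
      obtain ⟨⟨hx | hx, hxV⟩, hx2⟩ := h4.left_mem
      · exact absurd hx hx2
      · rcases hx.1 with hx1 | hx1
        · exact ⟨t, hx1, h3⟩
        · by_cases htT : t ∈ T
          · exact ⟨t, htT, h3⟩
          · have htW : ¬ (0 ≤ t.2 ∧ t.2 ≤ h ∧ -U ≤ hor t ∧ hor t ≤ 0) := fun h => hx2 ⟨h, htT⟩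
            have hs1 := h1.1.2.2.2
            obtain ⟨q1, q2, q3, q4⟩ := hxV
            have hx1' : reflX t ∈ T := hx1
            refine ⟨reflX t, hx1', ?_⟩
            by_contra hcon
            have : reflX t = s := by
              rw [adj_iff] at h3 hcon
              simp only [reflX_fst, reflX_snd] at hcon
              simp only [hor] at *
              ext
              · rw [reflX_fst]; omega
              · rw [reflX_snd]; omega
            exact h1.2 (this ▸ hx1')
    have hsG : s ∈ bdry W K := by
      obtain ⟨t', ht', hst'⟩ := hts
      exact mem_bdry_of_adj_above ht' h1.1 hst' h1.2
    exact ⟨g₀, c, hg0, hc, ((hGA (hΓ s hsG (Or.inr hts))).tail h3 h5.left_mem).trans h5⟩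

end Doubling

theorem op_inter_mono {ω ω' : Config} {B : Set Site} (h : ∀ v ∈ B, ω v = true → ω' v = true)
    (h' : ∀ v, v ∉ B → ω v = ω' v) : op ω ⊆ op ω' := by
  intro v hv
  by_cases hvB : v ∈ B
  · exact h v hvB hv
  · rw [mem_op, ← h' v hvB]; exact hv

theorem cl_inter_mono {ω ω' : Config} {B : Set Site} (h : ∀ v ∈ B, ω v = false → ω' v = false)
    (h' : ∀ v, v ∉ B → ω v = ω' v) : cl ω ⊆ cl ω' := by
  intro v hv
  by_cases hvB : v ∈ B
  · exact h v hvB hv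
  · rw [mem_cl, ← h' v hvB]; exact hv

theorem dep_conn_op (R : Set Site) (Q : Site → Site → Prop) :
    Dep R {ω | ∃ l r, Q l r ∧ Conn (op ω ∩ R) l r} :=
  dep_op R fun A => ∃ l r, Q l r ∧ Conn A l r

theorem dep_conn_cl (R : Set Site) (Q : Site → Site → Prop) :
    Dep R {ω | ∃ l r, Q l r ∧ Conn (cl ω ∩ R) l r} :=
  dep_cl R fun A => ∃ l r, Q l r ∧ Conn A l r

theorem inc_conn_op (R B : Set Site) (Q : Site → Site → Prop) :
    Inc B {ω | ∃ l r, Q l r ∧ Conn (op ω ∩ R) l r} := by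
  rintro ω ω' h h' ⟨l, r, hQ, hc⟩
  exact ⟨l, r, hQ, hc.mono (Set.inter_subset_inter_left _ (op_inter_mono h h'))⟩

theorem stripLR_eq (a b h : ℤ) : {ω | StripLR a b h (op ω)} =
    {ω | ∃ l r, (hor l ≤ a + 1 ∧ b - 1 ≤ hor r) ∧ Conn (op ω ∩ strip a b h) l r} := by
  simp only [StripLR, and_assoc]

theorem halfArc_eq (U h : ℤ) : {ω | HalfArc U h (op ω)} =
    {ω | ∃ l r, (hor l ≤ -U + 1 ∧ (r.2 = h ∧ 0 ≤ hor r ∨ U - 1 ≤ hor r)) ∧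
      Conn (op ω ∩ strip (-U) U h) l r} := by
  simp only [HalfArc, and_assoc]

theorem loc_stripLR (a b h : ℤ) : Loc {ω | StripLR a b h (op ω)} := by
  rw [stripLR_eq]
  exact (dep_conn_op _ _).loc (strip_finite _ _ _)

section Doubling

variable {U h : ℤ} {μ : Measure Config}

theorem stripLR_le_halfArc (hμ : IsBernoulliHalf μ) (hU : 2 ≤ U) (hh : 0 ≤ h) (hev : 2 ∣ h) :
    μ.real {ω | StripLR (-U) 0 h (op ω)} / 2 ≤ μ.real {ω | HalfArc U h (op ω)} := by
  have := hμ.1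
  set W := strip (-U) 0 h with hW
  have hWf : W.Finite := strip_finite _ _ _
  have hE : Loc {ω | HalfArc U h (op ω)} := by
    rw [halfArc_eq]
    exact (dep_conn_op _ _).loc (strip_finite _ _ _)
  rw [prob_partition_clusters hμ hWf row0 hE,
    prob_partition_clusters hμ hWf row0 (loc_stripLR (-U) 0 h), Finset.sum_div]
  refine Finset.sum_le_sum fun K hK => ?_
  by_cases hne : ({ω | StripLR (-U) 0 h (op ω)} ∩ {ω | clusters W row0 ω = K}).Nonempty
  swap
  · rw [Set.not_nonempty_iff_eq_empty.1 hne]; simp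
  obtain ⟨ω₀, ⟨l, r, hl, hr, hlr⟩, hω⟩ := hne
  have hω' : clusters W row0 ω₀ = K := hω
  have hKW : K ⊆ W := hω' ▸ (clusters_subset.trans Set.inter_subset_right)
  have hKtop : ∀ v ∈ K, v.2 ≠ h := by
    intro v hv hvh
    rw [← hω'] at hv
    obtain ⟨z, hz, hc⟩ := hv
    obtain ⟨x, hx1, hx2⟩ := strip_cross hlr hl hr (fun v hv => ⟨hv.2.1, hv.2.2.1⟩) hc hz hvh
      Set.inter_subset_right
    exact not_mem_cl.2 hx1.1 hx2.1
  have hKr : ∀ k ∈ K, ∃ z : Site, z.2 = 0 ∧ Conn K z k := by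
    intro k hk
    rw [← hω'] at hk ⊢
    obtain ⟨z, hz, hc⟩ := hk
    exact ⟨z, hz, hc.restrict' fun w hw => ⟨z, hz, hw⟩⟩
  set T := above h W K with hT
  have hTW : T ⊆ W := above_subset
  have hdisj : Disjoint (T ∪ {v | reflX v ∈ T}) (inspected W row0 K) := by
    have h1 := above_disjoint (W := W) (K := K) (h := h) hKtop
    rw [Set.disjoint_left] at h1 ⊢
    rintro v (hv | hv) hvS
    · exact h1 hv hvS
    · have h2 := (hTW hv).2.2.2
      have h3 := (inspected_subset hKW hvS).2.2.2
      rw [hor_reflX] at h2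
      have h4 : reflX v = v := by
        ext
        · rw [reflX_fst]; simp only [hor] at *; omega
        · rfl
      have hv' : reflX v ∈ T := hv
      rw [h4] at hv'
      exact h1 hv' hvS
  have hTf : (T ∪ {v | reflX v ∈ T}).Finite := by
    have h1 := hWf.subset hTW
    exact h1.union (h1.preimage reflX.injective.injOn)
  have hind := prob_inter_of_disjoint hμ hTf (hWf.subset (inspected_subset hKW)) hdisj
    (dep_symArc U h T) (dep_clusters_eq W row0 K)
  have hhalf := half_le_symArc hμ hU hh hev hTW
  have hsub : {ω | SymArc U h T (op ω)} ∩ {ω | clusters W row0 ω = K} ⊆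
      {ω | HalfArc U h (op ω)} ∩ {ω | clusters W row0 ω = K} := by
    rintro ω ⟨h1, h2⟩
    refine ⟨halfArc_of_symArc hU hh hKW hKtop hKr ?_ h1, h2⟩
    have h2' : clusters W row0 ω = K := h2
    rintro v ⟨hv1, hv2⟩
    rw [← h2'] at hv1 hv2
    exact open_of_inspected hv1 hv2
  have h1 := measureReal_mono (μ := μ) hsub
  have h2 := measureReal_mono (μ := μ)
    (Set.inter_subset_right : {ω | StripLR (-U) 0 h (op ω)} ∩ {ω | clusters W row0 ω = K} ⊆ _)
  have h3 : 0 ≤ μ.real {ω | clusters W row0 ω = K} := measureReal_nonneg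
  rw [hind] at h1
  nlinarith

/-- A half arc and its mirror image combine to a crossing. -/
theorem stripLR_of_halfArcs {A : Set Site} (hU : 2 ≤ U) (hh : 0 ≤ h)
    (h1 : HalfArc U h A) (h2 : HalfArc U h (reflX ⁻¹' A)) : StripLR (-U) U h A := by
  set V := strip (-U) U h with hV
  obtain ⟨l1, r1, hl1, hr1, hc1⟩ := h1
  obtain ⟨l2, r2, hl2, hr2, hc2⟩ : ∃ l2 r2, U - 1 ≤ hor l2 ∧
      (r2.2 = h ∧ hor r2 ≤ 0 ∨ hor r2 ≤ -U + 1) ∧ Conn (A ∩ V) l2 r2 := by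
    obtain ⟨l, r, hl, hr, hc⟩ := h2
    refine ⟨reflX l, reflX r, by rw [hor_reflX]; omega, ?_,
      hc.map (fun _ _ => adj_reflX) fun v hv => ⟨hv.1, reflX_mem_strip.2 hv.2⟩⟩
    simp only [hor_reflX, reflX_snd]; omega
  by_cases hr1' : U - 1 ≤ hor r1
  · exact ⟨l1, r1, hl1, hr1', hc1⟩
  by_cases hr2' : hor r2 ≤ -U + 1
  · exact ⟨r2, l2, hr2', hl2, hc2.symm⟩
  suffices h : ∃ v, Conn (A ∩ V) l1 v ∧ Conn (A ∩ V) l2 v by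
    obtain ⟨v, hv1, hv2⟩ := h
    exact ⟨l1, l2, hl1, hl2, hv1.trans hv2.symm⟩
  by_cases hr12 : r1 = r2
  · exact ⟨r1, hc1, hr12 ▸ hc2⟩
  set A1 : Set Site := {v | Conn (A ∩ V) l1 v} with hA1
  set A2 : Set Site := {v | Conn (A ∩ V) l2 v} with hA2
  have hA1V : ∀ v ∈ A1, v ∈ V := fun v hv => (Conn.right_mem hv).2
  have hA2V : ∀ v ∈ A2, v ∈ V := fun v hv => (Conn.right_mem hv).2
  have hq1 : Conn A1 l1 r1 := hc1.restrict
  have hq2 : Conn A2 l2 r2 := hc2.restrict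
  have v1 := hA1V _ hq1.left_mem
  have v2 := hA1V _ hq1.right_mem
  have v3 := hA2V _ hq2.left_mem
  have v4 := hA2V _ hq2.right_mem
  obtain ⟨a1, b1⟩ := l1
  obtain ⟨a2, b2⟩ := r1
  obtain ⟨a3, b3⟩ := l2
  obtain ⟨a4, b4⟩ := r2
  have hb2 : b2 = h := by omega
  have hb4 : b4 = h := by omega
  have ha24 : a4 < a2 := by
    have : a4 ≠ a2 := fun h => hr12 (by rw [h, hb2, hb4])
    simp only [hor] at *; omega
  set M : ℤ := U + h + 3 with hM
  simp only [strip, hor, Set.mem_ofPred_eq, hV] at v1 v2 v3 v4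
  simp only [hor] at hl1 hr1 hl2 hr2 hr1' hr2'
  set B1 : Set Site := A1 ∪ ({v | 0 ≤ v.2 ∧ v.2 ≤ h ∧ hor v < -U} ∪ {v | v.2 = h + 1 ∧ a2 ≤ v.1})
    with hB1
  set B2 : Set Site := A2 ∪ ({v | 0 ≤ v.2 ∧ v.2 ≤ h ∧ U < hor v ∧ v.1 ≤ M} ∪
    ({v | v.2 = -1 ∧ v.1 = M} ∪ {v | h + 1 ≤ v.2 ∧ v.2 ≤ h + 2 ∧ v.1 = a4})) with hB2
  have p1 : Conn B1 (-M, b1) (M, h + 1) := by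
    have c1 : Conn B1 (-M, b1) (a1 - 1, b1) := conn_row (by omega) fun z hz hz' =>
      Or.inr (Or.inl ⟨v1.1, v1.2.1, by simp only [hor]; omega⟩)
    have c2 : Conn B1 (a1, b1) (a2, b2) := hq1.mono Set.subset_union_left
    have c3 : Conn B1 (a2, h + 1) (M, h + 1) := conn_row (by omega) fun z hz hz' =>
      Or.inr (Or.inr ⟨rfl, hz⟩)
    exact ((c1.tail (adj_mk (by omega)) c2.left_mem).trans c2).trans
      ((Conn.single c2.right_mem (adj_mk (by omega)) c3.left_mem).trans c3)
  have p2 : Conn B2 (M, -1) (a4, h + 2) := by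
    have c0 : Conn B2 (M, 0) (M, b3) := conn_col (by omega) fun z hz hz' =>
      Or.inr (Or.inl ⟨hz, hz'.trans v3.2.1, by simp only [hor]; omega, le_rfl⟩)
    have c1 : Conn B2 (a3 + 1, b3) (M, b3) := conn_row (by omega) fun z hz hz' =>
      Or.inr (Or.inl ⟨v3.1, v3.2.1, by simp only [hor]; omega⟩)
    have c2 : Conn B2 (a3, b3) (a4, b4) := hq2.mono Set.subset_union_left
    have c3 : Conn B2 (a4, h + 1) (a4, h + 2) := conn_col (by omega) fun z hz hz' =>
      Or.inr (Or.inr (Or.inr ⟨hz, hz', rfl⟩))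
    have c00 : (M, -1) ∈ B2 := Or.inr (Or.inr (Or.inl ⟨rfl, rfl⟩))
    exact (((((Conn.single c00 (adj_mk (by omega)) c0.left_mem).trans c0).trans c1.symm).tail
      (adj_mk (by omega)) c2.left_mem).trans c2).trans
      ((Conn.single c2.right_mem (adj_mk (by omega)) c3.left_mem).trans c3)
  obtain ⟨v, hv1, hv2⟩ := conn_cross p1 p2
    (by
      rintro v (hv | hv | hv | hv)
      · obtain ⟨q1, q2, q3, q4⟩ := hA2V v hv
        simp only [hor] at q3 q4
        constructor <;> dsimp only <;> omega
      · obtain ⟨q1, q2, q3, q4⟩ := hv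
        simp only [hor] at q3
        constructor <;> dsimp only <;> omega
      · obtain ⟨q1, q2⟩ := hv
        constructor <;> dsimp only <;> omega
      · obtain ⟨q1, q2, q3⟩ := hv
        constructor <;> dsimp only <;> omega)
    (by
      rintro v (hv | hv | hv)
      · obtain ⟨q1, q2, q3, q4⟩ := hA1V v hv
        constructor <;> dsimp only <;> omega
      · obtain ⟨q1, q2, q3⟩ := hv
        constructor <;> dsimp only <;> omega
      · obtain ⟨q1, q2⟩ := hv
        constructor <;> dsimp only <;> omega)
  have hv2V : v ∈ A2 → v ∈ V := hA2V v
  have hv1V : v ∈ A1 → v ∈ V := hA1V v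
  simp only [strip, Set.mem_ofPred_eq, hV] at hv1V hv2V
  rcases hv1 with hv1 | hv1 | hv1
  · rcases hv2 with hv2 | hv2 | hv2 | hv2
    · exact ⟨v, hv1, hv2⟩
    all_goals
      exfalso
      have := hv1V hv1
      simp only [Set.mem_ofPred_eq] at hv2
      omega
  · exfalso
    simp only [Set.mem_ofPred_eq] at hv1
    rcases hv2 with hv2 | hv2 | hv2 | hv2
    · have := hv2V hv2
      omega
    all_goals
      simp only [Set.mem_ofPred_eq] at hv2
      omega
  · exfalso
    simp only [Set.mem_ofPred_eq] at hv1
    rcases hv2 with hv2 | hv2 | hv2 | hv2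
    · have := hv2V hv2
      omega
    all_goals
      simp only [Set.mem_ofPred_eq] at hv2
      omega

theorem stripLR_double (hμ : IsBernoulliHalf μ) (hU : 2 ≤ U) (hh : 0 ≤ h) (hev : 2 ∣ h) :
    μ.real {ω | StripLR (-U) 0 h (op ω)} ^ 2 / 4 ≤ μ.real {ω | StripLR (-U) U h (op ω)} := by
  have := hμ.1
  set E := {ω | HalfArc U h (op ω)} with hE
  have hd : Dep (strip (-U) U h) E := by
    rw [hE, halfArc_eq]; exact dep_conn_op _ _
  have hi : Inc (strip (-U) U h) E := by
    rw [hE, halfArc_eq]; exact inc_conn_op _ _ _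
  have hloc := hd.loc (strip_finite _ _ _)
  have hE' : {ω | HalfArc U h (reflX ⁻¹' op ω)} = relabel reflX false ⁻¹' E := by
    ext ω
    have : reflX ⁻¹' op ω = op (relabel reflX false ω) := by
      ext v; simp [mem_op, relabel]
    simp only [Set.mem_ofPred_eq, this, Set.mem_preimage, hE]
  have hd' : Dep (strip (-U) U h) (relabel reflX false ⁻¹' E) := by
    intro ω ω' h
    refine hd _ _ fun v hv => ?_
    simp only [relabel, h (reflX v) (reflX_mem_strip.2 hv)]
  have hi' : Inc (strip (-U) U h) (relabel reflX false ⁻¹' E) := by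
    intro ω ω' h h'
    refine hi _ _ (fun v hv => ?_) fun v hv => ?_
    · simpa only [relabel, Bool.false_xor] using h _ (reflX_mem_strip.2 hv)
    · simp only [relabel, h' (reflX v) (fun h => hv (reflX_mem_strip.1 h))]
  have h1 := harris hμ (strip_finite _ _ _) hloc hd' hi hi'
  rw [prob_relabel hμ _ _ hloc] at h1
  have h2 : μ.real (E ∩ relabel reflX false ⁻¹' E) ≤ μ.real {ω | StripLR (-U) U h (op ω)} := by
    refine measureReal_mono ?_
    rw [← hE']
    rintro ω ⟨h1, h2⟩
    exact stripLR_of_halfArcs hU hh h1 h2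
  have h3 := stripLR_le_halfArc hμ hU hh hev
  have h4 : 0 ≤ μ.real {ω | StripLR (-U) 0 h (op ω)} := measureReal_nonneg
  nlinarith

end Doubling

/-! ### Crossings of rectangles -/

/-- `A` crosses the rectangle horizontally. -/
def LR (x0 x1 y0 y1 : ℤ) (A : Set Site) : Prop :=
  ∃ l r : Site, (l.1 = x0 ∧ r.1 = x1) ∧ Conn (A ∩ rect x0 x1 y0 y1) l r

/-- `A` crosses the rectangle vertically. -/
def BT (x0 x1 y0 y1 : ℤ) (A : Set Site) : Prop :=
  ∃ b t : Site, (b.2 = y0 ∧ t.2 = y1) ∧ Conn (A ∩ rect x0 x1 y0 y1) b t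

theorem lip_fst : Lip Prod.fst := by
  intro a b h; rw [adj_iff] at h; omega

theorem LR.mono {x0 x1 y0 y1 x0' x1' y0' y1' : ℤ} {A : Set Site} (h : LR x0 x1 y0 y1 A)
    (h1 : x0 ≤ x0') (h2 : x0' ≤ x1') (h3 : x1' ≤ x1) (h4 : y0' ≤ y0) (h5 : y1 ≤ y1') :
    LR x0' x1' y0' y1' A := by
  obtain ⟨l, r, ⟨hl, hr⟩, hc⟩ := h
  obtain ⟨u, w, hu, hw, _, hc'⟩ := hc.ring lip_fst h2 (by omega) (by omega)
  refine ⟨u, w, ⟨hu, hw⟩, hc'.mono ?_⟩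
  rintro v ⟨⟨hv, q1, q2, q3, q4⟩, q5, q6⟩
  exact ⟨hv, q5, q6, h4.trans q3, q4.trans h5⟩

theorem loc_LR (x0 x1 y0 y1 : ℤ) : Loc {ω | LR x0 x1 y0 y1 (op ω)} :=
  (dep_conn_op _ _).loc (rect_finite _ _ _ _)

theorem loc_LR_cl (x0 x1 y0 y1 : ℤ) : Loc {ω | LR x0 x1 y0 y1 (cl ω)} :=
  (dep_conn_cl _ _).loc (rect_finite _ _ _ _)

theorem op_relabel (φ : Equiv.Perm Site) (ω : Config) : op (relabel φ false ω) = φ ⁻¹' op ω := by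
  ext v; simp [mem_op, relabel]

theorem op_relabel_true (φ : Equiv.Perm Site) (ω : Config) : op (relabel φ true ω) = φ ⁻¹' cl ω := by
  ext v; simp [mem_op, mem_cl, relabel]

theorem cl_relabel (φ : Equiv.Perm Site) (ω : Config) : cl (relabel φ false ω) = φ ⁻¹' cl ω := by
  ext v; simp [mem_cl, relabel]

/-- Exchange of the two coordinates. -/
def swap : Equiv.Perm Site := Equiv.prodComm ℤ ℤ

theorem adj_swap {a b : Site} (h : Adj a b) : Adj (swap a) (swap b) := by
  rw [adj_iff] at *; simp only [swap, Equiv.prodComm_apply, Prod.fst_swap, Prod.snd_swap]; omega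

section RSW

variable {μ : Measure Config}

theorem half_le_LR_square (hμ : IsBernoulliHalf μ) {L : ℤ} (hL : 0 ≤ L) :
    1 / 2 ≤ μ.real {ω | LR 0 L 0 L (op ω)} := by
  have := hμ.1
  set E := {ω | LR 0 L 0 L (op ω)} with hE
  have hloc : Loc E := loc_LR _ _ _ _
  have key : Eᶜ ⊆ relabel swap true ⁻¹' E := by
    intro ω hω
    rcases hex_box (op ω) hL hL with ⟨l, r, hl, hr, hc⟩ | ⟨b, t, hb, ht, hc⟩
    · exact absurd ⟨l, r, ⟨hl, hr⟩, hc⟩ hω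
    · show LR 0 L 0 L (op (relabel swap true ω))
      refine ⟨swap b, swap t, ⟨hb, ht⟩, hc.map (fun _ _ => adj_swap) ?_⟩
      rintro v ⟨hv, q1, q2, q3, q4⟩
      rw [op_relabel_true]
      refine ⟨?_, q3, q4, q1, q2⟩
      have : v ∈ cl ω := by
        by_contra hc; exact hv (not_mem_cl.1 hc)
      exact this
  have h1 : μ.real Eᶜ ≤ μ.real E := by
    rw [← prob_relabel hμ swap true hloc]
    exact measureReal_mono key
  rw [probReal_compl_eq_one_sub hloc.measurableSet] at h1
  linarith

theorem prob_stripLR_shift (hμ : IsBernoulliHalf μ) (a b h d : ℤ) :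
    μ.real {ω | StripLR (a + 2 * d) (b + 2 * d) h (op ω)} = μ.real {ω | StripLR a b h (op ω)} := by
  have := hμ.1
  have mono : ∀ a b d : ℤ, μ.real {ω | StripLR (a + 2 * d) (b + 2 * d) h (op ω)} ≤
      μ.real {ω | StripLR a b h (op ω)} := by
    intro a b d
    rw [← prob_relabel hμ (shift (d, 0)) false (loc_stripLR a b h)]
    refine measureReal_mono ?_
    rintro ω ⟨l, r, hl, hr, hc⟩
    refine ⟨l + (-d, 0), r + (-d, 0), ?_, ?_, hc.map (adj_add _) ?_⟩
    · simp only [hor, Prod.fst_add, Prod.snd_add] at *; omega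
    · simp only [hor, Prod.fst_add, Prod.snd_add] at *; omega
    · rintro v ⟨hv, q1, q2, q3, q4⟩
      rw [op_relabel]
      refine ⟨?_, ?_⟩
      · have : v + (-d, 0) + (d, 0) = v := by ext <;> simp
        simpa only [Set.mem_preimage, shift_apply, this] using hv
      · simp only [strip, hor, Set.mem_ofPred_eq, Prod.fst_add, Prod.snd_add] at *; omega
  refine le_antisymm (mono a b d) ?_
  have := mono (a + 2 * d) (b + 2 * d) (-d)
  simpa using this

theorem stripLR_pow (hμ : IsBernoulliHalf μ) {t : ℤ} (ht : 1 ≤ t) (k : ℕ) :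
    ((1 : ℝ) / 4) ^ (2 ^ k : ℕ) * 4 / 2 ^ (2 ^ k : ℕ) ≤
      μ.real {ω | StripLR (-(2 ^ k * (2 * t))) 0 (2 * t) (op ω)} := by
  have := hμ.1
  induction k with
  | zero =>
    have h1 := half_le_LR_square hμ (L := 2 * t) (by omega)
    have h2 : μ.real {ω | LR 0 (2 * t) 0 (2 * t) (op ω)} ≤
        μ.real {ω | StripLR (-(2 ^ 0 * (2 * t)) + 2 * (2 * t)) (0 + 2 * (2 * t)) (2 * t) (op ω)} := by
      refine measureReal_mono ?_
      rintro ω ⟨l, r, ⟨hl, hr⟩, hc⟩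
      have q1 := hc.left_mem.2
      have q2 := hc.right_mem.2
      simp only [rect, Set.mem_ofPred_eq] at q1 q2
      obtain ⟨l', r', hl', hr', hc'⟩ := strip_of_path (a := -(2 ^ 0 * (2 * t)) + 2 * (2 * t))
        (b := 0 + 2 * (2 * t)) hc (by omega) (by simp only [hor]; omega)
        (by simp only [hor]; omega)
      refine ⟨l', r', hl', hr', hc'.mono ?_⟩
      rintro v ⟨⟨hv, q1, q2, q3, q4⟩, q5, q6⟩
      exact ⟨hv, q3, q4, q5, q6⟩
    rw [prob_stripLR_shift hμ] at h2
    norm_num at h1 h2 ⊢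
    linarith
  | succ k ih =>
    have h1 := stripLR_double hμ (U := 2 ^ k * (2 * t)) (h := 2 * t)
      (by have : (1:ℤ) ≤ 2 ^ k := one_le_pow₀ (by norm_num)
          nlinarith) (by omega) ⟨t, rfl⟩
    have h2 := prob_stripLR_shift hμ (-(2 ^ (k + 1) * (2 * t))) 0 (2 * t) (2 ^ k * t)
    have e1 : -(2 ^ (k + 1) * (2 * t)) + 2 * (2 ^ k * t) = -(2 ^ k * (2 * t)) := by ring
    have e2 : 0 + 2 * (2 ^ k * t) = 2 ^ k * (2 * t) := by ring
    rw [e1, e2] at h2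
    rw [← h2]
    refine le_trans ?_ h1
    set x := ((1 : ℝ) / 4) ^ (2 ^ k : ℕ) * 4 / 2 ^ (2 ^ k : ℕ) with hx
    have hx0 : 0 ≤ x := by positivity
    have : ((1 : ℝ) / 4) ^ (2 ^ (k + 1) : ℕ) * 4 / 2 ^ (2 ^ (k + 1) : ℕ) = x ^ 2 / 4 := by
      rw [hx, pow_succ 2 k, pow_mul, pow_mul]; field_simp
    rw [this]
    gcongr

/-- A lower bound for crossing probabilities. -/
noncomputable def rswC : ℝ := (1 / 4) ^ (2 ^ 4 : ℕ) * 4 / 2 ^ (2 ^ 4 : ℕ)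

theorem rswC_pos : 0 < rswC := by unfold rswC; positivity

theorem LR_shift {x0 x1 y0 y1 : ℤ} {A : Set Site} (d : Site)
    (h : LR x0 x1 y0 y1 A) : LR (x0 - d.1) (x1 - d.1) (y0 - d.2) (y1 - d.2) (shift d ⁻¹' A) := by
  obtain ⟨l, r, ⟨hl, hr⟩, hc⟩ := h
  refine ⟨l + -d, r + -d, ⟨?_, ?_⟩, hc.map (adj_add _) ?_⟩
  · simp only [Prod.fst_add, Prod.fst_neg]; omega
  · simp only [Prod.fst_add, Prod.fst_neg]; omega
  · rintro v ⟨hv, q1, q2, q3, q4⟩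
    refine ⟨?_, ?_⟩
    · simpa only [Set.mem_preimage, shift_apply, neg_add_cancel_right] using hv
    · simp only [rect, Set.mem_ofPred_eq, Prod.fst_add, Prod.snd_add, Prod.fst_neg, Prod.snd_neg]
      omega

/-- Crossing probabilities of rectangles with aspect ratio at most six are bounded below. -/
theorem rsw_LR_op (hμ : IsBernoulliHalf μ) {x0 x1 y0 y1 t : ℤ} (ht : 1 ≤ t) (hx : x0 ≤ x1)
    (hx' : x1 - x0 ≤ 12 * t) (hy : 2 * t ≤ y1 - y0) :
    rswC ≤ μ.real {ω | LR x0 x1 y0 y1 (op ω)} := by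
  have := hμ.1
  refine (stripLR_pow hμ ht 4).trans ?_
  rw [← prob_relabel hμ (shift (-16 * t - x0, -y0)) false (loc_LR x0 x1 y0 y1)]
  refine measureReal_mono ?_
  rintro ω ⟨l, r, hl, hr, hc⟩
  have q1 := hc.left_mem.2
  have q2 := hc.right_mem.2
  simp only [strip, hor, Set.mem_ofPred_eq] at q1 q2 hl hr
  obtain ⟨u, w, hu, hw, _, hc'⟩ := hc.ring lip_fst (p := -16 * t) (q := -4 * t) (by omega)
    (by omega) (by omega)
  have h1 : LR (-16 * t) (-4 * t) 0 (2 * t) (op ω) := by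
    refine ⟨u, w, ⟨hu, hw⟩, hc'.mono ?_⟩
    rintro v ⟨⟨hv, q3, q4, _⟩, q5, q6⟩
    exact ⟨hv, q5, q6, q3, q4⟩
  show LR x0 x1 y0 y1 (op (relabel (shift (-16 * t - x0, -y0)) false ω))
  rw [op_relabel]
  refine (LR_shift (-16 * t - x0, -y0) h1).mono ?_ hx ?_ ?_ ?_ <;> dsimp only <;> omega

theorem rsw_LR_cl (hμ : IsBernoulliHalf μ) {x0 x1 y0 y1 t : ℤ} (ht : 1 ≤ t) (hx : x0 ≤ x1)
    (hx' : x1 - x0 ≤ 12 * t) (hy : 2 * t ≤ y1 - y0) :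
    rswC ≤ μ.real {ω | LR x0 x1 y0 y1 (cl ω)} := by
  refine (rsw_LR_op hμ ht hx hx' hy).trans_eq ?_
  rw [← prob_relabel hμ (Equiv.refl _) true (loc_LR x0 x1 y0 y1)]
  congr 1
  ext ω
  simp only [Set.mem_preimage, Set.mem_ofPred_eq, op_relabel_true]
  rfl

theorem BT_iff_swap {x0 x1 y0 y1 : ℤ} {A : Set Site} :
    BT x0 x1 y0 y1 A ↔ LR y0 y1 x0 x1 (swap ⁻¹' A) := by
  constructor
  · rintro ⟨b, t, ⟨hb, ht⟩, hc⟩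
    exact ⟨swap b, swap t, ⟨hb, ht⟩, hc.map (fun _ _ => adj_swap)
      fun v ⟨hv, q1, q2, q3, q4⟩ => ⟨hv, q3, q4, q1, q2⟩⟩
  · rintro ⟨b, t, ⟨hb, ht⟩, hc⟩
    exact ⟨swap b, swap t, ⟨hb, ht⟩, hc.map (fun _ _ => adj_swap)
      fun v ⟨hv, q1, q2, q3, q4⟩ => ⟨hv, q3, q4, q1, q2⟩⟩

theorem rsw_BT_op (hμ : IsBernoulliHalf μ) {x0 x1 y0 y1 t : ℤ} (ht : 1 ≤ t) (hy : y0 ≤ y1)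
    (hy' : y1 - y0 ≤ 12 * t) (hx : 2 * t ≤ x1 - x0) :
    rswC ≤ μ.real {ω | BT x0 x1 y0 y1 (op ω)} := by
  refine (rsw_LR_op hμ ht hy hy' hx).trans_eq ?_
  rw [← prob_relabel hμ swap false (loc_LR _ _ _ _)]
  congr 1
  ext ω
  simp only [Set.mem_preimage, Set.mem_ofPred_eq, op_relabel, BT_iff_swap]

theorem rsw_BT_cl (hμ : IsBernoulliHalf μ) {x0 x1 y0 y1 t : ℤ} (ht : 1 ≤ t) (hy : y0 ≤ y1)
    (hy' : y1 - y0 ≤ 12 * t) (hx : 2 * t ≤ x1 - x0) :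
    rswC ≤ μ.real {ω | BT x0 x1 y0 y1 (cl ω)} := by
  refine (rsw_LR_cl hμ ht hy hy' hx).trans_eq ?_
  rw [← prob_relabel hμ swap false (loc_LR_cl _ _ _ _)]
  congr 1
  ext ω
  simp only [Set.mem_preimage, Set.mem_ofPred_eq, cl_relabel, BT_iff_swap]

end RSW

/-! ### Half annuli and arms -/

/-- Distance from `z` used to define half annuli above the horizontal line through `z`. -/
def nrm (z v : Site) : ℤ := max (max (v.1 - z.1) (z.1 - v.1)) (v.2 - z.2)

theorem lip_nrm (z : Site) : Lip (nrm z) := by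
  intro a b h; rw [adj_iff] at h; simp only [nrm]; omega

/-- The half plane above the horizontal line through `z`. -/
def half (z : Site) : Set Site := {v | z.2 ≤ v.2}

/-- The annulus `p ≤ nrm z ≤ q`. -/
def ann (z : Site) (p q : ℤ) : Set Site := {v | p ≤ nrm z v ∧ nrm z v ≤ q}

theorem half_ann_finite (z : Site) (p q : ℤ) : (half z ∩ ann z p q).Finite := by
  refine (rect_finite (z.1 - q) (z.1 + q) z.2 (z.2 + q)).subset ?_
  rintro v ⟨h1, h2, h3⟩
  simp only [half, Set.mem_ofPred_eq, nrm] at h1 h3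
  refine ⟨?_, ?_, ?_, ?_⟩ <;> omega

/-- `X` contains a crossing of the annulus. -/
def Crosses (z : Site) (p q : ℤ) (X : Set Site) : Prop :=
  ∃ u w, (nrm z u = p ∧ nrm z w = q) ∧ Conn (X ∩ ann z p q) u w

theorem Crosses.of_conn {z : Site} {p q : ℤ} {X : Set Site} {u w : Site} (h : Conn X u w)
    (hpq : p ≤ q) (hu : nrm z u ≤ p) (hw : q ≤ nrm z w) : Crosses z p q X := by
  obtain ⟨u', w', h1, h2, _, h4⟩ := h.ring (lip_nrm z) hpq hu hw
  exact ⟨u', w', ⟨h1, h2⟩, h4⟩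

theorem Crosses.mono {z : Site} {p q : ℤ} {X Y : Set Site} (h : Crosses z p q X)
    (hXY : X ⊆ Y) : Crosses z p q Y := by
  obtain ⟨u, w, h1, h2⟩ := h
  exact ⟨u, w, h1, h2.mono (Set.inter_subset_inter_left _ hXY)⟩

/-- An arc around `z` meets every crossing of a half annulus around `z`. -/
theorem arc_meets {z : Site} {s : ℤ} (hs : 1 ≤ s) {X Y : Set Site}
    (h1 : BT (z.1 - 6 * s) (z.1 - 4 * s) z.2 (z.2 + 6 * s) X)
    (h2 : LR (z.1 - 6 * s) (z.1 + 6 * s) (z.2 + 4 * s) (z.2 + 6 * s) X)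
    (h3 : BT (z.1 + 4 * s) (z.1 + 6 * s) z.2 (z.2 + 6 * s) X)
    (hY : Crosses z (s + 1) (8 * s) (Y ∩ half z)) : ∃ v, v ∈ X ∧ v ∈ Y := by
  obtain ⟨b1, t1, ⟨hb1, ht1⟩, hc1⟩ := h1
  obtain ⟨l2, r2, ⟨hl2, hr2⟩, hc2⟩ := h2
  obtain ⟨b3, t3, ⟨hb3, ht3⟩, hc3⟩ := h3
  set R : Set Site := {v | z.1 - 6 * s ≤ v.1 ∧ v.1 ≤ z.1 + 6 * s ∧ z.2 ≤ v.2 ∧ v.2 ≤ z.2 + 6 * s ∧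
    4 * s ≤ nrm z v} with hR
  have hc1' : Conn (X ∩ R) b1 t1 := hc1.mono (by
    rintro v ⟨hv, q1, q2, q3, q4⟩
    refine ⟨hv, ?_⟩
    simp only [hR, Set.mem_ofPred_eq, nrm]; omega)
  have hc2' : Conn (X ∩ R) l2 r2 := hc2.mono (by
    rintro v ⟨hv, q1, q2, q3, q4⟩
    refine ⟨hv, ?_⟩
    simp only [hR, Set.mem_ofPred_eq, nrm]; omega)
  have hc3' : Conn (X ∩ R) b3 t3 := hc3.mono (by
    rintro v ⟨hv, q1, q2, q3, q4⟩
    refine ⟨hv, ?_⟩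
    simp only [hR, Set.mem_ofPred_eq, nrm]; omega)
  have m12 : ∃ v, Conn (X ∩ R) l2 v ∧ Conn (X ∩ R) b1 v := by
    obtain ⟨v, hv1, hv2⟩ := conn_cross hc2.restrict hc1.restrict
      (by
        intro v hv
        obtain ⟨_, q1, q2, q3, q4⟩ := Conn.right_mem hv
        rw [hl2, hr2]; constructor <;> omega)
      (by
        intro v hv
        obtain ⟨_, q1, q2, q3, q4⟩ := Conn.right_mem hv
        rw [hb1, ht1]; constructor <;> omega)
    refine ⟨v, Conn.mono ?_ hv1, Conn.mono ?_ hv2⟩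
    · rintro v ⟨hv, q1, q2, q3, q4⟩
      refine ⟨hv, ?_⟩
      simp only [hR, Set.mem_ofPred_eq, nrm]; omega
    · rintro v ⟨hv, q1, q2, q3, q4⟩
      refine ⟨hv, ?_⟩
      simp only [hR, Set.mem_ofPred_eq, nrm]; omega
  have m32 : ∃ v, Conn (X ∩ R) l2 v ∧ Conn (X ∩ R) b3 v := by
    obtain ⟨v, hv1, hv2⟩ := conn_cross hc2.restrict hc3.restrict
      (by
        intro v hv
        obtain ⟨_, q1, q2, q3, q4⟩ := Conn.right_mem hv
        rw [hl2, hr2]; constructor <;> omega)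
      (by
        intro v hv
        obtain ⟨_, q1, q2, q3, q4⟩ := Conn.right_mem hv
        rw [hb3, ht3]; constructor <;> omega)
    refine ⟨v, Conn.mono ?_ hv1, Conn.mono ?_ hv2⟩
    · rintro v ⟨hv, q1, q2, q3, q4⟩
      refine ⟨hv, ?_⟩
      simp only [hR, Set.mem_ofPred_eq, nrm]; omega
    · rintro v ⟨hv, q1, q2, q3, q4⟩
      refine ⟨hv, ?_⟩
      simp only [hR, Set.mem_ofPred_eq, nrm]; omega
  have harc : Conn (X ∩ R) b1 b3 := by
    obtain ⟨v, hv1, hv2⟩ := m12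
    obtain ⟨v', hv1', hv2'⟩ := m32
    exact ((hv2.trans hv1.symm).trans hv1').trans hv2'.symm
  obtain ⟨u, w, ⟨hu, hw⟩, hc⟩ := hY
  have e1 := hc1.left_mem.2
  have e3 := hc3.left_mem.2
  have eu := hc.left_mem
  have ew := hc.right_mem
  obtain ⟨x1, y1⟩ := b1
  obtain ⟨x3, y3⟩ := b3
  obtain ⟨ux, uy⟩ := u
  obtain ⟨wx, wy⟩ := w
  obtain ⟨zx, zy⟩ := z
  simp only [rect, Set.mem_ofPred_eq] at e1 e3
  obtain ⟨⟨_, eu1⟩, _, eu2⟩ := eu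
  obtain ⟨⟨_, ew1⟩, _, ew2⟩ := ew
  simp only [half, Set.mem_ofPred_eq, nrm] at eu1 ew1 hu hw
  dsimp only at hb1 hb3
  set A : Set Site := (X ∩ R) ∪ {v | v.2 = zy - 1 ∧ (v.1 ≤ zx - 4 * s ∨ zx + 4 * s ≤ v.1)} with hA
  set B : Set Site := (Y ∩ half (zx, zy) ∩ ann (zx, zy) (s + 1) (8 * s)) ∪
    ({v | zy - 1 ≤ v.2 ∧ v.2 ≤ zy + (s + 1) ∧ zx - (s + 1) ≤ v.1 ∧ v.1 ≤ zx + s + 1} ∪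
     {v | zy ≤ v.2 ∧ (v.1 = zx - 8 * s ∨ v.1 = zx + 8 * s)}) with hB
  have pA : Conn A (zx - 8 * s, zy - 1) (zx + 8 * s, zy - 1) := by
    have c1 : Conn A (zx - 8 * s, zy - 1) (x1, zy - 1) := conn_row (by omega) fun v q1 q2 =>
      Or.inr ⟨rfl, by dsimp only; omega⟩
    have c2 : Conn A (x1, y1) (x3, y3) := harc.mono Set.subset_union_left
    have c3 : Conn A (x3, zy - 1) (zx + 8 * s, zy - 1) := conn_row (by omega) fun v q1 q2 =>
      Or.inr ⟨rfl, by dsimp only; omega⟩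
    exact ((c1.tail (adj_mk (by omega)) c2.left_mem).trans c2).trans
      ((Conn.single c2.right_mem (adj_mk (by omega)) c3.left_mem).trans c3)
  have pB : Conn B (ux, zy - 1) (wx, zy + 8 * s) := by
    have c1 : Conn B (ux, zy - 1) (ux, uy) := conn_col (by omega) fun v q1 q2 => by
      refine Or.inr (Or.inl ⟨q1, ?_, ?_, ?_⟩) <;> dsimp only <;> omega
    have c2 : Conn B (ux, uy) (wx, wy) := hc.mono Set.subset_union_left
    by_cases hwy : wy = zy + 8 * s
    · rw [← hwy]; exact c1.trans c2
    · have c3 : Conn B (wx, wy) (wx, zy + 8 * s) := conn_col (by omega) fun v q1 q2 => by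
        refine Or.inr (Or.inr ⟨ew1.trans q1, ?_⟩); dsimp only; omega
      exact (c1.trans c2).trans c3
  obtain ⟨v, hv1, hv2⟩ := conn_cross pA pB
    (by
      rintro v (⟨_, hv⟩ | hv | hv)
      · have := hv.2
        simp only [nrm] at this
        constructor <;> dsimp only <;> omega
      · obtain ⟨q1, q2, q3, q4⟩ := hv
        constructor <;> dsimp only <;> omega
      · have := hv.2
        constructor <;> dsimp only <;> omega)
    (by
      rintro v (hv | hv)
      · obtain ⟨q1, q2, q3, q4, q5⟩ := hv.2
        dsimp only at q3 q4
        constructor <;> dsimp only <;> omega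
      · have := hv.1
        constructor <;> dsimp only <;> omega)
  rcases hv1 with hv1 | hv1
  · rcases hv2 with hv2 | hv2 | hv2
    · exact ⟨v, hv1.1, hv2.1.1⟩
    · obtain ⟨q1, q2, q3, q4, q5⟩ := hv1.2
      obtain ⟨p1, p2, p3, p4⟩ := hv2
      simp only [nrm] at q5; omega
    · obtain ⟨q1, q2, q3, q4, q5⟩ := hv1.2
      have := hv2.2
      dsimp only at q1 q2; omega
  · obtain ⟨p1, p2⟩ := hv1
    rcases hv2 with hv2 | hv2 | hv2
    · have := hv2.1.2
      simp only [half, Set.mem_ofPred_eq] at this; omega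
    · obtain ⟨q1, q2, q3, q4⟩ := hv2
      omega
    · have := hv2.1; omega

section Block

variable {μ : Measure Config}

/-- Absence of a closed crossing of a half annulus. -/
def Block (z : Site) (s : ℤ) : Set Config :=
  {ω | ¬ Crosses z (s + 1) (8 * s) (cl ω ∩ half z)}

theorem dep_block (z : Site) (s : ℤ) : Dep (half z ∩ ann z (s + 1) (8 * s)) (Block z s) := by
  have := (dep_conn_cl (half z ∩ ann z (s + 1) (8 * s))
    (fun u w => nrm z u = s + 1 ∧ nrm z w = 8 * s)).compl
  convert this using 1
  ext ω
  simp only [Block, Crosses, Set.mem_ofPred_eq, Set.mem_compl_iff, Set.inter_assoc]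

theorem inc_block (z : Site) (s : ℤ) (B : Set Site) : Inc B (Block z s) := by
  intro ω ω' h h' hω hc
  refine hω (hc.mono (Set.inter_subset_inter_left _ ?_))
  intro v hv
  by_contra hcon
  have h1 : v ∈ op ω := not_mem_cl.1 hcon
  exact not_mem_cl.2 (op_inter_mono h h' h1) hv

theorem block_ge (hμ : IsBernoulliHalf μ) (z : Site) {s : ℤ} (hs : 1 ≤ s) :
    rswC ^ 3 ≤ μ.real (Block z s) := by
  have := hμ.1
  set E1 := {ω | BT (z.1 - 6 * s) (z.1 - 4 * s) z.2 (z.2 + 6 * s) (op ω)} with hE1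
  set E2 := {ω | LR (z.1 - 6 * s) (z.1 + 6 * s) (z.2 + 4 * s) (z.2 + 6 * s) (op ω)} with hE2
  set E3 := {ω | BT (z.1 + 4 * s) (z.1 + 6 * s) z.2 (z.2 + 6 * s) (op ω)} with hE3
  have p1 : rswC ≤ μ.real E1 := rsw_BT_op hμ hs (by omega) (by omega) (by omega)
  have p2 : rswC ≤ μ.real E2 := rsw_LR_op hμ hs (by omega) (by omega) (by omega)
  have p3 : rswC ≤ μ.real E3 := rsw_BT_op hμ hs (by omega) (by omega) (by omega)
  have d1 := dep_conn_op (rect (z.1 - 6 * s) (z.1 - 4 * s) z.2 (z.2 + 6 * s))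
    (fun b t => b.2 = z.2 ∧ t.2 = z.2 + 6 * s)
  have d2 := dep_conn_op (rect (z.1 - 6 * s) (z.1 + 6 * s) (z.2 + 4 * s) (z.2 + 6 * s))
    (fun l r => l.1 = z.1 - 6 * s ∧ r.1 = z.1 + 6 * s)
  have d3 := dep_conn_op (rect (z.1 + 4 * s) (z.1 + 6 * s) z.2 (z.2 + 6 * s))
    (fun b t => b.2 = z.2 ∧ t.2 = z.2 + 6 * s)
  have i1 : ∀ B, Inc B E1 := fun B => inc_conn_op _ B _
  have i2 : ∀ B, Inc B E2 := fun B => inc_conn_op _ B _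
  have i3 : ∀ B, Inc B E3 := fun B => inc_conn_op _ B _
  have l1 : Loc E1 := d1.loc (rect_finite _ _ _ _)
  have l2 : Loc E2 := d2.loc (rect_finite _ _ _ _)
  have h12 := harris hμ (rect_finite _ _ _ _) l1 d2 (i1 _) (i2 _)
  have h123 := harris hμ (rect_finite _ _ _ _) (l1.inter l2) d3
    (fun ω ω' h h' hω => ⟨i1 _ ω ω' h h' hω.1, i2 _ ω ω' h h' hω.2⟩) (i3 _)
  have hsub : E1 ∩ E2 ∩ E3 ⊆ Block z s := by
    rintro ω ⟨⟨h1, h2⟩, h3⟩ hc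
    obtain ⟨v, hv1, hv2⟩ := arc_meets hs h1 h2 h3 hc
    exact not_mem_cl.2 hv1 hv2
  have hc := rswC_pos
  calc rswC ^ 3 = rswC * rswC * rswC := by ring
    _ ≤ μ.real E1 * μ.real E2 * μ.real E3 := by gcongr
    _ ≤ μ.real (E1 ∩ E2) * μ.real E3 := by gcongr; exact h12
    _ ≤ μ.real (E1 ∩ E2 ∩ E3) := h123
    _ ≤ _ := measureReal_mono hsub

end Block

/-! ### Counting crossing clusters -/

/-- `C` is a closed cluster of `A`. -/
def ClusterEvent (A C : Set Site) : Set Config := {ω | ∃ u ∈ C, clusters A {u} ω = C}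

theorem mem_clusters_singleton {A : Set Site} {u v : Site} {ω : Config} :
    v ∈ clusters A {u} ω ↔ Conn (cl ω ∩ A) u v := by
  simp [clusters]

theorem clusterEvent_iff {A C : Set Site} {ω : Config} {u : Site} (hu : u ∈ C)
    (h : ω ∈ ClusterEvent A C) : clusters A {u} ω = C := by
  obtain ⟨u', hu', h'⟩ := h
  have h1 : Conn (cl ω ∩ A) u' u := mem_clusters_singleton.1 (h' ▸ hu)
  ext v
  rw [← h', mem_clusters_singleton, mem_clusters_singleton]
  exact ⟨fun h => h1.trans h, fun h => h1.symm.trans h⟩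

theorem dep_clusterEvent (A C : Set Site) (hC : C ⊆ A) :
    Dep (inspected A ∅ C) (ClusterEvent A C) := by
  rintro ω ω' h ⟨u, hu, hc⟩
  refine ⟨u, hu, ?_⟩
  refine (clusters_eq_of_agree ?_).trans hc
  intro v hv
  apply h
  rw [hc] at hv
  rcases hv with (hv | hv) | hv
  · exact Or.inl (Or.inr (by rw [hv.1]; exact hu))
  · exact Or.inl (Or.inr hv)
  · exact Or.inr hv

theorem clusterEvent_disjoint {A C C' : Set Site} {ω : Config} (h : ω ∈ ClusterEvent A C)
    (h' : ω ∈ ClusterEvent A C') {v : Site} (hv : v ∈ inspected A ∅ C) (hv' : v ∈ C') :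
    C = C' := by
  have e' := clusterEvent_iff hv' h'
  have hvX : v ∈ cl ω ∩ A := clusters_subset (e'.symm ▸ hv' : v ∈ clusters A {v} ω)
  have hvC : v ∈ C := by
    rcases hv with (hv | hv) | ⟨_, k, hk, hkv⟩
    · exact absurd hv.1 (Set.notMem_empty _)
    · exact hv
    · have e := clusterEvent_iff hk h
      have hkX : k ∈ cl ω ∩ A := clusters_subset (e.symm ▸ hk : k ∈ clusters A {k} ω)
      rw [← e, mem_clusters_singleton]
      exact Conn.single hkX hkv hvX
  rw [← clusterEvent_iff hvC h, e']

/-- The set `C` joins the inside of a half annulus to its outside. -/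
def Spans (z : Site) (B : ℤ) (C : Set Site) : Prop :=
  (∃ u ∈ C, nrm z u ≤ B + 1) ∧ ∃ w ∈ C, 8 * B ≤ nrm z w

theorem sum_clusterEvent_le {μ : Measure Config} (hμ : IsBernoulliHalf μ) {z : Site} {B : ℤ}
    (hB : 1 ≤ B) {A : Set Site} (hA : A.Finite) (hAz : A ⊆ half z) (S : Finset (Set Site))
    (hS : ∀ C ∈ S, C ⊆ A ∧ Spans z B C) :
    ∑ C ∈ S, μ.real (ClusterEvent A C) ≤ 1 / rswC ^ 3 := by
  have := hμ.1
  have hc : (0 : ℝ) < rswC ^ 3 := pow_pos rswC_pos 3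
  rw [le_div_iff₀ hc, Finset.sum_mul]
  let N : Set Site → Set Config := fun C =>
    {ω | ¬ Crosses z (B + 1) (8 * B) (cl ω ∩ (A \ inspected A ∅ C))}
  have hN : ∀ C, Dep (A \ inspected A ∅ C) (N C) := fun C =>
    dep_cl _ (fun X => ¬ Crosses z (B + 1) (8 * B) X)
  have hfin : ∀ C ∈ S, (inspected A ∅ C).Finite := fun C hC =>
    hA.subset (inspected_subset (hS C hC).1)
  have h1 : ∀ C ∈ S, μ.real (ClusterEvent A C) * rswC ^ 3 ≤ μ.real (ClusterEvent A C ∩ N C) := by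
    intro C hC
    rw [prob_inter_of_disjoint hμ (hfin C hC) (hA.subset Set.sdiff_subset)
      Set.disjoint_sdiff_right (dep_clusterEvent A C (hS C hC).1) (hN C)]
    refine mul_le_mul_of_nonneg_left ?_ measureReal_nonneg
    refine (block_ge hμ z hB).trans (measureReal_mono ?_)
    intro ω hω hc
    exact hω (hc.mono fun v hv => ⟨hv.1, hAz hv.2.1⟩)
  refine (Finset.sum_le_sum h1).trans ?_
  rw [← measureReal_biUnion_finset]
  · exact measureReal_le_one
  · intro C hC C' hC' hne
    rw [Function.onFun, Set.disjoint_left]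
    rintro ω ⟨h2, h3⟩ ⟨h4, h5⟩
    apply h3
    obtain ⟨⟨u, hu, hu'⟩, w, hw, hw'⟩ := (hS C' hC').2
    have e := clusterEvent_iff hu h4
    have hcn : Conn (cl ω ∩ A) u w := mem_clusters_singleton.1 (e.symm ▸ hw)
    refine Crosses.of_conn (hcn.restrict' (B := cl ω ∩ (A \ inspected A ∅ C)) ?_) (by omega) hu' hw'
    intro t ht
    refine ⟨ht.right_mem.1, ht.right_mem.2, fun hti => hne ?_⟩
    exact clusterEvent_disjoint h2 h4 hti (e ▸ mem_clusters_singleton.2 ht)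
  · intro C hC
    have l1 : Loc (ClusterEvent A C) := (dep_clusterEvent A C (hS C hC).1).loc (hfin C hC)
    have l2 : Loc (N C) := (hN C).loc (hA.subset Set.sdiff_subset)
    exact (l1.inter l2).measurableSet

theorem sum_le_of_spanning {μ : Measure Config} (hμ : IsBernoulliHalf μ) {z : Site} {B : ℤ}
    (hB : 1 ≤ B) {A : Set Site} (hA : A.Finite) (hAz : A ⊆ half z) (J : Finset ℕ)
    (V : ℕ → Set Config) (Y : ℕ → ℤ) (hY : ∀ i j, i < j → Y (i + 1) ≤ Y j)
    (hV : ∀ i ∈ J, ∀ ω ∈ V i, ∃ u ∈ cl ω ∩ A, nrm z u ≤ B + 1 ∧ u.2 < Y (i + 1) ∧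
      (∃ w, 8 * B ≤ nrm z w ∧ Conn (cl ω ∩ A) u w) ∧ ∀ t, Conn (cl ω ∩ A) u t → Y i < t.2) :
    ∑ i ∈ J, μ.real (V i) ≤ 1 / rswC ^ 3 := by
  classical
  have := hμ.1
  let S : ℕ → Finset (Set Site) := fun i => hA.finite_subsets.toFinset.filter fun C =>
    Spans z B C ∧ (∃ u ∈ C, u.2 < Y (i + 1)) ∧ ∀ t ∈ C, Y i < t.2
  have hS : ∀ i C, C ∈ S i ↔ C ⊆ A ∧ Spans z B C ∧ (∃ u ∈ C, u.2 < Y (i + 1)) ∧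
      ∀ t ∈ C, Y i < t.2 := by
    intro i C
    simp only [S, Finset.mem_filter, Set.Finite.mem_toFinset, Set.mem_ofPred_eq]
  have hdis : Set.PairwiseDisjoint (J : Set ℕ) S := by
    have key : ∀ i j C, i < j → C ∈ S i → C ∈ S j → False := by
      intro i j C hij h1 h2
      obtain ⟨_, _, ⟨u, hu, hu'⟩, _⟩ := (hS i C).1 h1
      have := ((hS j C).1 h2).2.2.2 u hu
      have := hY i j hij
      omega
    intro i _ j _ hij
    rw [Function.onFun, Finset.disjoint_left]
    intro C h1 h2
    rcases lt_or_gt_of_ne hij with h | h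
    · exact key i j C h h1 h2
    · exact key j i C h h2 h1
  have h1 : ∀ i ∈ J, μ.real (V i) ≤ ∑ C ∈ S i, μ.real (ClusterEvent A C) := by
    intro i hi
    refine (measureReal_mono ?_ (measure_ne_top _ _)).trans (measureReal_biUnion_finset_le (S i) _)
    intro ω hω
    obtain ⟨u, hu, hu1, hu2, ⟨w, hw, hw'⟩, ht⟩ := hV i hi ω hω
    have hm : u ∈ clusters A {u} ω := mem_clusters_singleton.2 (.refl hu)
    refine Set.mem_biUnion (x := clusters A {u} ω) ?_ ⟨u, hm, rfl⟩
    refine (hS i _).2 ⟨fun v hv => (clusters_subset hv).2, ⟨⟨u, hm, hu1⟩,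
      w, mem_clusters_singleton.2 hw', hw⟩, ⟨u, hm, hu2⟩, ?_⟩
    intro t h
    exact ht t (mem_clusters_singleton.1 h)
  refine (Finset.sum_le_sum h1).trans ?_
  rw [← Finset.sum_biUnion hdis]
  refine sum_clusterEvent_le hμ hB hA hAz _ ?_
  intro C hC
  obtain ⟨i, _, hi⟩ := Finset.mem_biUnion.1 hC
  exact ⟨((hS i C).1 hi).1, ((hS i C).1 hi).2.1⟩

/-! ### Arms whose cluster avoids the boundary row -/

/-- A closed crossing of an annulus inside `D` whose cluster avoids the row of `z`. -/
def Arm (D : Set Site) (z : Site) (p q : ℤ) : Set Config :=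
  {ω | ∃ u w, (nrm z u = p ∧ nrm z w = q) ∧ Conn (cl ω ∩ (D ∩ ann z p q)) u w ∧
    ∀ t, Conn (cl ω ∩ (D ∩ ann z p q)) u t → z.2 < t.2}

/-- A closed connection to distance `q` inside `D` whose cluster avoids the row of `z`. -/
def FullArm (D : Set Site) (z : Site) (s q : ℤ) : Set Config :=
  {ω | ∃ u w, (nrm z u = 8 * s + 1 ∧ nrm z w = q) ∧ Conn (cl ω ∩ (D ∩ {v | nrm z v ≤ q})) u w ∧
    ∀ t, Conn (cl ω ∩ (D ∩ {v | nrm z v ≤ q})) u t → z.2 < t.2}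

theorem dep_conn_cl' (R : Set Site) (Q : (Site → Site → Prop) → Prop) :
    Dep R {ω | Q (Conn (cl ω ∩ R))} := dep_cl R (fun X => Q (Conn X))

theorem dep_arm (D : Set Site) (z : Site) (p q : ℤ) : Dep (D ∩ ann z p q) (Arm D z p q) :=
  dep_conn_cl' _ fun c => ∃ u w, (nrm z u = p ∧ nrm z w = q) ∧ c u w ∧ ∀ t, c u t → z.2 < t.2

theorem dep_fullArm (D : Set Site) (z : Site) (s q : ℤ) :
    Dep (D ∩ {v | nrm z v ≤ q}) (FullArm D z s q) :=
  dep_conn_cl' _ fun c =>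
    ∃ u w, (nrm z u = 8 * s + 1 ∧ nrm z w = q) ∧ c u w ∧ ∀ t, c u t → z.2 < t.2

theorem arm_le_fullArm {μ : Measure Config} (hμ : IsBernoulliHalf μ) {D : Set Site} {z : Site}
    (hD : D ⊆ half z) {s q : ℤ} (hs : 1 ≤ s) (hq : 8 * s + 1 ≤ q) :
    rswC ^ 3 * μ.real (Arm D z (s + 1) q) ≤ μ.real (FullArm D z s q) := by
  have := hμ.1
  let E : Set Config := {ω | ∃ u w, (nrm z u = 8 * s + 1 ∧ nrm z w = q) ∧
    Conn (cl ω ∩ (D ∩ ann z (8 * s + 1) q)) u w ∧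
    ∀ t, Conn (cl ω ∩ (D ∩ ann z (s + 1) q)) u t → z.2 < t.2}
  have hfin : (D ∩ ann z (s + 1) q).Finite :=
    (half_ann_finite z (s + 1) q).subset (Set.inter_subset_inter_left _ hD)
  have hE : Loc E := by
    refine Dep.loc (A := D ∩ ann z (s + 1) q) ?_ hfin
    have e : E = {ω | (fun X => ∃ u w, (nrm z u = 8 * s + 1 ∧ nrm z w = q) ∧
        Conn (X ∩ ann z (8 * s + 1) q) u w ∧ ∀ t, Conn X u t → z.2 < t.2)
        (cl ω ∩ (D ∩ ann z (s + 1) q))} := by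
      ext ω
      have : cl ω ∩ (D ∩ ann z (s + 1) q) ∩ ann z (8 * s + 1) q =
          cl ω ∩ (D ∩ ann z (8 * s + 1) q) := by
        ext v
        simp only [Set.mem_inter_iff, ann, Set.mem_ofPred_eq]
        constructor
        · rintro ⟨⟨h1, h2, h3⟩, h4⟩; exact ⟨h1, h2, h4⟩
        · rintro ⟨h1, h2, h3, h4⟩; exact ⟨⟨h1, h2, by omega, h4⟩, h3, h4⟩
      simp only [E, Set.mem_ofPred_eq, this]
    rw [e]
    exact dep_cl (D ∩ ann z (s + 1) q) fun X => ∃ u w, (nrm z u = 8 * s + 1 ∧ nrm z w = q) ∧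
      Conn (X ∩ ann z (8 * s + 1) q) u w ∧ ∀ t, Conn X u t → z.2 < t.2
  have hArm : Arm D z (s + 1) q ⊆ E := by
    rintro ω ⟨u, w, ⟨hu, hw⟩, hc, ht⟩
    obtain ⟨u', w', h1, h2, h3, h4⟩ :=
      hc.ring (lip_nrm z) (p := 8 * s + 1) (q := q) hq (by omega) hw.ge
    refine ⟨u', w', ⟨h1, h2⟩, h4.mono ?_, fun t h => ht t (h3.trans h)⟩
    rintro v ⟨⟨h5, h6, _⟩, h7⟩
    exact ⟨h5, h6, h7⟩
  have hInc : Inc (half z ∩ ann z (s + 1) (8 * s)) E := by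
    rintro ω ω' h1 h2 ⟨u, w, huw, hc, ht⟩
    refine ⟨u, w, huw, hc.mono ?_, ?_⟩
    · rintro v ⟨h3, h4, h5⟩
      refine ⟨?_, h4, h5⟩
      rw [mem_cl, ← h2 v ?_]
      · exact h3
      · rintro ⟨_, h6, h7⟩
        have := h5.1
        omega
    · intro t h
      refine ht t (h.mono ?_)
      rintro v ⟨h3, h4⟩
      refine ⟨?_, h4⟩
      by_cases hv : v ∈ half z ∩ ann z (s + 1) (8 * s)
      · by_contra h5
        rw [not_mem_cl, mem_op] at h5
        have := h1 v hv h5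
        rw [mem_cl] at h3
        simp [h3] at this
      · rw [mem_cl, h2 v hv]; exact h3
  have hEB : E ∩ Block z s ⊆ FullArm D z s q := by
    rintro ω ⟨⟨u, w, ⟨hu, hw⟩, hc, ht⟩, hb⟩
    refine ⟨u, w, ⟨hu, hw⟩, hc.mono ?_, ?_⟩
    · rintro v ⟨h3, h4, h5⟩
      exact ⟨h3, h4, h5.2⟩
    · intro t h
      apply ht
      refine h.restrict' ?_
      intro v hv
      refine ⟨hv.right_mem.1, hv.right_mem.2.1, ?_, hv.right_mem.2.2⟩
      by_contra hlt
      apply hb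
      refine (Crosses.of_conn (hv.symm) (by omega) (by omega) (by omega)).mono ?_
      rintro x ⟨h5, h6, _⟩
      exact ⟨h5, hD h6⟩
  calc rswC ^ 3 * μ.real (Arm D z (s + 1) q) ≤ μ.real (Block z s) * μ.real E :=
        mul_le_mul (block_ge hμ z hs) (measureReal_mono hArm) measureReal_nonneg measureReal_nonneg
    _ = μ.real E * μ.real (Block z s) := mul_comm _ _
    _ ≤ μ.real (E ∩ Block z s) := harris hμ (half_ann_finite z _ _) hE (dep_block z s) hInc
        (inc_block z s _)
    _ ≤ _ := measureReal_mono hEB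

/-- Arms in different rows produce different crossing clusters. -/
theorem sum_fullArm_le {μ : Measure Config} (hμ : IsBernoulliHalf μ) {z0 : Site} {s B : ℤ}
    (hs : 1 ≤ s) (hB : 1 ≤ B) {D : Set Site} (hD : D ⊆ half z0) (J : Finset ℕ)
    (Z : ℕ → Set Site) (hZ : ∀ h ∈ J, ∀ z ∈ Z h, z.2 = z0.2 + 16 * s * h ∧
      z.1 - z0.1 ≤ B - 8 * s ∧ z0.1 - z.1 ≤ B - 8 * s ∧ 16 * s * h ≤ B - 8 * s) :
    ∑ h ∈ J, μ.real {ω | ∃ z ∈ Z h, ω ∈ FullArm (D ∩ half z) z s (16 * B)} ≤ 1 / rswC ^ 3 := by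
  refine sum_le_of_spanning hμ hB (A := D ∩ ann z0 0 (8 * B)) (z := z0)
    ((half_ann_finite z0 0 (8 * B)).subset (Set.inter_subset_inter_left _ hD))
    (fun v hv => hD hv.1) J _ (fun h => z0.2 + 16 * s * h) ?_ ?_
  · intro i j hij
    have : ((i + 1 : ℕ) : ℤ) ≤ j := by exact_mod_cast hij
    have := mul_le_mul_of_nonneg_left this (show (0 : ℤ) ≤ 16 * s by omega)
    omega
  · rintro h hh ω ⟨z, hz, u, w, ⟨hu, hw⟩, hc, ht⟩
    obtain ⟨hz2, hz1, hz1', hz3⟩ := hZ h hh z hz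
    have h0 : 0 ≤ 16 * s * (h : ℤ) := by positivity
    obtain ⟨q1, q2, q3⟩ := hc.left_mem
    have e1 := hD q2.1
    have e2 := q2.2
    simp only [half, Set.mem_ofPred_eq] at e1 e2
    have hu0 : nrm z0 u ≤ B + 1 := by
      simp only [nrm] at hu ⊢; omega
    have hw0 : 8 * B ≤ nrm z0 w := by
      simp only [nrm] at hw ⊢; omega
    obtain ⟨w', hw'1, _, hw'2⟩ := hc.ring_upper (lip_nrm z0) (q := 8 * B) (by omega) hw0
    have hsub : cl ω ∩ (D ∩ half z ∩ {v | nrm z v ≤ 16 * B}) ∩ {v | nrm z0 v ≤ 8 * B} ⊆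
        cl ω ∩ (D ∩ ann z0 0 (8 * B)) := by
      rintro v ⟨⟨h1, ⟨h2, _⟩, _⟩, h3⟩
      refine ⟨h1, h2, ?_, h3⟩
      simp only [nrm]; omega
    have hcu := hw'2.mono hsub
    have hY1 : u.2 < z0.2 + 16 * s * ((h + 1 : ℕ) : ℤ) := by
      simp only [nrm] at hu
      push_cast
      rw [mul_add]
      omega
    refine ⟨u, hcu.left_mem, hu0, hY1, ⟨w', hw'1.ge, hcu⟩, ?_⟩
    intro t htc
    have key : Conn (cl ω ∩ (D ∩ half z ∩ {v | nrm z v ≤ 16 * B})) u t := by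
      refine htc.ind (P := fun t => Conn (cl ω ∩ (D ∩ half z ∩ {v | nrm z v ≤ 16 * B})) u t)
        (.refl hc.left_mem) ?_
      intro a b _ ha hab hb
      refine ha.tail hab ⟨hb.1, ⟨hb.2.1, ?_⟩, ?_⟩
      · have h1 := ht a ha
        rw [adj_iff] at hab
        simp only [half, Set.mem_ofPred_eq]
        omega
      · have h1 := hb.2.2.2
        have h2 := hD hb.2.1
        simp only [half, Set.mem_ofPred_eq, nrm] at h1 h2 ⊢
        omega
    have := ht t key
    omega

/-! ### Translation invariance and the linear bound for arms -/

theorem conn_shift_iff {A B : Set Site} {d : Site} (h : ∀ v, v ∈ A ↔ v + d ∈ B) {u w : Site} :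
    Conn A u w ↔ Conn B (u + d) (w + d) := by
  constructor
  · intro hc
    exact hc.map (φ := fun v => v + d) (adj_add d) fun a ha => (h a).1 ha
  · intro hc
    have := hc.map (φ := fun v => v + -d) (B := A) (adj_add (-d)) fun a ha =>
      (h _).2 (by rwa [neg_add_cancel_right])
    simpa only [add_neg_cancel_right] using this

theorem nrm_add (z v d : Site) : nrm (z + d) (v + d) = nrm z v := by
  simp only [nrm, Prod.fst_add, Prod.snd_add]; omega

theorem arm_shift_subset {D D' : Set Site} {d : Site} (h : ∀ v, v ∈ D ↔ v + d ∈ D') (z : Site)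
    (p q : ℤ) : relabel (shift d) false ⁻¹' Arm D z p q ⊆ Arm D' (z + d) p q := by
  intro ω hω
  have key : ∀ v, v ∈ cl (relabel (shift d) false ω) ∩ (D ∩ ann z p q) ↔
      v + d ∈ cl ω ∩ (D' ∩ ann (z + d) p q) := by
    intro v
    rw [cl_relabel]
    simp only [Set.mem_inter_iff, Set.mem_preimage, shift_apply, ann, Set.mem_ofPred_eq, nrm_add, h]
  obtain ⟨u, w, ⟨hu, hw⟩, hc, ht⟩ := hω
  refine ⟨u + d, w + d, ⟨by rw [nrm_add, hu], by rw [nrm_add, hw]⟩, (conn_shift_iff key).1 hc, ?_⟩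
  intro t hc'
  have := ht (t + -d) ((conn_shift_iff key).2 (by rwa [neg_add_cancel_right]))
  simp only [Prod.snd_add, Prod.snd_neg] at this ⊢
  omega

/-- A family of domains indexed by their base point is translation invariant. -/
def TransInv (D : Site → Set Site) : Prop := ∀ z d v, v ∈ D z ↔ v + d ∈ D (z + d)

theorem prob_arm_le_shift {μ : Measure Config} (hμ : IsBernoulliHalf μ) {D : Site → Set Site}
    (hD : TransInv D) (hDh : ∀ z, D z ⊆ half z) (z z' : Site) (p q : ℤ) :
    μ.real (Arm (D z) z p q) ≤ μ.real (Arm (D z') z' p q) := by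
  have := hμ.1
  rw [← prob_relabel hμ (shift (z' - z)) false (dep_arm (D z) z p q |>.loc ?_)]
  · refine measureReal_mono ?_
    have := arm_shift_subset (D := D z) (D' := D z') (d := z' - z) (fun v => ?_) z p q
    · rwa [add_sub_cancel] at this
    · rw [hD z (z' - z) v, add_sub_cancel]
  · exact (half_ann_finite z p q).subset (Set.inter_subset_inter_left _ (hDh z))

/-- The cone above `z` of the sites at angle at least `π / 4` from the positive axis. -/
def cone (z : Site) : Set Site := {v | z.2 ≤ v.2 ∧ v.1 - z.1 ≤ v.2 - z.2}

/-- The quadrant to the upper left of `z`. -/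
def corner (z : Site) : Set Site := {v | z.2 ≤ v.2 ∧ v.1 ≤ z.1}

theorem transInv_half : TransInv half := by
  intro z d v; simp only [half, Set.mem_ofPred_eq, Prod.snd_add]; omega

theorem transInv_cone : TransInv cone := by
  intro z d v; simp only [cone, Set.mem_ofPred_eq, Prod.snd_add, Prod.fst_add]; omega

theorem transInv_corner : TransInv corner := by
  intro z d v; simp only [corner, Set.mem_ofPred_eq, Prod.snd_add, Prod.fst_add]; omega

theorem rswC3_le_one {μ : Measure Config} (hμ : IsBernoulliHalf μ) : rswC ^ 3 ≤ 1 := by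
  have := hμ.1
  exact (block_ge hμ (0, 0) le_rfl).trans measureReal_le_one

theorem arm_linear {μ : Measure Config} (hμ : IsBernoulliHalf μ) {D : Site → Set Site}
    (hD : TransInv D) (hDh : ∀ z, D z ⊆ half z) {δ : ℤ} (hδ0 : 0 ≤ δ) (hδ1 : δ ≤ 1)
    (hdir : ∀ z a, 0 ≤ a → D z ∩ half (z + (δ * a, a)) = D (z + (δ * a, a)))
    {s : ℤ} (hs : 1 ≤ s) {J : ℕ} (hJ : 1 ≤ J) (z : Site) :
    J * (rswC ^ 3) ^ 2 * μ.real (Arm (D z) z (s + 1) (256 * J * s)) ≤ 1 := by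
  have := hμ.1
  have hc : (0 : ℝ) < rswC ^ 3 := pow_pos rswC_pos 3
  have hJs : (1 : ℤ) * s ≤ J * s := mul_le_mul_of_nonneg_right (by exact_mod_cast hJ) (by omega)
  have key := sum_fullArm_le hμ hs (z0 := z) (B := 16 * J * s) (by nlinarith) (hDh z)
    (Finset.range J) (fun h => {z + (δ * (16 * s * h), 16 * s * h)}) (by
      intro h hh z' hz'
      rw [Set.mem_singleton_iff] at hz'
      rw [Finset.mem_range] at hh
      have h1 : ((h : ℤ) + 1) * s ≤ J * s := mul_le_mul_of_nonneg_right (by exact_mod_cast hh)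
        (by omega)
      have h0 : 0 ≤ (h : ℤ) * s := by positivity
      have h2 : δ * (16 * s * h) ≤ 16 * s * h := by nlinarith
      have h3 : 0 ≤ δ * (16 * s * h) := by positivity
      subst hz'
      simp only [Prod.fst_add, Prod.snd_add]
      refine ⟨trivial, ?_, ?_, ?_⟩ <;> nlinarith)
  have h1 : ∀ h ∈ Finset.range J, rswC ^ 3 * μ.real (Arm (D z) z (s + 1) (256 * J * s)) ≤
      μ.real {ω | ∃ z' ∈ ({z + (δ * (16 * s * h), 16 * s * h)} : Set Site),
        ω ∈ FullArm (D z ∩ half z') z' s (16 * (16 * J * s))} := by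
    intro h _
    simp only [Set.mem_singleton_iff, exists_eq_left, Set.ofPred_mem_eq]
    rw [hdir z _ (by positivity)]
    refine le_trans ?_ (arm_le_fullArm hμ (hDh _) hs (by nlinarith))
    refine mul_le_mul_of_nonneg_left ?_ hc.le
    rw [show 16 * (16 * J * s) = 256 * J * s by ring]
    exact prob_arm_le_shift hμ hD hDh _ _ _ _
  have h2 := (Finset.sum_le_sum h1).trans key
  rw [Finset.sum_const, Finset.card_range, nsmul_eq_mul, le_div_iff₀ hc] at h2
  linarith

theorem arm_linear_pow {μ : Measure Config} (hμ : IsBernoulliHalf μ) {D : Site → Set Site}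
    (hD : TransInv D) (hDh : ∀ z, D z ⊆ half z) {δ : ℤ} (hδ0 : 0 ≤ δ) (hδ1 : δ ≤ 1)
    (hdir : ∀ z a, 0 ≤ a → D z ∩ half (z + (δ * a, a)) = D (z + (δ * a, a)))
    {s : ℤ} (hs : 1 ≤ s) (l : ℕ) (z : Site) :
    μ.real (Arm (D z) z (s + 1) (2 ^ l * s)) ≤ 256 / (rswC ^ 3) ^ 2 * (1 / 2) ^ l := by
  have := hμ.1
  have hc : (0 : ℝ) < rswC ^ 3 := pow_pos rswC_pos 3
  have hc1 := rswC3_le_one hμ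
  by_cases hl : l < 8
  · refine measureReal_le_one.trans ?_
    have h1 : (1 : ℝ) ≤ 256 * (1 / 2) ^ l := by
      have : ((1 : ℝ) / 2) ^ 8 ≤ (1 / 2) ^ l :=
        pow_le_pow_of_le_one (by norm_num) (by norm_num) hl.le
      norm_num at this ⊢; linarith
    have h2 : (1 : ℝ) ≤ 1 / (rswC ^ 3) ^ 2 := by
      rw [le_div_iff₀ (by positivity), one_mul]
      exact pow_le_one₀ hc.le hc1
    calc (1 : ℝ) ≤ (1 / (rswC ^ 3) ^ 2) * (256 * (1 / 2) ^ l) := one_le_mul_of_one_le_of_one_le h2 h1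
      _ = _ := by ring
  · obtain ⟨k, rfl⟩ := Nat.exists_eq_add_of_le (not_lt.1 hl)
    have := arm_linear hμ hD hDh hδ0 hδ1 hdir hs (J := 2 ^ k) Nat.one_le_two_pow z
    rw [show (256 * ((2 ^ k : ℕ) : ℤ) * s) = 2 ^ (8 + k) * s by push_cast; ring] at this
    have h3 : (0 : ℝ) < 2 ^ k * (rswC ^ 3) ^ 2 := by positivity
    have h4 : μ.real (Arm (D z) z (s + 1) (2 ^ (8 + k) * s)) ≤ 1 / (2 ^ k * (rswC ^ 3) ^ 2) := by
      rw [le_div_iff₀ h3]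
      push_cast at this
      linarith
    refine h4.trans (le_of_eq ?_)
    rw [pow_add, one_div_pow, one_div_pow]
    field_simp
    norm_num

theorem half_linear {μ : Measure Config} (hμ : IsBernoulliHalf μ) {s : ℤ} (hs : 1 ≤ s) (l : ℕ)
    (z : Site) : μ.real (Arm (half z) z (s + 1) (2 ^ l * s)) ≤
      256 / (rswC ^ 3) ^ 2 * (1 / 2) ^ l := by
  refine arm_linear_pow hμ transInv_half (fun _ => subset_rfl) (δ := 0) le_rfl zero_le_one ?_ hs l z
  intro z a ha
  ext v
  simp only [half, Set.mem_inter_iff, Set.mem_ofPred_eq, Prod.snd_add]; omega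

theorem cone_linear {μ : Measure Config} (hμ : IsBernoulliHalf μ) {s : ℤ} (hs : 1 ≤ s) (l : ℕ)
    (z : Site) : μ.real (Arm (cone z) z (s + 1) (2 ^ l * s)) ≤
      256 / (rswC ^ 3) ^ 2 * (1 / 2) ^ l := by
  refine arm_linear_pow hμ transInv_cone (fun _ v hv => hv.1) (δ := 1) zero_le_one le_rfl ?_ hs l z
  intro z a ha
  ext v
  simp only [cone, half, Set.mem_inter_iff, Set.mem_ofPred_eq, Prod.snd_add, Prod.fst_add]; omega

/-! ### The quadratic recursion for arms in the half plane -/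

theorem sq_sum_prob_le {μ : Measure Config} [IsProbabilityMeasure μ] {ι : Type*} (S : Finset ι)
    (E : ι → Set Config) (hE : ∀ i, MeasurableSet (E i)) :
    (∑ i ∈ S, μ.real (E i)) ^ 2 ≤
      μ.real (⋃ i ∈ S, E i) * ∑ i ∈ S, ∑ j ∈ S, μ.real (E i ∩ E j) := by
  classical
  set U : Set Config := ⋃ i ∈ S, E i with hU
  have hUm : MeasurableSet U := S.measurableSet_biUnion fun i _ => hE i
  have hint : ∀ F : Set Config, MeasurableSet F → Integrable (F.indicator (1 : Config → ℝ)) μ :=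
    fun F hF => (integrable_const (1 : ℝ)).indicator hF
  have key : ∀ t : ℝ, 0 ≤ (∑ i ∈ S, ∑ j ∈ S, μ.real (E i ∩ E j)) - 2 * t * (∑ i ∈ S, μ.real (E i))
      + t ^ 2 * μ.real U := by
    intro t
    let g : Config → ℝ := fun ω => (∑ i ∈ S, ∑ j ∈ S, (E i ∩ E j).indicator (1 : Config → ℝ) ω) -
      2 * t * (∑ i ∈ S, (E i).indicator (1 : Config → ℝ) ω) + t ^ 2 * U.indicator (1 : Config → ℝ) ω
    have hg : ∫ ω, g ω ∂μ = (∑ i ∈ S, ∑ j ∈ S, μ.real (E i ∩ E j)) -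
        2 * t * (∑ i ∈ S, μ.real (E i)) + t ^ 2 * μ.real U := by
      have i1 : Integrable (fun ω => ∑ i ∈ S, ∑ j ∈ S,
          (E i ∩ E j).indicator (1 : Config → ℝ) ω) μ :=
        integrable_finsetSum _ fun i _ => integrable_finsetSum _ fun j _ =>
          hint _ ((hE i).inter (hE j))
      have i2 : Integrable (fun ω => ∑ i ∈ S, (E i).indicator (1 : Config → ℝ) ω) μ :=
        integrable_finsetSum _ fun i _ => hint _ (hE i)
      have i3 := hint U hUm
      have i12 : Integrable (fun ω => (∑ i ∈ S, ∑ j ∈ S,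
          (E i ∩ E j).indicator (1 : Config → ℝ) ω) -
          2 * t * (∑ i ∈ S, (E i).indicator (1 : Config → ℝ) ω)) μ := i1.sub (i2.const_mul _)
      simp only [g]
      rw [integral_add i12 (i3.const_mul _),
        integral_sub i1 (i2.const_mul _), integral_const_mul, integral_const_mul,
        integral_finsetSum _ fun i _ => hint _ (hE i),
        integral_finsetSum _ fun i _ => integrable_finsetSum _ fun j _ =>
          hint _ ((hE i).inter (hE j)), integral_indicator_one hUm]
      simp only [integral_indicator_one (hE _)]
      congr 2
      refine Finset.sum_congr rfl fun i _ => ?_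
      rw [integral_finsetSum _ fun j _ => hint _ ((hE i).inter (hE j))]
      exact Finset.sum_congr rfl fun j _ => integral_indicator_one ((hE i).inter (hE j))
    rw [← hg]
    refine integral_nonneg fun ω => ?_
    have h1 : ∑ i ∈ S, ∑ j ∈ S, (E i ∩ E j).indicator (1 : Config → ℝ) ω =
        (∑ i ∈ S, (E i).indicator (1 : Config → ℝ) ω) ^ 2 := by
      rw [pow_two, Finset.sum_mul_sum]
      refine Finset.sum_congr rfl fun i _ => Finset.sum_congr rfl fun j _ => ?_
      rw [Set.inter_indicator_one]; rfl
    simp only [Pi.zero_apply, g, h1]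
    by_cases hω : ω ∈ U
    · rw [Set.indicator_of_mem hω]
      simp only [Pi.one_apply]
      nlinarith [sq_nonneg (∑ i ∈ S, (E i).indicator (1 : Config → ℝ) ω - t)]
    · have h2 : ∑ i ∈ S, (E i).indicator (1 : Config → ℝ) ω = 0 := by
        refine Finset.sum_eq_zero fun i hi => Set.indicator_of_notMem ?_ _
        exact fun h => hω (Set.mem_biUnion (show i ∈ (S : Set ι) from hi) h)
      rw [h2, Set.indicator_of_notMem hω]
      simp
  set a := ∑ i ∈ S, ∑ j ∈ S, μ.real (E i ∩ E j)
  set b := ∑ i ∈ S, μ.real (E i) with hb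
  have hu : 0 ≤ μ.real U := measureReal_nonneg
  rcases hu.eq_or_lt with h | h
  · have hb0 : b = 0 := by
      refine Finset.sum_eq_zero fun i hi => le_antisymm ?_ measureReal_nonneg
      rw [h]
      exact measureReal_mono (Set.subset_biUnion_of_mem (show i ∈ (S : Set ι) from hi))
        (measure_ne_top _ _)
    rw [← h, hb0]; simp
  · have := key (b / μ.real U)
    have h3 : a - 2 * (b / μ.real U) * b + (b / μ.real U) ^ 2 * μ.real U =
        a - b ^ 2 / μ.real U := by
      field_simp; ring
    rw [h3, sub_nonneg, div_le_iff₀ h] at this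
    linarith

theorem arm_of_conn {ω : Config} {X D : Set Site} {z : Site} {p q : ℤ} {u w : Site}
    (hc : Conn X u w) (ht : ∀ t, Conn X u t → z.2 < t.2)
    (hX : X ∩ ann z p q ⊆ D ∩ cl ω) (hX' : cl ω ∩ (D ∩ ann z p q) ⊆ X)
    (hpq : p ≤ q) (hu : nrm z u ≤ p) (hw : q ≤ nrm z w) : ω ∈ Arm D z p q := by
  obtain ⟨u', w', h1, h2, h3, h4⟩ := hc.ring (lip_nrm z) hpq hu hw
  refine ⟨u', w', ⟨h1, h2⟩, h4.mono ?_, fun t h => ht t (h3.trans (h.mono hX'))⟩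
  rintro v hv
  exact ⟨(hX hv).2, (hX hv).1, hv.2⟩

theorem fullArm_subset_arm (D : Set Site) (z : Site) {s q p' q' : ℤ} (h1 : 8 * s + 1 ≤ p')
    (h2 : p' ≤ q') (h3 : q' ≤ q) : FullArm D z s q ⊆ Arm D z p' q' := by
  rintro ω ⟨u, w, ⟨hu, hw⟩, hc, ht⟩
  refine arm_of_conn hc ht ?_ ?_ h2 (by omega) (by omega)
  · rintro v ⟨⟨h4, h5, _⟩, _⟩; exact ⟨h5, h4⟩
  · rintro v ⟨h4, h5, h6⟩; exact ⟨h4, h5, h6.2.trans h3⟩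

theorem loc_fullArm_half (z : Site) (s q : ℤ) : Loc (FullArm (half z) z s q) := by
  refine (dep_fullArm _ _ _ _).loc ((half_ann_finite z 0 q).subset ?_)
  rintro v ⟨h1, h2⟩
  refine ⟨h1, ?_, h2⟩
  simp only [nrm]; omega

/-- A bound for arms in half annuli of ratio `2 ^ j`. -/
def ArmBound (μ : Measure Config) (j : ℕ) (A : ℝ) : Prop :=
  ∀ s : ℤ, 1 ≤ s → ∀ z, μ.real (Arm (half z) z (s + 1) (2 ^ j * s)) ≤ A

theorem pair_le {μ : Measure Config} (hμ : IsBernoulliHalf μ) {s : ℤ} (hs : 1 ≤ s) {l e : ℕ}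
    (hel : e + 9 ≤ l) {A : ℕ → ℝ} (hA0 : 1 ≤ A 0) (hA : ∀ j < l, ArmBound μ j (A j))
    {z : Site} {Δ : ℤ} (h1 : 2 ^ (e + 4) * s ≤ Δ) (h2 : Δ < 2 ^ (e + 5) * s) :
    μ.real (FullArm (half z) z s (2 ^ l * s) ∩
      FullArm (half (z + (Δ, 0))) (z + (Δ, 0)) s (2 ^ l * s)) ≤ A (e - 1) ^ 2 * A (l - e - 6) := by
  have := hμ.1
  set z' := z + (Δ, 0) with hz'
  have hle : (2 : ℤ) ^ (l - e - 6) * (2 ^ (e + 6) * s) = 2 ^ l * s := by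
    rw [← mul_assoc, ← pow_add]; congr 2; omega
  have hfar : μ.real (Arm (half z) z (2 ^ (e + 6) * s + 1) (2 ^ l * s)) ≤ A (l - e - 6) := by
    rw [← hle]
    exact hA (l - e - 6) (by omega) _ (by have := pow_pos (two_pos (α := ℤ)) (e + 6); nlinarith) z
  have hP : (2 : ℤ) ^ (e + 7) ≤ 2 ^ l := pow_le_pow_right₀ one_le_two (by omega)
  have hP1 : (1 : ℤ) ≤ 2 ^ e := one_le_pow₀ one_le_two
  have hPs := mul_le_mul_of_nonneg_right hP (show 0 ≤ s by omega)
  have hP1s := mul_le_mul_of_nonneg_right hP1 (show 0 ≤ s by omega)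
  have p4 : (2 : ℤ) ^ (e + 4) * s = 16 * (2 ^ e * s) := by ring
  have p5 : (2 : ℤ) ^ (e + 5) * s = 32 * (2 ^ e * s) := by ring
  have p6 : (2 : ℤ) ^ (e + 6) * s = 64 * (2 ^ e * s) := by ring
  have p7 : (2 : ℤ) ^ (e + 7) * s = 128 * (2 ^ e * s) := by ring
  rw [p7] at hPs
  rw [p4] at h1
  rw [p5] at h2
  have hsub : FullArm (half z) z s (2 ^ l * s) ⊆
      Arm (half z) z (2 ^ (e + 6) * s + 1) (2 ^ l * s) := by
    refine fullArm_subset_arm _ _ ?_ ?_ le_rfl <;> rw [p6] <;> omega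
  have hAl : 0 ≤ A (l - e - 6) := measureReal_nonneg.trans hfar
  rcases Nat.eq_zero_or_pos e with he | he
  · refine (measureReal_mono (Set.inter_subset_left.trans hsub)).trans (hfar.trans ?_)
    rw [he]
    refine le_mul_of_one_le_left (he ▸ hAl) ?_
    exact one_le_pow₀ hA0
  · have hee : (2 : ℤ) ^ (e - 1) * (8 * s) = 4 * (2 ^ e * s) := by
      obtain ⟨e, rfl⟩ := Nat.exists_eq_succ_of_ne_zero he.ne'
      simp only [Nat.succ_eq_add_one, Nat.add_sub_cancel]; ring
    have hPe : (2 : ℤ) ≤ 2 ^ e := by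
      calc (2 : ℤ) = 2 ^ 1 := by norm_num
        _ ≤ 2 ^ e := pow_le_pow_right₀ one_le_two he
    have hPes := mul_le_mul_of_nonneg_right hPe (show 0 ≤ s by omega)
    by_cases he2 : e = 1
    · refine (measureReal_mono (Set.inter_subset_left.trans hsub)).trans (hfar.trans ?_)
      subst he2
      exact le_mul_of_one_le_left hAl (one_le_pow₀ hA0)
    have hPe4 : (4 : ℤ) ≤ 2 ^ e := by
      calc (4 : ℤ) = 2 ^ 2 := by norm_num
        _ ≤ 2 ^ e := pow_le_pow_right₀ one_le_two (by omega)
    have hPes4 := mul_le_mul_of_nonneg_right hPe4 (show 0 ≤ s by omega)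
    have n1 : ∀ x, μ.real (Arm (half x) x (8 * s + 1) (4 * (2 ^ e * s))) ≤ A (e - 1) := by
      intro x
      rw [← hee]
      exact hA (e - 1) (by omega) _ (by omega) x
    have s1 : FullArm (half z) z s (2 ^ l * s) ⊆ Arm (half z) z (8 * s + 1) (4 * (2 ^ e * s)) :=
      fullArm_subset_arm _ _ le_rfl (by omega) (by omega)
    have s2 : FullArm (half z') z' s (2 ^ l * s) ⊆
        Arm (half z') z' (8 * s + 1) (4 * (2 ^ e * s)) :=
      fullArm_subset_arm _ _ le_rfl (by omega) (by omega)
    rw [p6] at hsub hfar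
    have hA1 : 0 ≤ A (e - 1) := measureReal_nonneg.trans (n1 z)
    have d1 : Disjoint (half z ∩ ann z (8 * s + 1) (4 * (2 ^ e * s)))
        (half z' ∩ ann z' (8 * s + 1) (4 * (2 ^ e * s))) := by
      rw [Set.disjoint_left]
      rintro v ⟨_, _, h3⟩ ⟨_, _, h4⟩
      simp only [nrm, hz', Prod.fst_add] at h3 h4
      omega
    have d2 : Disjoint ((half z ∩ ann z (8 * s + 1) (4 * (2 ^ e * s))) ∪
        (half z' ∩ ann z' (8 * s + 1) (4 * (2 ^ e * s))))
        (half z ∩ ann z (64 * (2 ^ e * s) + 1) (2 ^ l * s)) := by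
      rw [Set.disjoint_left]
      rintro v (⟨_, _, h3⟩ | ⟨_, _, h3⟩) ⟨_, h4, _⟩ <;>
      · simp only [nrm, hz', Prod.fst_add, Prod.snd_add] at h3 h4
        omega
    calc _ ≤ μ.real ((Arm (half z) z (8 * s + 1) (4 * (2 ^ e * s)) ∩
          Arm (half z') z' (8 * s + 1) (4 * (2 ^ e * s))) ∩
          Arm (half z) z (64 * (2 ^ e * s) + 1) (2 ^ l * s)) :=
          measureReal_mono fun ω hω => ⟨⟨s1 hω.1, s2 hω.2⟩, hsub hω.1⟩
      _ = μ.real (Arm (half z) z (8 * s + 1) (4 * (2 ^ e * s))) *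
          μ.real (Arm (half z') z' (8 * s + 1) (4 * (2 ^ e * s))) *
          μ.real (Arm (half z) z (64 * (2 ^ e * s) + 1) (2 ^ l * s)) := by
          rw [prob_inter_of_disjoint hμ ((half_ann_finite _ _ _).union (half_ann_finite _ _ _))
            (half_ann_finite _ _ _) d2 (((dep_arm _ _ _ _).mono Set.subset_union_left).inter
              ((dep_arm _ _ _ _).mono Set.subset_union_right)) (dep_arm _ _ _ _),
            prob_inter_of_disjoint hμ (half_ann_finite _ _ _) (half_ann_finite _ _ _) d1
              (dep_arm _ _ _ _) (dep_arm _ _ _ _)]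
      _ ≤ A (e - 1) * A (e - 1) * A (l - e - 6) := by
          have := measureReal_nonneg (μ := μ) (s := Arm (half z) z (8 * s + 1) (4 * (2 ^ e * s)))
          gcongr
          · exact n1 z
          · exact n1 z'
      _ = _ := by ring

theorem sum_log_eq (f : ℕ → ℝ) (n : ℕ) :
    ∑ d ∈ Finset.Ico 1 (2 ^ n), f (Nat.log 2 d) = ∑ e ∈ Finset.range n, 2 ^ e * f e := by
  induction n with
  | zero => simp
  | succ n ih =>
    rw [Finset.sum_range_succ, ← ih, ← Finset.sum_Ico_consecutive _ Nat.one_le_two_pow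
      (Nat.pow_le_pow_right two_pos n.le_succ)]
    congr 1
    rw [Finset.sum_congr rfl (g := fun _ => f n)]
    · rw [Finset.sum_const, Nat.card_Ico, nsmul_eq_mul, pow_succ, mul_two, Nat.add_sub_cancel]
      norm_num
    · intro d hd
      rw [Finset.mem_Ico] at hd
      rw [(Nat.log_eq_iff (by have := Nat.one_le_two_pow (n := n); right; omega)).2 hd]

theorem sum_sum_dist_le {K : ℕ} (p : ℕ → ℕ → ℝ) (F : ℕ → ℝ) (hF : ∀ d, 0 ≤ F d)
    (h : ∀ i < K, ∀ j < K, i ≤ j → p i j ≤ F (j - i))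
    (hs : ∀ i j, p i j = p j i) :
    ∑ i ∈ Finset.range K, ∑ j ∈ Finset.range K, p i j ≤ K * (2 * ∑ d ∈ Finset.range K, F d) := by
  have h1 : ∀ i ∈ Finset.range K, ∑ j ∈ Finset.range K, p i j ≤ 2 * ∑ d ∈ Finset.range K, F d := by
    intro i hi
    rw [Finset.mem_range] at hi
    rw [← Finset.sum_range_add_sum_Ico _ hi.le, two_mul]
    refine add_le_add ?_ ?_
    · calc ∑ j ∈ Finset.range i, p i j ≤ ∑ j ∈ Finset.range i, F (i - 1 - j + 1) := by
            refine Finset.sum_le_sum fun j hj => ?_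
            rw [Finset.mem_range] at hj
            rw [hs, show i - 1 - j + 1 = i - j by omega]
            exact h j (by omega) i hi hj.le
        _ = ∑ j ∈ Finset.range i, F (j + 1) := Finset.sum_range_reflect (fun j => F (j + 1)) i
        _ ≤ ∑ j ∈ Finset.range (i + 1), F j := by
            rw [Finset.sum_range_succ' F]; linarith [hF 0]
        _ ≤ _ := Finset.sum_le_sum_of_subset_of_nonneg
            (Finset.range_subset_range.2 (by omega)) fun d _ _ => hF d
    · rw [Finset.sum_Ico_eq_sum_range]
      calc ∑ k ∈ Finset.range (K - i), p i (i + k) ≤ ∑ k ∈ Finset.range (K - i), F k := by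
            refine Finset.sum_le_sum fun k hk => ?_
            rw [Finset.mem_range] at hk
            have := h i hi (i + k) (by omega) (by omega)
            rwa [Nat.add_sub_cancel_left] at this
        _ ≤ _ := Finset.sum_le_sum_of_subset_of_nonneg
            (Finset.range_subset_range.2 (by omega)) fun d _ _ => hF d
  refine (Finset.sum_le_sum h1).trans ?_
  rw [Finset.sum_const, Finset.card_range, nsmul_eq_mul]

theorem union_row_ge {μ : Measure Config} (hμ : IsBernoulliHalf μ) {s : ℤ} (hs : 1 ≤ s) {l : ℕ}
    (hl : 8 ≤ l) {A : ℕ → ℝ} (hA0 : 1 ≤ A 0) (hA : ∀ j < l, ArmBound μ j (A j)) (z0 z : Site) :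
    (2 ^ (l - 8) * (rswC ^ 3 * μ.real (Arm (half z0) z0 (s + 1) (2 ^ l * s)))) ^ 2 ≤
      μ.real (⋃ k ∈ Finset.range (2 ^ (l - 8)),
        FullArm (half (z + (16 * s * (k : ℤ), 0))) (z + (16 * s * (k : ℤ), 0)) s (2 ^ l * s)) *
      (2 ^ (l - 8) * (2 * (A (l - 3) +
        ∑ e ∈ Finset.range (l - 8), 2 ^ e * (A (e - 1) ^ 2 * A (l - e - 6))))) := by
  have := hμ.1
  have hc : (0 : ℝ) < rswC ^ 3 := pow_pos rswC_pos 3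
  have hl8 : (2 : ℤ) ^ 8 * s ≤ 2 ^ l * s :=
    mul_le_mul_of_nonneg_right (pow_le_pow_right₀ one_le_two hl) (by omega)
  have hAn : ∀ j < l, 0 ≤ A j := fun j hj =>
    measureReal_nonneg.trans (hA j hj 1 le_rfl (0, 0))
  let x : ℕ → Site := fun k => z + (16 * s * (k : ℤ), 0)
  let E : ℕ → Set Config := fun k => FullArm (half (x k)) (x k) s (2 ^ l * s)
  let f : ℕ → ℝ := fun e => A (e - 1) ^ 2 * A (l - e - 6)
  let F : ℕ → ℝ := fun d => if d = 0 then A (l - 3) else if d < 2 ^ (l - 8) then f (Nat.log 2 d)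
    else 0
  have hlog : ∀ d, d ≠ 0 → d < 2 ^ (l - 8) → Nat.log 2 d < l - 8 := fun d hd h =>
    Nat.log_lt_of_lt_pow hd h
  have hfn : ∀ e < l - 8, 0 ≤ f e := fun e he => mul_nonneg (sq_nonneg _) (hAn _ (by omega))
  have hF : ∀ d, 0 ≤ F d := by
    intro d
    simp only [F]
    split_ifs with h1 h2
    · exact hAn _ (by omega)
    · exact hfn _ (hlog d h1 h2)
    · exact le_rfl
  have hFsum : ∑ d ∈ Finset.range (2 ^ (l - 8)), F d =
      A (l - 3) + ∑ e ∈ Finset.range (l - 8), 2 ^ e * f e := by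
    rw [← sum_log_eq f, ← Finset.sum_range_add_sum_Ico _ (Nat.one_le_two_pow (n := l - 8))]
    congr 1
    · simp [F]
    · refine Finset.sum_congr rfl fun d hd => ?_
      rw [Finset.mem_Ico] at hd
      simp only [F]
      rw [if_neg (by omega), if_pos hd.2]
  have hpair : ∀ i < 2 ^ (l - 8), ∀ j < 2 ^ (l - 8), i ≤ j → μ.real (E i ∩ E j) ≤ F (j - i) := by
    intro i hi j hj hij
    simp only [F]
    split_ifs with h1 h2
    · refine (measureReal_mono (Set.inter_subset_left.trans (fullArm_subset_arm _ _ le_rfl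
        (q' := 2 ^ l * s) (by omega) le_rfl))).trans ?_
      have := hA (l - 3) (by omega) (8 * s) (by omega) (x i)
      rwa [show (2 : ℤ) ^ (l - 3) * (8 * s) = 2 ^ l * s by
        rw [show (8 : ℤ) = 2 ^ 3 by norm_num, ← mul_assoc, ← pow_add]; congr 2; omega] at this
    · have hlt := hlog _ h1 h2
      have e1 : x j = x i + (16 * s * ((j - i : ℕ) : ℤ), 0) := by
        simp only [x]
        ext
        · simp only [Prod.fst_add]; push_cast [hij]; ring
        · simp
      simp only [E]
      rw [e1]
      have b1 : ((2 : ℤ) ^ (Nat.log 2 (j - i))) ≤ ((j - i : ℕ) : ℤ) := by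
        exact_mod_cast Nat.pow_log_le_self 2 h1
      have b2 : ((j - i : ℕ) : ℤ) < (2 : ℤ) ^ (Nat.log 2 (j - i) + 1) := by
        exact_mod_cast Nat.lt_pow_succ_log_self one_lt_two (j - i)
      refine pair_le hμ hs (by omega) hA0 hA ?_ ?_
      · have := mul_le_mul_of_nonneg_right b1 (show 0 ≤ 16 * s by omega)
        rw [pow_add]; linarith
      · have := mul_lt_mul_of_pos_right b2 (show 0 < 16 * s by omega)
        rw [pow_add] at this ⊢; linarith
    · omega
  have hlow : 2 ^ (l - 8) * (rswC ^ 3 * μ.real (Arm (half z0) z0 (s + 1) (2 ^ l * s))) ≤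
      ∑ k ∈ Finset.range (2 ^ (l - 8)), μ.real (E k) := by
    have : ∀ k ∈ Finset.range (2 ^ (l - 8)),
        rswC ^ 3 * μ.real (Arm (half z0) z0 (s + 1) (2 ^ l * s)) ≤ μ.real (E k) := by
      intro k _
      refine le_trans ?_ (arm_le_fullArm hμ subset_rfl hs (by omega))
      exact mul_le_mul_of_nonneg_left
        (prob_arm_le_shift hμ transInv_half (fun _ => subset_rfl) _ _ _ _) hc.le
    refine le_trans (le_of_eq ?_) (Finset.sum_le_sum this)
    rw [Finset.sum_const, Finset.card_range, nsmul_eq_mul]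
    push_cast; rfl
  calc _ ≤ (∑ k ∈ Finset.range (2 ^ (l - 8)), μ.real (E k)) ^ 2 :=
        pow_le_pow_left₀ (by positivity) hlow 2
    _ ≤ _ := sq_sum_prob_le _ E fun k => (loc_fullArm_half _ _ _).measurableSet
    _ ≤ _ := by
      refine mul_le_mul_of_nonneg_left ?_ measureReal_nonneg
      rw [← hFsum]
      have := sum_sum_dist_le (fun i j => μ.real (E i ∩ E j)) F hF hpair
        (fun i j => by simp only [Set.inter_comm])
      push_cast at this
      exact this

theorem arm_recursion {μ : Measure Config} (hμ : IsBernoulliHalf μ) {l : ℕ}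
    (hl : 8 ≤ l) {A : ℕ → ℝ} (hA0 : 1 ≤ A 0) (hA : ∀ j < l, ArmBound μ j (A j))
    {s : ℤ} (hs : 1 ≤ s) (z : Site) :
    μ.real (Arm (half z) z (s + 1) (2 ^ l * s)) ^ 2 ≤ 2 * 4 ^ 8 / (rswC ^ 3) ^ 3 *
      (1 / 4) ^ l * (A (l - 3) +
        ∑ e ∈ Finset.range (l - 8), 2 ^ e * (A (e - 1) ^ 2 * A (l - e - 6))) := by
  have := hμ.1
  have hc : (0 : ℝ) < rswC ^ 3 := pow_pos rswC_pos 3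
  obtain ⟨m, rfl⟩ := Nat.exists_eq_add_of_le hl
  rw [Nat.add_sub_cancel_left 8 m]
  set a := μ.real (Arm (half z) z (s + 1) (2 ^ (8 + m) * s)) with ha
  set T := A (8 + m - 3) +
        ∑ e ∈ Finset.range m, 2 ^ e * (A (e - 1) ^ 2 * A (8 + m - e - 6)) with hT
  have key := sum_fullArm_le hμ hs (z0 := z) (B := 16 * 2 ^ m * s)
    (by have := one_le_pow₀ (n := m) (one_le_two (α := ℤ)); nlinarith) (subset_refl (half z))
    (Finset.range (2 ^ m)) (fun h => {x | ∃ k < 2 ^ m, x = z + (16 * s * (k : ℕ), 16 * s * h)}) (by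
      rintro h hh z' ⟨k, hk, rfl⟩
      rw [Finset.mem_range] at hh
      have h1 : ((h : ℤ) + 1) * s ≤ 2 ^ m * s := mul_le_mul_of_nonneg_right (by exact_mod_cast hh)
        (by omega)
      have h2 : ((k : ℤ) + 1) * s ≤ 2 ^ m * s := mul_le_mul_of_nonneg_right (by exact_mod_cast hk)
        (by omega)
      have h0 : 0 ≤ (h : ℤ) * s := by positivity
      have h0' : 0 ≤ (k : ℤ) * s := by positivity
      simp only [Prod.fst_add, Prod.snd_add]
      refine ⟨trivial, ?_, ?_, ?_⟩ <;> nlinarith)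
  have h1 : ∀ h ∈ Finset.range (2 ^ m), (2 ^ m * (rswC ^ 3 * a)) ^ 2 ≤
      μ.real {ω | ∃ z' ∈ ({x | ∃ k < 2 ^ m, x = z + (16 * s * (k : ℕ), 16 * s * h)} : Set Site),
        ω ∈ FullArm (half z ∩ half z') z' s (16 * (16 * 2 ^ m * s))} * (2 ^ m * (2 * T)) := by
    intro h _
    have hr := union_row_ge hμ hs hl hA0 hA z (z + (0, 16 * s * h))
    rw [Nat.add_sub_cancel_left 8 m] at hr
    refine hr.trans (mul_le_mul_of_nonneg_right (measureReal_mono ?_ (measure_ne_top _ _)) ?_)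
    · intro ω hω
      simp only [Set.mem_iUnion, Finset.mem_range, exists_prop] at hω
      obtain ⟨k, hk, hω⟩ := hω
      have e : z + (0, 16 * s * (h : ℤ)) + (16 * s * (k : ℤ), 0) =
          z + (16 * s * (k : ℤ), 16 * s * (h : ℤ)) := by ext <;> simp
      rw [e] at hω
      refine ⟨_, ⟨k, hk, rfl⟩, ?_⟩
      have e2 : half z ∩ half (z + (16 * s * (k : ℤ), 16 * s * (h : ℤ))) =
          half (z + (16 * s * (k : ℤ), 16 * s * (h : ℤ))) := by
        have : 0 ≤ 16 * s * (h : ℤ) := by positivity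
        ext v
        simp only [half, Set.mem_inter_iff, Set.mem_ofPred_eq, Prod.snd_add]; omega
      rw [e2, show 16 * (16 * 2 ^ m * s) = 2 ^ (8 + m) * s by ring]
      exact hω
    · have hAn : ∀ j < 8 + m, 0 ≤ A j := fun j hj =>
        measureReal_nonneg.trans (hA j hj 1 le_rfl (0, 0))
      have : 0 ≤ T := add_nonneg (hAn _ (by omega)) (Finset.sum_nonneg fun e he => by
        rw [Finset.mem_range] at he
        exact mul_nonneg (by positivity) (mul_nonneg (sq_nonneg _) (hAn _ (by omega))))
      positivity
  have hTn : 0 ≤ T := by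
    have hAn : ∀ j < 8 + m, 0 ≤ A j := fun j hj =>
      measureReal_nonneg.trans (hA j hj 1 le_rfl (0, 0))
    exact add_nonneg (hAn _ (by omega)) (Finset.sum_nonneg fun e he => by
        rw [Finset.mem_range] at he
        exact mul_nonneg (by positivity) (mul_nonneg (sq_nonneg _) (hAn _ (by omega))))
  have h2 := Finset.sum_le_sum h1
  rw [← Finset.sum_mul, Finset.sum_const, Finset.card_range, nsmul_eq_mul] at h2
  have h3 := h2.trans (mul_le_mul_of_nonneg_right key (by positivity))
  push_cast at h3
  have hm : (0 : ℝ) < 2 ^ m := by positivity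
  have e4 : (4 : ℝ) ^ m = 2 ^ m * 2 ^ m := by rw [← mul_pow]; norm_num
  have h4 : a ^ 2 * ((rswC ^ 3) ^ 3 * (2 ^ m * 2 ^ m)) ≤ 2 * T := by
    have h5 : 2 ^ m * (2 ^ m * (rswC ^ 3 * a)) ^ 2 * rswC ^ 3 ≤ 2 ^ m * (2 * T) := by
      have := mul_le_mul_of_nonneg_right h3 hc.le
      refine this.trans (le_of_eq ?_)
      rw [one_div, mul_comm, ← mul_assoc, mul_inv_cancel₀ hc.ne', one_mul]
    have h6 : 2 ^ m * (a ^ 2 * ((rswC ^ 3) ^ 3 * (2 ^ m * 2 ^ m))) ≤ 2 ^ m * (2 * T) := by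
      refine le_trans (le_of_eq ?_) h5; ring
    exact le_of_mul_le_mul_left h6 hm
  have h7 : a ^ 2 ≤ 2 * T / ((rswC ^ 3) ^ 3 * (2 ^ m * 2 ^ m)) := by
    rw [le_div_iff₀ (by positivity)]; exact h4
  refine h7.trans (le_of_eq ?_)
  rw [pow_add, one_div_pow, one_div_pow, e4]
  field_simp

theorem armBound_of_lt {μ : Measure Config} (hμ : IsBernoulliHalf μ) {C r : ℝ} {l : ℕ} (hl : l < 8)
    (hC : 4 ^ 8 ≤ C) (hr : 1 / 4 ≤ r) : ArmBound μ l (C * r ^ l) := by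
  have := hμ.1
  intro s _ z
  refine measureReal_le_one.trans ?_
  calc (1 : ℝ) ≤ 4 ^ 8 * (1 / 4) ^ l := by
        have : ((1 : ℝ) / 4) ^ 8 ≤ (1 / 4) ^ l :=
          pow_le_pow_of_le_one (by norm_num) (by norm_num) hl.le
        norm_num at this ⊢; linarith
    _ ≤ C * r ^ l := by gcongr

theorem armBound_improve {r r' M C : ℝ} (hr : 0 < r) (hr1 : r ≤ 1) (hr' : 1 / 4 ≤ r')
    (hC : 1 ≤ C) (hM : ∀ l : ℕ, r ^ l * ∑ e ∈ Finset.range l, (2 * r) ^ e ≤ M * (4 * r' ^ 2) ^ l)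
    (hM' : ∀ l : ℕ, r ^ l ≤ M * (4 * r' ^ 2) ^ l)
    (h : ∀ μ, IsBernoulliHalf μ → ∀ j, ArmBound μ j (C * r ^ j)) :
    ∃ C', 1 ≤ C' ∧ ∀ μ, IsBernoulliHalf μ → ∀ j, ArmBound μ j (C' * r' ^ j) := by
  have hc : (0 : ℝ) < rswC ^ 3 := pow_pos rswC_pos 3
  have hM0 : 0 < M := by have := hM' 0; simp at this; linarith
  set Q : ℝ := 2 * 4 ^ 8 / (rswC ^ 3) ^ 3 with hQ
  have hQ0 : 0 < Q := by positivity
  set C1 : ℝ := 2 * Q * C ^ 3 * (1 / r) ^ 8 * M with hC1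
  have hC10 : 0 < C1 := by positivity
  refine ⟨4 ^ 8 + C1, by linarith [show (1 : ℝ) ≤ 4 ^ 8 by norm_num], fun μ hμ l => ?_⟩
  by_cases hl : l < 8
  · exact armBound_of_lt hμ hl (by linarith) hr'
  rw [not_lt] at hl
  intro s hs z
  have key := arm_recursion hμ hl (A := fun j => C * r ^ j) (by simpa using hC)
    (fun j _ => h μ hμ j) hs z
  have hi : 1 ≤ 1 / r := by rw [le_div_iff₀ hr]; linarith
  have hC3 : C ≤ C ^ 3 := le_self_pow₀ hC (by norm_num)
  have t1 : C * r ^ (l - 3) ≤ C ^ 3 * (1 / r) ^ 8 * r ^ l := by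
    have : r ^ (l - 3) = (1 / r) ^ 3 * r ^ l := by
      conv_rhs => rw [show l = 3 + (l - 3) by omega, pow_add, ← mul_assoc, ← mul_pow]
      rw [one_div_mul_cancel hr.ne', one_pow, one_mul]
    rw [this, ← mul_assoc]
    gcongr ?_ * ?_ * _
    · exact pow_le_pow_right₀ hi (by norm_num)
  have t2 : ∀ e ∈ Finset.range (l - 8), 2 ^ e * ((C * r ^ (e - 1)) ^ 2 * (C * r ^ (l - e - 6))) ≤
      C ^ 3 * (1 / r) ^ 8 * (r ^ l * (2 * r) ^ e) := by
    intro e he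
    rw [Finset.mem_range] at he
    have q1 : r ^ (e - 1) ≤ (1 / r) * r ^ e := by
      rcases Nat.eq_zero_or_pos e with h0 | h0
      · rw [h0]; simpa using hi
      · obtain ⟨e, rfl⟩ := Nat.exists_eq_succ_of_ne_zero h0.ne'
        rw [Nat.succ_eq_add_one, Nat.add_sub_cancel, pow_succ', ← mul_assoc,
          one_div_mul_cancel hr.ne', one_mul]
    have q2 : r ^ (l - e - 6) * r ^ e = (1 / r) ^ 6 * r ^ l := by
      conv_rhs => rw [show l = 6 + ((l - e - 6) + e) by omega, pow_add, ← mul_assoc, ← mul_pow]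
      rw [one_div_mul_cancel hr.ne', one_pow, one_mul, pow_add]
    calc 2 ^ e * ((C * r ^ (e - 1)) ^ 2 * (C * r ^ (l - e - 6)))
        ≤ 2 ^ e * ((C * ((1 / r) * r ^ e)) ^ 2 * (C * r ^ (l - e - 6))) := by gcongr
      _ = C ^ 3 * (1 / r) ^ 2 * (r ^ (l - e - 6) * r ^ e) * (2 * r) ^ e := by ring
      _ = _ := by rw [q2]; ring
  have t3 : C * r ^ (l - 3) +
      ∑ e ∈ Finset.range (l - 8), 2 ^ e * ((C * r ^ (e - 1)) ^ 2 * (C * r ^ (l - e - 6))) ≤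
      C ^ 3 * (1 / r) ^ 8 * (2 * (M * (4 * r' ^ 2) ^ l)) := by
    have := (Finset.sum_le_sum t2).trans (Finset.sum_le_sum_of_subset_of_nonneg
      (Finset.range_subset_range.2 (Nat.sub_le l 8)) fun e _ _ => by positivity)
    rw [← Finset.mul_sum, ← Finset.mul_sum] at this
    have h2 := add_le_add t1 this
    rw [← mul_add] at h2
    refine h2.trans (mul_le_mul_of_nonneg_left ?_ (by positivity))
    linarith [hM l, hM' l]
  have hr0 : 0 < r' := by linarith
  have h5 : μ.real (Arm (half z) z (s + 1) (2 ^ l * s)) ^ 2 ≤ ((4 ^ 8 + C1) * r' ^ l) ^ 2 := by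
    calc _ ≤ Q * (1 / 4) ^ l * (C ^ 3 * (1 / r) ^ 8 * (2 * (M * (4 * r' ^ 2) ^ l))) :=
          key.trans (mul_le_mul_of_nonneg_left t3 (by positivity))
      _ = C1 * (r' ^ l) ^ 2 := by
          rw [mul_pow 4, ← pow_mul, ← pow_mul, mul_comm l 2, one_div_pow, hC1]
          field_simp
      _ ≤ (4 ^ 8 + C1) ^ 2 * (r' ^ l) ^ 2 := by
          gcongr
          nlinarith
      _ = _ := by ring
  exact (pow_le_pow_iff_left₀ measureReal_nonneg (by positivity) two_ne_zero).1 h5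

theorem sum_geom_le {x y : ℝ} (hx : 0 ≤ x) (hxy : x < 1) (hy : 1 / (1 - x) ≤ y) (l : ℕ) :
    ∑ e ∈ Finset.range l, x ^ e ≤ y := by
  refine (Summable.sum_le_tsum _ (fun e _ => pow_nonneg hx e)
    (summable_geometric_of_lt_one hx hxy)).trans ?_
  rw [tsum_geometric_of_lt_one hx hxy]
  rwa [one_div] at hy

theorem half_arm_intermediate : ∃ C : ℝ, 1 ≤ C ∧ ∀ μ, IsBernoulliHalf μ →
    ∀ j, ArmBound μ j (C * (8 / 25) ^ j) := by
  have hc : (0 : ℝ) < rswC ^ 3 := pow_pos rswC_pos 3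
  have h0 : ∀ μ, IsBernoulliHalf μ → ∀ j,
      ArmBound μ j ((1 + 256 / (rswC ^ 3) ^ 2) * (1 / 2) ^ j) := by
    intro μ hμ j s hs z
    refine (half_linear hμ hs j z).trans ?_
    gcongr; linarith
  obtain ⟨C1, hC1, h1⟩ := armBound_improve (r := 1 / 2) (r' := 2 / 5) (M := 4) (by norm_num)
    (by norm_num) (by norm_num) (le_add_of_nonneg_right (by positivity))
    (by
      intro l
      have h := one_add_mul_le_pow (show (-2 : ℝ) ≤ 7 / 25 by norm_num) l
      have h2 : (l : ℝ) ≤ 4 * (1 + 7 / 25) ^ l := by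
        have : (0 : ℝ) ≤ l := Nat.cast_nonneg l
        linarith
      rw [show (2 * (1 / 2) : ℝ) = 1 by norm_num]
      simp only [one_pow, Finset.sum_const, Finset.card_range, nsmul_eq_mul, mul_one]
      rw [show (4 * (2 / 5) ^ 2 : ℝ) = 1 / 2 * (1 + 7 / 25) by norm_num, mul_pow]
      have : (0 : ℝ) < (1 / 2) ^ l := by positivity
      nlinarith)
    (by
      intro l
      have : ((1 : ℝ) / 2) ^ l ≤ (4 * (2 / 5) ^ 2) ^ l :=
        pow_le_pow_left₀ (by norm_num) (by norm_num) l
      have : (0 : ℝ) < (4 * (2 / 5) ^ 2) ^ l := by positivity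
      linarith) h0
  refine armBound_improve (r := 2 / 5) (r' := 8 / 25) (M := 5) (by norm_num) (by norm_num)
    (by norm_num) hC1 ?_ ?_ h1
  · intro l
    have h2 := sum_geom_le (x := 2 * (2 / 5)) (y := 5) (by norm_num) (by norm_num) (by norm_num) l
    have h3 : ((2 : ℝ) / 5) ^ l ≤ (4 * (8 / 25) ^ 2) ^ l :=
      pow_le_pow_left₀ (by norm_num) (by norm_num) l
    calc _ ≤ ((2 : ℝ) / 5) ^ l * 5 := by gcongr
      _ ≤ (4 * (8 / 25) ^ 2) ^ l * 5 := by gcongr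
      _ = _ := mul_comm _ _
  · intro l
    have h3 : ((2 : ℝ) / 5) ^ l ≤ (4 * (8 / 25) ^ 2) ^ l :=
      pow_le_pow_left₀ (by norm_num) (by norm_num) l
    have : (0 : ℝ) < (4 * (8 / 25) ^ 2) ^ l := by positivity
    linarith

/-- The three-arm bound in the half plane. -/
theorem half_quadratic : ∃ C : ℝ, 1 ≤ C ∧ ∀ μ, IsBernoulliHalf μ →
    ∀ j, ArmBound μ j (C * (1 / 4) ^ j) := by
  have hc : (0 : ℝ) < rswC ^ 3 := pow_pos rswC_pos 3
  obtain ⟨C, hC, h⟩ := half_arm_intermediate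
  set Q : ℝ := 2 * 4 ^ 8 / (rswC ^ 3) ^ 3 with hQ
  have hQ0 : 0 < Q := by positivity
  set M : ℝ := 64 + C ^ 2 * (25 / 8) ^ 2 * 4 ^ 6 * 6 with hM
  have hM0 : 0 < M := by positivity
  set K : ℝ := 4 ^ 8 + Q * M with hK
  have hK1 : 1 ≤ K := by
    have : 0 < Q * M := by positivity
    linarith [show (1 : ℝ) ≤ 4 ^ 8 by norm_num]
  have hK0 : 0 < K := by linarith
  refine ⟨K, hK1, fun μ hμ l => ?_⟩
  induction l using Nat.strong_induction_on with
  | _ l ih =>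
    by_cases hl : l < 8
    · refine armBound_of_lt hμ hl ?_ le_rfl
      have : 0 < Q * M := by positivity
      linarith
    rw [not_lt] at hl
    intro s hs z
    set A : ℕ → ℝ := fun j => min (C * (8 / 25) ^ j) (K * (1 / 4) ^ j) with hA
    have hAn : ∀ j, 0 ≤ A j := fun j => le_min (by positivity) (by positivity)
    have key := arm_recursion hμ hl (A := A) (le_min (by simpa using hC) (by simpa using hK1))
      (fun j hj s hs z => le_min (h μ hμ j s hs z) (ih j hj s hs z)) hs z
    have t1 : A (l - 3) ≤ K * (1 / 4) ^ l * 64 := by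
      refine (min_le_right _ _).trans (le_of_eq ?_)
      conv_rhs => rw [show l = 3 + (l - 3) by omega, pow_add]
      ring
    have t2 : ∀ e ∈ Finset.range (l - 8), 2 ^ e * (A (e - 1) ^ 2 * A (l - e - 6)) ≤
        K * (1 / 4) ^ l * (C ^ 2 * (25 / 8) ^ 2 * 4 ^ 6) * (8 * (8 / 25) ^ 2) ^ e := by
      intro e he
      rw [Finset.mem_range] at he
      have q1 : A (e - 1) ≤ C * ((25 / 8) * (8 / 25) ^ e) := by
        refine (min_le_left _ _).trans (mul_le_mul_of_nonneg_left ?_ (by linarith))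
        rcases Nat.eq_zero_or_pos e with h0 | h0
        · rw [h0]; norm_num
        · obtain ⟨e, rfl⟩ := Nat.exists_eq_succ_of_ne_zero h0.ne'
          rw [Nat.succ_eq_add_one, Nat.add_sub_cancel, pow_succ', ← mul_assoc]
          norm_num
      have q2 : A (l - e - 6) ≤ K * (4 ^ 6 * 4 ^ e * (1 / 4) ^ l) := by
        refine (min_le_right _ _).trans (mul_le_mul_of_nonneg_left (le_of_eq ?_) hK0.le)
        conv_rhs => rw [show l = (6 + e) + (l - e - 6) by omega, pow_add, ← pow_add, ← mul_assoc,
          ← mul_pow]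
        norm_num
      calc 2 ^ e * (A (e - 1) ^ 2 * A (l - e - 6))
          ≤ 2 ^ e * ((C * ((25 / 8) * (8 / 25) ^ e)) ^ 2 * (K * (4 ^ 6 * 4 ^ e * (1 / 4) ^ l))) := by
            have := hAn (e - 1)
            have := hAn (l - e - 6)
            gcongr
        _ = K * (1 / 4) ^ l * (C ^ 2 * (25 / 8) ^ 2 * 4 ^ 6) *
            (2 ^ e * 4 ^ e * ((8 / 25) ^ e) ^ 2) := by ring
        _ = _ := by
            have e1 : (2 : ℝ) ^ e * 4 ^ e * ((8 / 25) ^ e) ^ 2 = (8 * (8 / 25) ^ 2) ^ e := by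
              rw [← pow_mul, mul_comm e 2, pow_mul, ← mul_pow, ← mul_pow]
              norm_num
            rw [e1]
    have t3 : A (l - 3) + ∑ e ∈ Finset.range (l - 8), 2 ^ e * (A (e - 1) ^ 2 * A (l - e - 6)) ≤
        K * (1 / 4) ^ l * M := by
      have h1 := Finset.sum_le_sum t2
      rw [← Finset.mul_sum] at h1
      have h2 := sum_geom_le (x := 8 * (8 / 25) ^ 2) (y := 6) (by norm_num) (by norm_num)
        (by norm_num) (l - 8)
      have h3 : K * (1 / 4) ^ l * (C ^ 2 * (25 / 8) ^ 2 * 4 ^ 6) *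
          ∑ e ∈ Finset.range (l - 8), (8 * (8 / 25) ^ 2 : ℝ) ^ e ≤
          K * (1 / 4) ^ l * (C ^ 2 * (25 / 8) ^ 2 * 4 ^ 6) * 6 :=
        mul_le_mul_of_nonneg_left h2 (by positivity)
      have := h1.trans h3
      rw [hM]
      linarith
    refine (pow_le_pow_iff_left₀ measureReal_nonneg (by positivity) two_ne_zero).1 ?_
    calc _ ≤ Q * (1 / 4) ^ l * (K * (1 / 4) ^ l * M) :=
          key.trans (mul_le_mul_of_nonneg_left t3 (by positivity))
      _ = (Q * M) * (K * ((1 / 4) ^ l) ^ 2) := by ring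
      _ ≤ K * (K * ((1 / 4) ^ l) ^ 2) := by
          gcongr
          linarith [show (0 : ℝ) ≤ 4 ^ 8 by norm_num]
      _ = _ := by ring

/-! ### Barriers in a corner -/

/-- The part of the corner with apex at the origin inside an annulus. -/
def cornerAnn (p q : ℤ) : Set Site := corner (0, 0) ∩ ann (0, 0) p q

theorem mem_cornerAnn {p q : ℤ} {v : Site} : v ∈ cornerAnn p q ↔
    (0 ≤ v.2 ∧ v.1 ≤ 0) ∧ p ≤ nrm (0, 0) v ∧ nrm (0, 0) v ≤ q := Iff.rfl

theorem cornerAnn_finite (p q : ℤ) : (cornerAnn p q).Finite :=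
  (half_ann_finite (0, 0) p q).subset (Set.inter_subset_inter_left _ fun _ hv => hv.1)

/-- A connection in a corner from its bottom row to its vertical side meets every radial
crossing that does not bypass it on the right. -/
theorem barrier {PA PB : Set Site} {s q : ℤ} {b e c d : Site} (hs : 0 ≤ s)
    (hA : Conn PA b e) (hb : b.2 = 0) (he : e.1 = 0) (hPA : PA ⊆ cornerAnn (s + 1) q)
    (hB : Conn PB c d) (hc : nrm (0, 0) c = s + 1) (hd : nrm (0, 0) d = q)
    (hPB : ∀ v ∈ PB, 0 ≤ v.2 ∧ s + 1 ≤ nrm (0, 0) v ∧ nrm (0, 0) v ≤ q ∧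
      (1 ≤ v.1 → v.1 ≤ v.2 ∧ v.2 ≠ e.2)) : ∃ v, v ∈ PA ∧ v ∈ PB := by
  have mb := mem_cornerAnn.1 (hPA hA.left_mem)
  have me := mem_cornerAnn.1 (hPA hA.right_mem)
  have mc := hPB c hB.left_mem
  have md := hPB d hB.right_mem
  simp only [nrm] at mb me mc md hc hd
  obtain ⟨b1, b2⟩ := b
  obtain ⟨e1, e2⟩ := e
  obtain ⟨c1, c2⟩ := c
  obtain ⟨d1, d2⟩ := d
  dsimp only at *
  subst hb he
  set A : Set Site := PA ∪ ({v | v.2 = -1 ∧ v.1 ≤ -(s + 1) ∧ -q - 1 ≤ v.1} ∪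
    {v | v.2 = e2 ∧ 1 ≤ v.1}) with hA'
  set B : Set Site := PB ∪ {v | -1 ≤ v.2 ∧ v.2 ≤ q + 1 ∧ -q - 1 ≤ v.1 ∧ v.1 ≤ q + 1 ∧
    ((v.1 ≤ 0 ∧ nrm (0, 0) v ≤ s) ∨ (v.1 ≤ 0 ∧ 0 ≤ v.2 ∧ nrm (0, 0) v = q + 1) ∨
      (1 ≤ v.1 ∧ v.2 ≠ e2))} with hB'
  have pA : Conn A (-q - 1, -1) (q + 1, e2) := by
    have c1 : Conn A (-q - 1, -1) (b1, -1) := conn_row (by omega) fun v q1 q2 =>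
      Or.inr (Or.inl ⟨rfl, by dsimp only; omega, by dsimp only; omega⟩)
    have c2 : Conn A (b1, 0) (0, e2) := hA.mono Set.subset_union_left
    have c3 : Conn A (1, e2) (q + 1, e2) := conn_row (by omega) fun v q1 q2 =>
      Or.inr (Or.inr ⟨rfl, by dsimp only; omega⟩)
    exact ((c1.tail (adj_mk (by omega)) c2.left_mem).trans c2).trans
      ((Conn.single c2.right_mem (adj_mk (by omega)) c3.left_mem).trans c3)
  have hBB : ∀ x y : ℤ, (-1 ≤ y ∧ y ≤ q + 1 ∧ -q - 1 ≤ x ∧ x ≤ q + 1 ∧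
      ((x ≤ 0 ∧ max (max x (-x)) y ≤ s) ∨ (x ≤ 0 ∧ 0 ≤ y ∧ max (max x (-x)) y = q + 1) ∨
      (1 ≤ x ∧ y ≠ e2))) → ((x, y) : Site) ∈ B := by
    intro x y h
    refine Or.inr ?_
    simp only [Set.mem_ofPred_eq, nrm]
    omega
  have cB : Conn B (c1, c2) (d1, d2) := hB.mono Set.subset_union_left
  have pB1 : ∃ x, Conn B (x, -1) (c1, c2) := by
    by_cases h1 : 1 ≤ c1
    · exact ⟨c1, conn_col (by omega) fun v q1 q2 => by
        rcases eq_or_lt_of_le q2 with h | h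
        · rw [h]; exact cB.left_mem
        · exact hBB _ _ (by omega)⟩
    · obtain ⟨x, y, hx, hy, hxy, had⟩ : ∃ x y, -s ≤ x ∧ -1 ≤ y ∧ (x ≤ 0 ∧ y ≤ s) ∧
          Adj (x, y) (c1, c2) := by
        by_cases h2 : c2 = s + 1
        · by_cases h3 : c1 = -(s + 1)
          · exact ⟨-s, s, by omega, by omega, by omega, adj_mk (by omega)⟩
          · exact ⟨c1, s, by omega, by omega, by omega, adj_mk (by omega)⟩
        · exact ⟨-s, c2, by omega, by omega, by omega, adj_mk (by omega)⟩
      have k1 : Conn B (x, -1) (x, y) := conn_col (by omega) fun v q1 q2 => hBB _ _ (by omega)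
      exact ⟨x, k1.tail had cB.left_mem⟩
  have pB2 : ∃ x, Conn B (d1, d2) (x, q + 1) := by
    by_cases h1 : d2 = q
    · refine ⟨d1, Conn.single cB.right_mem (adj_mk (by omega)) (hBB _ _ (by omega))⟩
    · have k1 : Conn B (-q - 1, d2) (-q - 1, q + 1) := conn_col (by omega) fun v q1 q2 =>
        hBB _ _ (by omega)
      exact ⟨_, (Conn.single cB.right_mem (adj_mk (by omega)) k1.left_mem).trans k1⟩
  obtain ⟨x, k1⟩ := pB1
  obtain ⟨x', k2⟩ := pB2
  obtain ⟨v, hv1, hv2⟩ := conn_cross pA ((k1.trans cB).trans k2)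
    (by
      rintro v (hv | hv)
      · have := hPB v hv
        simp only [nrm] at this
        constructor <;> dsimp only <;> omega
      · obtain ⟨_, _, q1, q2, _⟩ := hv
        exact ⟨q1, q2⟩)
    (by
      rintro v (hv | hv | hv)
      · have := mem_cornerAnn.1 (hPA hv)
        simp only [nrm] at this
        constructor <;> dsimp only <;> omega
      · have := hv.1
        constructor <;> dsimp only <;> omega
      · have := hv.1
        constructor <;> dsimp only <;> omega)
  refine ⟨v, ?_⟩
  have hA0 : v ∈ PA → 0 ≤ v.2 ∧ v.1 ≤ 0 ∧ s + 1 ≤ nrm (0, 0) v ∧ nrm (0, 0) v ≤ q := by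
    intro h
    have := mem_cornerAnn.1 (hPA h)
    omega
  rcases hv1 with h1 | h1 | h1
  · refine ⟨h1, ?_⟩
    rcases hv2 with h2 | h2
    · exact h2
    · have h3 := hA0 h1
      obtain ⟨_, _, _, _, h4⟩ := h2
      omega
  · exfalso
    obtain ⟨h4, h5, h6⟩ := h1
    rcases hv2 with h2 | h2
    · have := (hPB v h2).1
      omega
    · obtain ⟨_, _, _, _, h7⟩ := h2
      simp only [nrm] at h7
      omega
  · exfalso
    obtain ⟨h4, h5⟩ := h1
    rcases hv2 with h2 | h2
    · exact ((hPB v h2).2.2.2 h5).2 h4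
    · obtain ⟨_, _, _, _, h7⟩ := h2
      omega

/-- A set of sites attached to the bottom row of a corner. -/
structure Attached (p q : ℤ) (U : Set Site) : Prop where
  subset : U ⊆ cornerAnn p q
  conn : ∀ v ∈ U, ∃ b : Site, b.2 = 0 ∧ Conn U b v
  row : ∀ v ∈ cornerAnn p q, v.2 = 0 → v ∈ U

/-- The set `X` joins the inside of the annulus to its outside. -/
def Radial (p q : ℤ) (X : Set Site) : Prop :=
  ∃ u w, (nrm (0, 0) u = p ∧ nrm (0, 0) w = q) ∧ Conn X u w

theorem Radial.mono {p q : ℤ} {X Y : Set Site} (h : Radial p q X) (hXY : X ⊆ Y) :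
    Radial p q Y := by
  obtain ⟨u, w, h1, h2⟩ := h
  exact ⟨u, w, h1, h2.mono hXY⟩

theorem Attached.line {s q : ℤ} {U X : Set Site} (hs : 0 ≤ s) (hU : Attached (s + 1) q U)
    (h : Radial (s + 1) q X) (hX : X ⊆ cornerAnn (s + 1) q \ U) : ∀ v ∈ U, v.1 ≠ 0 := by
  intro v hv hv0
  obtain ⟨b, hb, hbv⟩ := hU.conn v hv
  obtain ⟨u, w, ⟨hu, hw⟩, hc⟩ := h
  obtain ⟨x, hx, hx'⟩ := barrier hs hbv hb hv0 hU.subset hc hu hw fun x hx => by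
    obtain ⟨⟨h1, h2⟩, h3, h4⟩ := mem_cornerAnn.1 (hX hx).1
    exact ⟨h1, h3, h4, fun h5 => by omega⟩
  exact (hX hx').2 hx

/-- The part of the wedge to the right of the corner up to height `r`. -/
def wedge (p r : ℤ) : Set Site := {v | 1 ≤ v.1 ∧ v.1 ≤ v.2 ∧ p ≤ v.2 ∧ v.2 ≤ r}

/-- The region of an arc at distance about `a` around the corner. -/
def arcZone (a w : ℤ) : Set Site :=
  {v | -(a + 2 * w) ≤ v.1 ∧ v.1 ≤ 2 * w + 1 ∧ 0 ≤ v.2 ∧ v.2 ≤ a + 2 * w ∧ (v.1 ≤ -a ∨ a ≤ v.2)}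

/-- An arc of sites of `X` around the corner. -/
def Arc (a w : ℤ) (X : Set Site) : Prop :=
  ∃ b e : Site, (b.2 = 0 ∧ e.1 = 2 * w + 1) ∧ Conn (X ∩ arcZone a w) b e

theorem Arc.mono {a w : ℤ} {X Y : Set Site} (h : Arc a w X) (hXY : X ⊆ Y) : Arc a w Y := by
  obtain ⟨u, v, h1, h2⟩ := h
  exact ⟨u, v, h1, h2.mono (Set.inter_subset_inter_left _ hXY)⟩

theorem arcZone_left {p q a w : ℤ} (ha : p ≤ a) (ha0 : 1 ≤ a) (haq : a + 2 * w ≤ q)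
    {v : Site} (hv : v ∈ arcZone a w) (h : v.1 ≤ 0) :
    v ∈ cornerAnn p q ∧ a ≤ nrm (0, 0) v ∧ nrm (0, 0) v ≤ a + 2 * w := by
  obtain ⟨h1, h2, h3, h4, h5⟩ := hv
  rw [mem_cornerAnn]
  simp only [nrm]
  omega

/-- The final part of an arc after its last visit to an attached set. -/
theorem Attached.tail {p q a w : ℤ} {U X : Set Site} (hU : Attached p q U) (hl : ∀ v ∈ U, v.1 ≠ 0)
    (ha : p ≤ a) (ha0 : 1 ≤ a) (hw : 0 ≤ w) (haq : a + 2 * w ≤ q) (hX : Arc a w X) :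
    ∃ e e' : Site, e.1 = 0 ∧ a ≤ e.2 ∧ e.2 ≤ a + 2 * w ∧ e'.1 = 2 * w + 1 ∧
      Conn ((X \ U) ∩ arcZone a w) e e' ∧
      ∃ b : Site, b.2 = 0 ∧
        Conn (U ∪ {t | Conn ((X \ U) ∩ arcZone a w ∩ {v | v.1 ≤ 0}) t e}) b e := by
  obtain ⟨b, e', ⟨hb, he'⟩, hc⟩ := hX
  have hbU : b ∈ U := by
    have h1 := hc.left_mem.2
    refine hU.row b (arcZone_left ha ha0 haq h1 ?_).1 hb
    obtain ⟨_, _, _, _, h5⟩ := h1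
    omega
  have he'U : e' ∉ U := by
    intro h
    have := (mem_cornerAnn.1 (hU.subset h)).1
    omega
  obtain ⟨s, t, hs, _, hst, ht⟩ := hc.last_exit hbU he'U
  have ht1 : t.1 ≤ 0 := by
    have h1 := (mem_cornerAnn.1 (hU.subset hs)).1
    have h2 := hl s hs
    rw [adj_iff] at hst
    omega
  have e1 : (X ∩ arcZone a w) \ U = (X \ U) ∩ arcZone a w := by
    ext v; simp only [Set.mem_sdiff, Set.mem_inter_iff]; tauto
  rw [e1] at ht
  obtain ⟨e, he, h1, h2⟩ := ht.ring_upper lip_fst (q := 0) ht1 (by omega)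
  have hez := h1.left_mem.2
  obtain ⟨_, _, h3, h4, h5⟩ := hez
  refine ⟨e, e', he, by omega, h4, he', h1, ?_⟩
  obtain ⟨b', hb', hbs⟩ := hU.conn s hs
  refine ⟨b', hb', ?_⟩
  have h6 : Conn {t' | Conn ((X \ U) ∩ arcZone a w ∩ {v | v.1 ≤ 0}) t' e} t e := by
    have := h2.symm.restrict.symm
    refine this.mono ?_
    intro v hv
    exact Conn.symm hv
  exact ((hbs.mono Set.subset_union_left).tail hst (Or.inr h6.left_mem)).trans
    (h6.mono Set.subset_union_right)

/-! ### Detours through the wedge next to a corner -/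

/-- The free region next to a corner, with the wedge opened up to height `r`. -/
def free (U : Set Site) (p q r : ℤ) : Set Site := (cornerAnn p q \ U) ∪ wedge p r

/-- The part of an annulus that can be joined to the vertical side while avoiding `U`. -/
def pocket (U : Set Site) (p q : ℤ) : Set Site :=
  {v | ∃ l : Site, l.1 = 0 ∧ Conn (cornerAnn p q \ U) v l}

theorem pocket_subset {U : Set Site} {p q : ℤ} : pocket U p q ⊆ cornerAnn p q \ U := by
  rintro v ⟨l, _, h⟩
  exact h.left_mem

/-- An open arc blocks the crossings that do not use the wedge next to it. -/
theorem Attached.not_radial {s q r a w : ℤ} {U : Set Site} {ω : Config} (hs : 0 ≤ s)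
    (hU : Attached (s + 1) q U) (hl : ∀ v ∈ U, v.1 ≠ 0) (ha : s + 1 ≤ a) (hw : 0 ≤ w)
    (haq : a + 2 * w ≤ q) (hra : r < a) (hrq : r ≤ q)
    (hA : Arc a w (op ω ∪ (pocket U a (a + 2 * w))ᶜ)) :
    ¬ Radial (s + 1) q (cl ω ∩ free U (s + 1) q r) := by
  rintro ⟨u, v, ⟨hu, hv⟩, hc⟩
  obtain ⟨e, e', he, hae, hea, -, -, b, hb, hbe⟩ := hU.tail hl ha (by omega) hw haq hA
  set T : Set Site := {t | Conn (((op ω ∪ (pocket U a (a + 2 * w))ᶜ) \ U) ∩ arcZone a w ∩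
    {v | v.1 ≤ 0}) t e} with hT
  have hTz : ∀ t ∈ T, t ∈ cornerAnn (s + 1) q ∧ t ∈ op ω := by
    intro t ht
    have h1 := Conn.left_mem ht
    refine ⟨(arcZone_left ha (by omega) haq h1.1.2 h1.2).1, ?_⟩
    have h2 : t ∈ pocket U a (a + 2 * w) := by
      refine ⟨e, he, Conn.mono ?_ ht⟩
      rintro x ⟨⟨⟨_, h3⟩, h4⟩, h5⟩
      exact ⟨(arcZone_left (le_refl a) (by omega) (le_refl _) h4 h5).1, h3⟩
    rcases h1.1.1.1 with h3 | h3
    · exact h3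
    · exact absurd h2 h3
  obtain ⟨x, hx, hx'⟩ := barrier hs hbe hb he
    (Set.union_subset hU.subset fun t ht => (hTz t ht).1) hc hu hv (by
      rintro x ⟨_, ⟨hx, _⟩ | ⟨h1, h2, h3, h4⟩⟩
      · obtain ⟨⟨h1, h2⟩, h3, h4⟩ := mem_cornerAnn.1 hx
        exact ⟨h1, h3, h4, fun h5 => by omega⟩
      · simp only [nrm]; omega)
  rcases hx with hx | hx
  · rcases hx'.2 with h | h
    · exact h.2 hx
    · have := (mem_cornerAnn.1 (hU.subset hx)).1
      have := h.1
      omega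
  · exact not_mem_cl.2 (hTz x hx).2 hx'.1

theorem Conn.first_hit {Y T Z : Set Site} {u v : Site} (h : Conn Y u v) (hv : v ∈ T)
    (hT : ∀ t ∈ T, t ∉ Z) (hZ : ∀ x ∈ Z, ¬ Conn (Y \ T) u x) : ∃ t ∈ T, Conn (Y \ Z) u t := by
  by_cases hu : u ∈ T
  · exact ⟨u, hu, .refl ⟨h.left_mem, hT u hu⟩⟩
  · obtain ⟨a, t, ht, h1, hat, h2⟩ := h.first_exit (Q := Tᶜ) hu (fun h => h hv)
    have htT : t ∈ T := not_not.1 ht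
    refine ⟨t, htT, Conn.tail (h1.restrict' fun x hx => ⟨hx.right_mem.1, ?_⟩) hat
      ⟨h2.left_mem, hT t htT⟩⟩
    intro hxZ
    exact hZ x hxZ hx

/-- A crossing of the corner annulus can be rerouted through the wedge. -/
theorem Attached.detour {s q a1 a2 a3 w : ℤ} {U C : Set Site} (hs : 0 ≤ s)
    (hU : Attached (s + 1) q U) (ha1 : s + 1 ≤ a1) (hw : 0 ≤ w) (hwa : 2 * w + 1 ≤ a1)
    (h12 : a1 + 2 * w < a2) (h23 : a2 + 2 * w < a3) (haq : a3 + 2 * w ≤ q)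
    (hC : Radial (s + 1) q (C ∩ (cornerAnn (s + 1) q \ U))) (hA1 : Arc a1 w C) (hA3 : Arc a3 w C)
    (hR : BT 1 (2 * w + 1) a1 (a3 + 2 * w) C) :
    Radial (s + 1) q (C ∩ (free U (s + 1) q (a3 + 2 * w) \ pocket U a2 (a2 + 2 * w))) := by
  have hl := hU.line hs hC fun _ hv => hv.2
  obtain ⟨u, v, ⟨hu, hv⟩, hc⟩ := hC
  set Z := pocket U a2 (a2 + 2 * w) with hZ
  set P := C ∩ (free U (s + 1) q (a3 + 2 * w) \ Z) with hP
  have hYP : (C ∩ (cornerAnn (s + 1) q \ U)) \ Z ⊆ P := by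
    rintro x ⟨⟨h1, h2⟩, h3⟩
    exact ⟨h1, Or.inl h2, h3⟩
  have hYB : ∀ y : ℤ, ∀ x ∈ cornerAnn (s + 1) q, 0 ≤ x.2 ∧ s + 1 ≤ nrm (0, 0) x ∧
      nrm (0, 0) x ≤ q ∧ (1 ≤ x.1 → x.1 ≤ x.2 ∧ x.2 ≠ y) := by
    intro y x hx
    obtain ⟨⟨h1, h2⟩, h3, h4⟩ := mem_cornerAnn.1 hx
    exact ⟨h1, h3, h4, fun h5 => by omega⟩
  have hZz : ∀ x ∈ Z, x.1 ≤ 0 ∧ a2 ≤ nrm (0, 0) x ∧ nrm (0, 0) x ≤ a2 + 2 * w := by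
    intro x hx
    obtain ⟨⟨h1, h2⟩, h3, h4⟩ := mem_cornerAnn.1 (pocket_subset hx).1
    exact ⟨h2, h3, h4⟩
  -- the part of the argument common to both arcs
  have main : ∀ a, (a = a1 ∨ a = a3) → ∀ u0 v0 : Site, Conn (C ∩ (cornerAnn (s + 1) q \ U)) u0 v0 →
      (∀ T : Set Site, (∀ t ∈ T, t.1 ≤ 0 ∧ a ≤ nrm (0, 0) t ∧ nrm (0, 0) t ≤ a + 2 * w) →
        (∃ b e : Site, b.2 = 0 ∧ e.1 = 0 ∧ Conn (U ∪ T) b e) → U ∪ T ⊆ cornerAnn (s + 1) q →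
        (∃ t ∈ T, Conn (C ∩ (cornerAnn (s + 1) q \ U)) u0 t) ∧
        (∀ x ∈ Z, ¬ Conn ((C ∩ (cornerAnn (s + 1) q \ U)) \ T) u0 x)) →
      Arc a w C → ∃ x : Site, a1 ≤ x.2 ∧ Conn P u0 x ∧ ∃ x' : Site, x.1 = 1 ∧ x'.1 = 2 * w + 1 ∧
        Conn (P ∩ {v | 1 ≤ v.1 ∧ v.1 ≤ 2 * w + 1 ∧ a1 ≤ v.2 ∧ v.2 ≤ a3 + 2 * w}) x x' := by
    intro a ha u0 v0 hc0 hT hA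
    obtain ⟨e, e', he, hae, hea, he', hee, b, hb, hbe⟩ :=
      hU.tail hl (a := a) (by omega) (by omega) hw (by omega) hA
    set T : Set Site := {t | Conn ((C \ U) ∩ arcZone a w ∩ {v | v.1 ≤ 0}) t e} with hT'
    have hTz : ∀ t ∈ T, t ∈ cornerAnn (s + 1) q ∧ a ≤ nrm (0, 0) t ∧
        nrm (0, 0) t ≤ a + 2 * w := by
      intro t ht
      have h1 := Conn.left_mem ht
      exact arcZone_left (by omega) (by omega) (by omega) h1.1.2 h1.2
    obtain ⟨⟨t0, ht0, hc1⟩, hav⟩ := hT T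
      (fun t ht => ⟨(Conn.left_mem ht).2, (hTz t ht).2⟩) ⟨b, e, hb, he, hbe⟩
      (Set.union_subset hU.subset fun t ht => (hTz t ht).1)
    obtain ⟨t, ht, hct⟩ := hc1.first_hit ht0
      (fun t ht hZt => by have := hTz t ht; have := hZz t hZt; omega) hav
    have hzone : (C \ U) ∩ arcZone a w ⊆ P := by
      rintro x ⟨⟨h1, h2⟩, h3⟩
      by_cases hx0 : x.1 ≤ 0
      · obtain ⟨h4, h5⟩ := arcZone_left (p := s + 1) (q := q) (by omega) (by omega) (by omega) h3 hx0
        refine ⟨h1, Or.inl ⟨h4, h2⟩, fun h => ?_⟩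
        have := hZz x h
        omega
      · obtain ⟨g1, g2, g3, g4, g5⟩ := h3
        refine ⟨h1, Or.inr ⟨by omega, by omega, by omega, by omega⟩, fun h => ?_⟩
        have := hZz x h
        omega
    have hte : Conn ((C \ U) ∩ arcZone a w) t e' :=
      (Conn.mono Set.inter_subset_left ht).trans hee
    obtain ⟨x, x', hx, hx', h3, h4⟩ := hte.ring lip_fst (p := 1) (q := 2 * w + 1) (by omega)
      (by have := (Conn.left_mem ht).2; simp only [Set.mem_ofPred_eq] at this; omega) he'.ge
    have hz := h3.right_mem.2
    obtain ⟨_, _, g3, g4, g5⟩ := hz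
    refine ⟨x, by omega, (hct.mono hYP).trans (h3.mono hzone), x', hx, hx', h4.mono ?_⟩
    rintro y ⟨g6, g7, g8⟩
    refine ⟨hzone g6, g7, g8, ?_⟩
    obtain ⟨_, _, k3, k4, k5⟩ := g6.2
    constructor <;> omega
  have inner := main a1 (Or.inl rfl) u v hc (by
    intro T hT ⟨b, e, hb, he, hbe⟩ hUT
    have meT := mem_cornerAnn.1 (hUT hbe.right_mem)
    constructor
    · obtain ⟨x, hx, hx'⟩ := barrier hs hbe hb he hUT hc.restrict hu hv
        fun x hx => hYB _ x (Conn.right_mem hx).2.1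
      rcases hx with hx | hx
      · exact absurd hx (Conn.right_mem hx').2.2
      · exact ⟨x, hx, hx'⟩
    · rintro x ⟨l, hl0, hxl⟩ hux
      have ml := mem_cornerAnn.1 hxl.right_mem.1
      simp only [nrm] at ml
      obtain ⟨l1, l2⟩ := l
      dsimp only at hl0 ml
      subst hl0
      have hline : Conn {v : Site | v.1 = 0 ∧ l2 ≤ v.2 ∧ v.2 ≤ q} (0, l2) (0, q) :=
        conn_col (by omega) fun y q1 q2 => ⟨rfl, q1, q2⟩
      obtain ⟨y, hy, hy'⟩ := barrier (PB := ((C ∩ (cornerAnn (s + 1) q \ U)) \ T) ∪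
          ((cornerAnn a2 (a2 + 2 * w) \ U) ∪ {v : Site | v.1 = 0 ∧ l2 ≤ v.2 ∧ v.2 ≤ q}))
        hs hbe hb he hUT
        (((hux.mono Set.subset_union_left).trans (hxl.mono
          (Set.subset_union_left.trans Set.subset_union_right))).trans (hline.mono
          (Set.subset_union_right.trans Set.subset_union_right))) hu
        (by simp only [nrm]; omega) (by
          rintro y (hy | hy | hy)
          · exact hYB _ y hy.1.2.1
          · refine hYB _ y ?_
            have := mem_cornerAnn.1 hy.1
            exact mem_cornerAnn.2 (by omega)
          · obtain ⟨h1, h2, h3⟩ := hy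
            simp only [nrm]; omega)
      rcases hy with hy | hy
      · rcases hy' with h | h | h
        · exact h.1.2.2 hy
        · exact h.2 hy
        · exact hl y hy h.1
      · have h0 := hT y hy
        rcases hy' with h | h | h
        · exact h.2 hy
        · have := mem_cornerAnn.1 h.1
          omega
        · obtain ⟨h1, h2, h3⟩ := h
          simp only [nrm] at h0
          omega) hA1
  have outer := main a3 (Or.inr rfl) v u hc.symm (by
    intro T hT ⟨b, e, hb, he, hbe⟩ hUT
    have meT := mem_cornerAnn.1 (hUT hbe.right_mem)
    constructor
    · obtain ⟨x, hx, hx'⟩ := barrier hs hbe hb he hUT hc.symm.restrict.symm hu hv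
        fun x hx => hYB _ x (Conn.right_mem hx).2.1
      rcases hx with hx | hx
      · exact absurd hx (Conn.right_mem hx').2.2
      · exact ⟨x, hx, hx'⟩
    · rintro x ⟨l, hl0, hxl⟩ hux
      have ml := mem_cornerAnn.1 hxl.right_mem.1
      simp only [nrm] at ml
      obtain ⟨l1, l2⟩ := l
      dsimp only at hl0 ml
      subst hl0
      have hline : Conn {v : Site | v.1 = 0 ∧ s + 1 ≤ v.2 ∧ v.2 ≤ l2} (0, s + 1) (0, l2) :=
        conn_col (by omega) fun y q1 q2 => ⟨rfl, q1, q2⟩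
      obtain ⟨y, hy, hy'⟩ := barrier (PB := ((C ∩ (cornerAnn (s + 1) q \ U)) \ T) ∪
          ((cornerAnn a2 (a2 + 2 * w) \ U) ∪ {v : Site | v.1 = 0 ∧ s + 1 ≤ v.2 ∧ v.2 ≤ l2}))
        hs hbe hb he hUT
        (((hux.mono Set.subset_union_left).trans (hxl.mono
          (Set.subset_union_left.trans Set.subset_union_right))).trans (hline.symm.mono
          (Set.subset_union_right.trans Set.subset_union_right))).symm
        (by simp only [nrm]; omega) hv (by
          rintro y (hy | hy | hy)
          · exact hYB _ y hy.1.2.1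
          · refine hYB _ y ?_
            have := mem_cornerAnn.1 hy.1
            exact mem_cornerAnn.2 (by omega)
          · obtain ⟨h1, h2, h3⟩ := hy
            simp only [nrm]; omega)
      rcases hy with hy | hy
      · rcases hy' with h | h | h
        · exact h.1.2.2 hy
        · exact h.2 hy
        · exact hl y hy h.1
      · have h0 := hT y hy
        rcases hy' with h | h | h
        · exact h.2 hy
        · have := mem_cornerAnn.1 h.1
          omega
        · obtain ⟨h1, h2, h3⟩ := h
          simp only [nrm] at h0
          omega) hA3
  obtain ⟨x1, _, hux1, x1', hx1, hx1', hc1⟩ := inner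
  obtain ⟨x3, _, hvx3, x3', hx3, hx3', hc3⟩ := outer
  obtain ⟨b, t, ⟨hb, ht⟩, hbt⟩ := hR
  have hRP : C ∩ rect 1 (2 * w + 1) a1 (a3 + 2 * w) ⊆ P := by
    rintro x ⟨h1, g1, g2, g3, g4⟩
    refine ⟨h1, Or.inr ⟨by omega, by omega, by omega, by omega⟩, fun h => ?_⟩
    have := hZz x h
    omega
  have meet : ∀ x x' : Site, x.1 = 1 → x'.1 = 2 * w + 1 →
      Conn (P ∩ {v | 1 ≤ v.1 ∧ v.1 ≤ 2 * w + 1 ∧ a1 ≤ v.2 ∧ v.2 ≤ a3 + 2 * w}) x x' →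
      Conn P x b := by
    intro x x' hx hx' hxx
    obtain ⟨y, hy, hy'⟩ := conn_cross hxx.restrict hbt.restrict
      (by
        intro y hy
        obtain ⟨_, g1, g2, g3, g4⟩ := Conn.right_mem hy
        omega)
      (by
        intro y hy
        obtain ⟨_, g1, g2, g3, g4⟩ := Conn.right_mem hy
        omega)
    exact (Conn.mono Set.inter_subset_left hy).trans (Conn.mono hRP hy').symm
  exact ⟨u, v, ⟨hu, hv⟩, (hux1.trans (meet _ _ hx1 hx1' hc1)).trans
    (hvx3.trans (meet _ _ hx3 hx3' hc3)).symm⟩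

/-! ### Gaining a constant factor at every scale -/

theorem wedge_finite (p r : ℤ) : (wedge p r).Finite := by
  refine (rect_finite 1 r p r).subset ?_
  rintro v ⟨h1, h2, h3, h4⟩
  refine ⟨?_, ?_, ?_, ?_⟩ <;> omega

theorem free_finite (U : Set Site) (p q r : ℤ) : (free U p q r).Finite :=
  ((cornerAnn_finite p q).subset Set.sdiff_subset).union (wedge_finite p r)

theorem free_mono {U : Set Site} {p q r r' : ℤ} (h : r ≤ r') : free U p q r ⊆ free U p q r' :=
  Set.union_subset_union_right _ fun _ hv => ⟨hv.1, hv.2.1, hv.2.2.1, hv.2.2.2.trans h⟩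

theorem decr_of_monotone {Q : Set Site → Prop} (hQ : ∀ X Y, X ⊆ Y → Q X → Q Y) (B : Set Site) :
    Decr B {ω | Q (cl ω)} := by
  intro ω ω' h h' hq
  refine hQ _ _ ?_ hq
  intro v hv
  rw [mem_cl] at hv ⊢
  by_cases hB : v ∈ B
  · exact h v hB hv
  · rw [← h' v hB]; exact hv

theorem harris_monotone {μ : Measure Config} (hμ : IsBernoulliHalf μ) {Q R : Set Site → Prop}
    (hQ : ∀ X Y, X ⊆ Y → Q X → Q Y) (hR : ∀ X Y, X ⊆ Y → R X → R Y)
    (lQ : Loc {ω | Q (cl ω)}) (lR : Loc {ω | R (cl ω)}) :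
    μ.real {ω | Q (cl ω)} * μ.real {ω | R (cl ω)} ≤ μ.real {ω | Q (cl ω) ∧ R (cl ω)} := by
  obtain ⟨A, hA, hd⟩ := lR
  exact harris_decr hμ hA lQ hd (decr_of_monotone hQ A) (decr_of_monotone hR A)

theorem loc_radial (p q : ℤ) {R : Set Site} (hR : R.Finite) :
    Loc {ω | Radial p q (cl ω ∩ R)} := (dep_cl R (Radial p q)).loc hR

theorem arcZone_finite (a w : ℤ) : (arcZone a w).Finite := by
  refine (rect_finite (-(a + 2 * w)) (2 * w + 1) 0 (a + 2 * w)).subset ?_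
  rintro v ⟨h1, h2, h3, h4, h5⟩
  exact ⟨h1, h2, h3, h4⟩

theorem loc_arc (a w : ℤ) : Loc {ω | Arc a w (cl ω)} :=
  (dep_conn_cl (arcZone a w) fun b e : Site => b.2 = 0 ∧ e.1 = 2 * w + 1).loc (arcZone_finite a w)

theorem loc_BT_cl (x0 x1 y0 y1 : ℤ) : Loc {ω | BT x0 x1 y0 y1 (cl ω)} :=
  (dep_conn_cl _ _).loc (rect_finite _ _ _ _)

theorem BT.mono {x0 x1 y0 y1 : ℤ} {A B : Set Site} (h : BT x0 x1 y0 y1 A) (hAB : A ⊆ B) :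
    BT x0 x1 y0 y1 B := by
  obtain ⟨l, r, h1, h2⟩ := h
  exact ⟨l, r, h1, h2.mono (Set.inter_subset_inter_left _ hAB)⟩

theorem Arc.of_crossings {a w : ℤ} (ha : 0 ≤ a) (hw : 0 ≤ w) {X : Set Site}
    (h1 : BT (-(a + 2 * w)) (-a) 0 (a + 2 * w) X)
    (h2 : LR (-(a + 2 * w)) (2 * w + 1) a (a + 2 * w) X) : Arc a w X := by
  obtain ⟨b, t, ⟨hb, ht⟩, hbt⟩ := h1
  obtain ⟨l, r, ⟨hl, hr⟩, hlr⟩ := h2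
  obtain ⟨v, hv, hv'⟩ := conn_cross hlr.restrict hbt.restrict
    (by
      intro v hv
      obtain ⟨_, q1, q2, q3, q4⟩ := Conn.right_mem hv
      constructor <;> omega)
    (by
      intro v hv
      obtain ⟨_, q1, q2, q3, q4⟩ := Conn.right_mem hv
      constructor <;> omega)
  have c1 : Conn (X ∩ arcZone a w) b v := Conn.mono (by
    rintro x ⟨hx, q1, q2, q3, q4⟩
    refine ⟨hx, ?_⟩
    simp only [arcZone, Set.mem_ofPred_eq]; omega) hv'
  have sub : X ∩ rect (-(a + 2 * w)) (2 * w + 1) a (a + 2 * w) ⊆ X ∩ arcZone a w := by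
    rintro x ⟨hx, q1, q2, q3, q4⟩
    refine ⟨hx, ?_⟩
    simp only [arcZone, Set.mem_ofPred_eq]; omega
  exact ⟨b, r, ⟨hb, hr⟩, c1.trans ((Conn.mono sub hv).symm.trans (hlr.mono sub))⟩

section
variable {μ : Measure Config}

theorem arc_ge_cl (hμ : IsBernoulliHalf μ) {a w : ℤ} (hw : 1 ≤ w) (ha : 0 ≤ a)
    (haw : a + 4 * w + 1 ≤ 12 * w) : rswC ^ 2 ≤ μ.real {ω | Arc a w (cl ω)} := by
  have := hμ.1
  have h1 := rsw_BT_cl hμ (x0 := -(a + 2 * w)) (x1 := -a) (y0 := 0) (y1 := a + 2 * w) hw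
    (by omega) (by omega) (by omega)
  have h2 := rsw_LR_cl hμ (x0 := -(a + 2 * w)) (x1 := 2 * w + 1) (y0 := a) (y1 := a + 2 * w) hw
    (by omega) (by omega) (by omega)
  calc rswC ^ 2 = rswC * rswC := sq _
    _ ≤ _ := mul_le_mul h1 h2 rswC_pos.le measureReal_nonneg
    _ ≤ _ := harris_monotone hμ (fun X Y h h' => h'.mono h)
        (fun X Y h ⟨l, r, h1, h2⟩ => ⟨l, r, h1, h2.mono (Set.inter_subset_inter_left _ h)⟩)
        (loc_BT_cl _ _ _ _) (loc_LR_cl _ _ _ _)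
    _ ≤ _ := measureReal_mono fun ω hω => Arc.of_crossings ha (by omega) hω.1 hω.2

theorem arc_ge_op (hμ : IsBernoulliHalf μ) {a w : ℤ} (hw : 1 ≤ w) (ha : 0 ≤ a)
    (haw : a + 4 * w + 1 ≤ 12 * w) : rswC ^ 2 ≤ μ.real {ω | Arc a w (op ω)} := by
  have hl : Loc {ω | Arc a w (op ω)} :=
    (dep_conn_op (arcZone a w) fun b e : Site => b.2 = 0 ∧ e.1 = 2 * w + 1).loc (arcZone_finite a w)
  refine (arc_ge_cl hμ hw ha haw).trans_eq ?_
  rw [← prob_relabel hμ (Equiv.refl _) true hl]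
  congr 1
  ext ω
  simp only [Set.mem_preimage, Set.mem_ofPred_eq, op_relabel_true]
  rfl

theorem Attached.detour_prob (hμ : IsBernoulliHalf μ) {s q w r : ℤ} {U : Set Site} (hs : 0 ≤ s)
    (hU : Attached (s + 1) q U) (hw : 3 ≤ w) (hsw : s + 1 ≤ 3 * w) (hq : 9 * w + 2 ≤ q)
    (hr : r ≤ 5 * w) :
    μ.real {ω | Radial (s + 1) q (cl ω ∩ free U (s + 1) q r)} +
      rswC ^ 7 * μ.real {ω | Radial (s + 1) q (cl ω ∩ (cornerAnn (s + 1) q \ U))} ≤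
    μ.real {ω | Radial (s + 1) q (cl ω ∩ free U (s + 1) q (9 * w + 2))} := by
  have := hμ.1
  set α := μ.real {ω | Radial (s + 1) q (cl ω ∩ (cornerAnn (s + 1) q \ U))} with hα
  have hfin : (cornerAnn (s + 1) q \ U).Finite := (cornerAnn_finite _ _).subset Set.sdiff_subset
  rcases Set.eq_empty_or_nonempty {ω | Radial (s + 1) q (cl ω ∩ (cornerAnn (s + 1) q \ U))} with
    h0 | ⟨ω0, h0⟩
  · rw [hα, h0, measureReal_empty, mul_zero, add_zero]
    exact measureReal_mono fun ω hω =>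
      Radial.mono hω (Set.inter_subset_inter_right _ (free_mono (by omega)))
  have hl := hU.line hs h0 fun _ hv => hv.2
  set Z := pocket U (5 * w + 1) (5 * w + 1 + 2 * w) with hZ
  have hZf : Z.Finite := (cornerAnn_finite _ _).subset (pocket_subset.trans Set.sdiff_subset)
  set F := free U (s + 1) q (9 * w + 2) with hF
  set E : Set Config := {ω | Radial (s + 1) q (cl ω ∩ (F \ Z))} with hE
  set O : Set Config := {ω | Arc (5 * w + 1) w (op ω ∪ Zᶜ)} with hO
  have dE : Dep (F \ Z) E := dep_cl _ (Radial (s + 1) q)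
  have dO : Dep Z O := by
    have e : O = {ω | (fun X => Arc (5 * w + 1) w (X ∪ Zᶜ)) (op ω ∩ Z)} := by
      ext ω
      have : op ω ∪ Zᶜ = op ω ∩ Z ∪ Zᶜ := by
        ext v; simp only [Set.mem_union, Set.mem_inter_iff, Set.mem_compl_iff]; tauto
      simp only [hO, Set.mem_ofPred_eq, ← this]
    rw [e]
    exact dep_op Z fun X => Arc (5 * w + 1) w (X ∪ Zᶜ)
  have hFf : (F \ Z).Finite := (free_finite _ _ _ _).subset Set.sdiff_subset
  have pO : rswC ^ 2 ≤ μ.real O :=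
    (arc_ge_op hμ (a := 5 * w + 1) (w := w) (by omega) (by omega) (by omega)).trans
      (measureReal_mono fun ω hω => Arc.mono hω Set.subset_union_left)
  have pE : α * rswC ^ 5 ≤ μ.real E := by
    have mR : ∀ X Y : Set Site, X ⊆ Y → Radial (s + 1) q (X ∩ (cornerAnn (s + 1) q \ U)) →
        Radial (s + 1) q (Y ∩ (cornerAnn (s + 1) q \ U)) := fun X Y h h' =>
      h'.mono (Set.inter_subset_inter_left _ h)
    have mA : ∀ a : ℤ, ∀ X Y : Set Site, X ⊆ Y → Arc a w X → Arc a w Y := fun a X Y h h' => h'.mono h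
    have mB : ∀ X Y : Set Site, X ⊆ Y → BT 1 (2 * w + 1) (3 * w) (7 * w + 2 + 2 * w) X →
        BT 1 (2 * w + 1) (3 * w) (7 * w + 2 + 2 * w) Y := fun X Y h h' => h'.mono h
    have l0 : Loc {ω | Radial (s + 1) q (cl ω ∩ (cornerAnn (s + 1) q \ U))} := loc_radial _ _ hfin
    have p1 := arc_ge_cl hμ (a := 3 * w) (w := w) (by omega) (by omega) (by omega)
    have p3 := arc_ge_cl hμ (a := 7 * w + 2) (w := w) (by omega) (by omega) (by omega)
    have p2 := rsw_BT_cl hμ (x0 := 1) (x1 := 2 * w + 1) (y0 := 3 * w) (y1 := 7 * w + 2 + 2 * w)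
      (t := w) (by omega) (by omega) (by omega) (by omega)
    have k1 := harris_monotone hμ mR (mA (3 * w)) l0 (loc_arc _ _)
    have l1 := l0.inter (loc_arc (3 * w) w)
    have k2 := harris_monotone hμ (Q := fun X => Radial (s + 1) q (X ∩ (cornerAnn (s + 1) q \ U)) ∧
      Arc (3 * w) w X) (fun X Y h h' => ⟨mR X Y h h'.1, mA _ X Y h h'.2⟩) (mA (7 * w + 2)) l1
      (loc_arc _ _)
    have l2 := l1.inter (loc_arc (7 * w + 2) w)
    have k3 := harris_monotone hμ (Q := fun X => (Radial (s + 1) q (X ∩ (cornerAnn (s + 1) q \ U)) ∧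
      Arc (3 * w) w X) ∧ Arc (7 * w + 2) w X)
      (fun X Y h h' => ⟨⟨mR X Y h h'.1.1, mA _ X Y h h'.1.2⟩, mA _ X Y h h'.2⟩) mB l2
      (loc_BT_cl _ _ _ _)
    have hc := rswC_pos
    calc α * rswC ^ 5 = α * rswC ^ 2 * rswC ^ 2 * rswC := by ring
      _ ≤ α * μ.real {ω | Arc (3 * w) w (cl ω)} * μ.real {ω | Arc (7 * w + 2) w (cl ω)} *
          μ.real {ω | BT 1 (2 * w + 1) (3 * w) (7 * w + 2 + 2 * w) (cl ω)} := by
        have : 0 ≤ α := measureReal_nonneg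
        gcongr
      _ ≤ _ := by
        refine (mul_le_mul_of_nonneg_right ((mul_le_mul_of_nonneg_right k1
          measureReal_nonneg).trans k2) measureReal_nonneg).trans k3
      _ ≤ _ := measureReal_mono ?_
    rintro ω ⟨⟨⟨h1, h2⟩, h3⟩, h4⟩
    have := hU.detour hs (a1 := 3 * w) (a2 := 5 * w + 1) (a3 := 7 * w + 2) hsw (by omega) (by omega)
      (by omega) (by omega) (by omega) h1 h2 h3 h4
    rw [show 7 * w + 2 + 2 * w = 9 * w + 2 by ring] at this
    exact this
  have hdis : Disjoint {ω | Radial (s + 1) q (cl ω ∩ free U (s + 1) q r)} (E ∩ O) := by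
    rw [Set.disjoint_left]
    rintro ω h1 ⟨_, h2⟩
    exact hU.not_radial hs hl (a := 5 * w + 1) (by omega) (by omega) (by omega) (by omega) (by omega)
      h2 h1
  have lEO : Loc (E ∩ O) := (dE.loc hFf).inter (dO.loc hZf)
  calc _ ≤ μ.real {ω | Radial (s + 1) q (cl ω ∩ free U (s + 1) q r)} + μ.real (E ∩ O) := by
        rw [prob_inter_of_disjoint hμ hFf hZf Set.disjoint_sdiff_left dE dO]
        have hc := rswC_pos
        have : α * rswC ^ 5 * rswC ^ 2 ≤ μ.real E * μ.real O :=
          mul_le_mul pE pO (by positivity) measureReal_nonneg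
        nlinarith
    _ = μ.real ({ω | Radial (s + 1) q (cl ω ∩ free U (s + 1) q r)} ∪ (E ∩ O)) :=
        (measureReal_union hdis lEO.measurableSet).symm
    _ ≤ _ := by
        refine measureReal_mono (Set.union_subset ?_ ?_)
        · intro ω hω
          exact Radial.mono hω (Set.inter_subset_inter_right _ (free_mono (by omega)))
        · intro ω hω
          exact Radial.mono hω.1 (Set.inter_subset_inter_right _ Set.sdiff_subset)

theorem Attached.sum_detours (hμ : IsBernoulliHalf μ) {s q : ℤ} {U : Set Site} (hs : 1 ≤ s)
    (hU : Attached (s + 1) q U) (L : ℕ) (hq : 9 * (2 ^ (L + 1) * s) + 2 ≤ q) :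
    L * (rswC ^ 7 * μ.real {ω | Radial (s + 1) q (cl ω ∩ (cornerAnn (s + 1) q \ U))}) ≤
    μ.real {ω | Radial (s + 1) q (cl ω ∩ free U (s + 1) q (9 * (2 ^ (L + 1) * s) + 2))} := by
  induction L with
  | zero => simp
  | succ L ih =>
    have h1 : (1 : ℤ) ≤ 2 ^ L := one_le_pow₀ one_le_two
    have h2 : s ≤ 2 ^ L * s := le_mul_of_one_le_left (by omega) h1
    have e1 : (2 : ℤ) ^ (L + 1) * s = 2 * (2 ^ L * s) := by ring
    have e2 : (2 : ℤ) ^ (L + 1 + 1) * s = 4 * (2 ^ L * s) := by ring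
    rw [e1] at ih
    rw [e2] at hq ⊢
    have := hU.detour_prob hμ (w := 4 * (2 ^ L * s)) (r := 9 * (2 * (2 ^ L * s)) + 2) (by omega)
      (by omega) (by omega) hq (by omega)
    have := ih (by omega)
    push_cast
    linarith

end

/-! ### Arms in a corner -/

/-- The horizontal axis. -/
def axis : Set Site := {v | v.2 = 0}

/-- The sites inspected when exploring the closed clusters of the bottom row of a corner. -/
def explored (p q : ℤ) (K : Set Site) : Set Site := inspected (cornerAnn p q) axis K

theorem attached_explored (p q : ℤ) (ω : Config) :
    Attached p q (explored p q (clusters (cornerAnn p q) axis ω)) where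
  subset := inspected_subset (clusters_subset.trans Set.inter_subset_right)
  conn := by
    have hK : ∀ v ∈ clusters (cornerAnn p q) axis ω, ∃ b : Site, b.2 = 0 ∧
        Conn (explored p q (clusters (cornerAnn p q) axis ω)) b v := by
      rintro v ⟨b, hb, hbv⟩
      exact ⟨b, hb, hbv.restrict' fun w hw => Or.inl (Or.inr ⟨b, hb, hw⟩)⟩
    intro v hv
    rcases id hv with (h | h) | ⟨h, k, hk, hkv⟩
    · exact ⟨v, h.1, Conn.refl hv⟩
    · exact hK v h
    · obtain ⟨b, hb, hbk⟩ := hK k hk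
      exact ⟨b, hb, hbk.tail hkv hv⟩
  row := fun v hv h => Or.inl (Or.inl ⟨h, hv⟩)

theorem mem_clusters_of_explored {p q : ℤ} {ω : Config} {v : Site} (hv : v ∈ cl ω)
    (h : v ∈ explored p q (clusters (cornerAnn p q) axis ω)) :
    v ∈ clusters (cornerAnn p q) axis ω := by
  by_contra h'
  exact not_mem_cl.2 (open_of_inspected h h') hv

theorem radial_of_corner_arm {p q : ℤ} {ω : Config} (h : ω ∈ Arm (corner (0, 0)) (0, 0) p q) :
    Radial p q (cl ω ∩ (cornerAnn p q \ explored p q (clusters (cornerAnn p q) axis ω))) := by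
  obtain ⟨u, w, h1, hc, ht⟩ := h
  refine ⟨u, w, h1, hc.restrict' fun t h2 => ⟨h2.right_mem.1, h2.right_mem.2, fun h3 => ?_⟩⟩
  obtain ⟨z, hz, hzt⟩ := mem_clusters_of_explored h2.right_mem.1 h3
  have := ht z (h2.trans hzt.symm)
  have h0 : z.2 = 0 := hz
  dsimp only at this
  omega

theorem cone_arm_of_radial {p q r : ℤ} {ω : Config} (hp : 1 ≤ p) (hr : r ≤ q)
    (hl : ∀ v ∈ explored p q (clusters (cornerAnn p q) axis ω), v.1 ≠ 0)
    (h : Radial p q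
      (cl ω ∩ free (explored p q (clusters (cornerAnn p q) axis ω)) p q r)) :
    ω ∈ Arm (cone (0, 0)) (0, 0) p q := by
  obtain ⟨u, w, h1, hc⟩ := h
  set U := explored p q (clusters (cornerAnn p q) axis ω) with hU
  have sub : cl ω ∩ free U p q r ⊆ cl ω ∩ (cone (0, 0) ∩ ann (0, 0) p q) := by
    rintro v ⟨hv, ⟨h2, _⟩ | ⟨h2, h3, h4, h5⟩⟩
    · obtain ⟨h3, h4⟩ := mem_cornerAnn.1 h2
      refine ⟨hv, ?_, h4⟩
      simp only [cone, Set.mem_ofPred_eq]; omega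
    · refine ⟨hv, ?_, ?_⟩
      · simp only [cone, Set.mem_ofPred_eq]; omega
      · simp only [ann, nrm, Set.mem_ofPred_eq]; omega
  refine ⟨u, w, h1, hc.mono sub, fun t ht => ?_⟩
  have key : t ∈ free U p q q := by
    refine ht.ind (P := fun t => t ∈ free U p q q) (free_mono hr hc.left_mem.2) ?_
    rintro s t hs0 hs hst ⟨htc, ht1, ht2⟩
    simp only [cone, ann, nrm, Set.mem_ofPred_eq] at ht1 ht2
    by_cases h0 : 1 ≤ t.1
    · right
      refine ⟨h0, ?_, ?_, ?_⟩ <;> omega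
    · have htA : t ∈ cornerAnn p q := mem_cornerAnn.2 (by simp only [nrm]; omega)
      refine Or.inl ⟨htA, fun htU => ?_⟩
      rcases hs with hs | hs
      · exact hs.2 (Or.inr ⟨hs.1, t, mem_clusters_of_explored htc htU, hst.symm⟩)
      · have := hl t htU
        have := hs.1
        rw [adj_iff] at hst
        omega
  rcases key with ⟨h2, h3⟩ | ⟨h2, h3, _⟩
  · have h4 := (mem_cornerAnn.1 h2).1
    have : t.2 ≠ 0 := fun h5 => h3 (Or.inl (Or.inl ⟨h5, h2⟩))
    dsimp only; omega
  · dsimp only; omega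

section
variable {μ : Measure Config}

theorem corner_gain (hμ : IsBernoulliHalf μ) {s q : ℤ} (hs : 1 ≤ s) (L : ℕ)
    (hq : 9 * (2 ^ (L + 1) * s) + 2 ≤ q) :
    L * rswC ^ 7 * μ.real (Arm (corner (0, 0)) (0, 0) (s + 1) q) ≤
      μ.real (Arm (cone (0, 0)) (0, 0) (s + 1) q) := by
  have := hμ.1
  have hA := cornerAnn_finite (s + 1) q
  have hl1 : Loc (Arm (corner (0, 0)) (0, 0) (s + 1) q) := (dep_arm _ _ _ _).loc hA
  have hl2 : Loc (Arm (cone (0, 0)) (0, 0) (s + 1) q) := (dep_arm _ _ _ _).loc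
    ((half_ann_finite (0, 0) (s + 1) q).subset (Set.inter_subset_inter_left _ fun _ hv => hv.1))
  rw [prob_partition_clusters hμ hA axis hl1, prob_partition_clusters hμ hA axis hl2,
    Finset.mul_sum]
  refine Finset.sum_le_sum fun K _ => ?_
  have hc := rswC_pos
  set U := explored (s + 1) q K with hU
  set E : Set Config := {ω | clusters (cornerAnn (s + 1) q) axis ω = K} with hE
  set F : Set Config := {ω | Radial (s + 1) q (cl ω ∩ (cornerAnn (s + 1) q \ U))} with hF
  have h1 : Arm (corner (0, 0)) (0, 0) (s + 1) q ∩ E ⊆ E ∩ F := by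
    rintro ω ⟨h1, h2⟩
    refine ⟨h2, ?_⟩
    have := radial_of_corner_arm h1
    rwa [show clusters _ axis ω = K from h2] at this
  rcases (E ∩ F).eq_empty_or_nonempty with h0 | ⟨ω0, h2, h3⟩
  · rw [h0] at h1
    rw [Set.subset_empty_iff.1 h1, measureReal_empty, mul_zero]
    exact measureReal_nonneg
  have hUa : Attached (s + 1) q U := by
    have := attached_explored (s + 1) q ω0
    rwa [show clusters _ axis ω0 = K from h2] at this
  have hl := hUa.line (by omega) h3 fun _ hv => hv.2
  have dE : Dep U E := dep_clusters_eq _ _ _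
  have hUf : U.Finite := hA.subset hUa.subset
  set r := 9 * (2 ^ (L + 1) * s) + 2 with hr
  set G : Set Config := {ω | Radial (s + 1) q (cl ω ∩ free U (s + 1) q r)} with hG
  have hEF : μ.real (E ∩ F) = μ.real E * μ.real F :=
    prob_inter_of_disjoint hμ hUf (hA.subset Set.sdiff_subset) Set.disjoint_sdiff_right dE
      (dep_cl _ (Radial (s + 1) q))
  have hEG : μ.real (E ∩ G) = μ.real E * μ.real G := by
    refine prob_inter_of_disjoint hμ hUf (free_finite U (s + 1) q r) ?_ dE
      (dep_cl _ (Radial (s + 1) q))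
    rw [Set.disjoint_left]
    rintro v hv (h | h)
    · exact h.2 hv
    · have := (mem_cornerAnn.1 (hUa.subset hv)).1
      have := h.1
      omega
  calc L * rswC ^ 7 * μ.real (Arm (corner (0, 0)) (0, 0) (s + 1) q ∩ E)
      ≤ L * rswC ^ 7 * μ.real (E ∩ F) :=
        mul_le_mul_of_nonneg_left (measureReal_mono h1) (by positivity)
    _ = μ.real E * (L * (rswC ^ 7 * μ.real F)) := by rw [hEF]; ring
    _ ≤ μ.real E * μ.real G :=
        mul_le_mul_of_nonneg_left (hUa.sum_detours hμ hs L hq) measureReal_nonneg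
    _ = μ.real (E ∩ G) := hEG.symm
    _ ≤ _ := by
        refine measureReal_mono ?_
        rintro ω ⟨h4, h5⟩
        refine ⟨?_, h4⟩
        have e : clusters (cornerAnn (s + 1) q) axis ω = K := h4
        subst e
        exact cone_arm_of_radial (by omega) hq hl h5

end

theorem arm_subset (D : Set Site) (z : Site) {p q p' q' : ℤ} (h1 : p ≤ p') (h2 : p' ≤ q')
    (h3 : q' ≤ q) : Arm D z p q ⊆ Arm D z p' q' := by
  rintro ω ⟨u, w, ⟨hu, hw⟩, hc, ht⟩
  refine arm_of_conn hc ht ?_ ?_ h2 (by omega) (by omega)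
  · rintro v ⟨⟨h4, h5, _⟩, _⟩; exact ⟨h5, h4⟩
  · rintro v ⟨h4, h5, h6, h7⟩
    exact ⟨h4, h5, by omega, by omega⟩

section
variable {μ : Measure Config}

theorem corner_gain_pow (hμ : IsBernoulliHalf μ) {s : ℤ} (hs : 1 ≤ s) (L : ℕ) :
    L * rswC ^ 7 * μ.real (Arm (corner (0, 0)) (0, 0) (s + 1) (2 ^ (L + 5) * s)) ≤
      256 / (rswC ^ 3) ^ 2 * (1 / 2) ^ (L + 5) := by
  refine (corner_gain hμ hs L ?_).trans (cone_linear hμ hs (L + 5) (0, 0))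
  have h1 : (1 : ℤ) ≤ 2 ^ L := one_le_pow₀ one_le_two
  have h2 : s ≤ 2 ^ L * s := le_mul_of_one_le_left (by omega) h1
  have e1 : (2 : ℤ) ^ (L + 1) * s = 2 * (2 ^ L * s) := by ring
  have e2 : (2 : ℤ) ^ (L + 5) * s = 32 * (2 ^ L * s) := by ring
  omega

theorem corner_iterate (hμ : IsBernoulliHalf μ) {l : ℕ} (hl : 1 ≤ l) {A : ℝ}
    (h : ∀ s : ℤ, 1 ≤ s → μ.real (Arm (corner (0, 0)) (0, 0) (s + 1) (2 ^ l * s)) ≤ A) (k : ℕ) :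
    ∀ s : ℤ, 1 ≤ s → μ.real (Arm (corner (0, 0)) (0, 0) (s + 1) (2 ^ (l * k) * s)) ≤ A ^ k := by
  have := hμ.1
  have hA : 0 ≤ A := measureReal_nonneg.trans (h 1 le_rfl)
  induction k with
  | zero => intro s hs; simp [measureReal_le_one]
  | succ k ih =>
    intro s hs
    rcases Nat.eq_zero_or_pos k with rfl | hk
    · simpa using h s hs
    have h2 : (2 : ℤ) ≤ 2 ^ l := by
      calc (2 : ℤ) = 2 ^ 1 := (pow_one 2).symm
        _ ≤ 2 ^ l := pow_le_pow_right₀ one_le_two hl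
    have h3 : (2 : ℤ) ≤ 2 ^ (l * k) := by
      calc (2 : ℤ) = 2 ^ 1 := (pow_one 2).symm
        _ ≤ 2 ^ (l * k) := pow_le_pow_right₀ one_le_two (Nat.mul_pos hl hk)
    have h4 : 2 * s ≤ 2 ^ l * s := mul_le_mul_of_nonneg_right h2 (by omega)
    have h5 : 2 * (2 ^ l * s) ≤ 2 ^ (l * k) * (2 ^ l * s) :=
      mul_le_mul_of_nonneg_right h3 (by omega)
    have e : (2 : ℤ) ^ (l * (k + 1)) * s = 2 ^ (l * k) * (2 ^ l * s) := by
      rw [mul_add, mul_one, pow_add]; ring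
    rw [e]
    calc μ.real (Arm (corner (0, 0)) (0, 0) (s + 1) (2 ^ (l * k) * (2 ^ l * s)))
        ≤ μ.real (Arm (corner (0, 0)) (0, 0) (s + 1) (2 ^ l * s) ∩
            Arm (corner (0, 0)) (0, 0) (2 ^ l * s + 1) (2 ^ (l * k) * (2 ^ l * s))) :=
          measureReal_mono (Set.subset_inter
            (arm_subset _ _ le_rfl (by omega) (by omega))
            (arm_subset _ _ (by omega) (by omega) le_rfl))
      _ = _ := by
          refine prob_inter_of_disjoint hμ (cornerAnn_finite _ _) (cornerAnn_finite _ _) ?_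
            (dep_arm _ _ _ _) (dep_arm _ _ _ _)
          rw [Set.disjoint_left]
          rintro v ⟨_, _, h6⟩ ⟨_, h7, _⟩
          omega
      _ ≤ A * A ^ k :=
          mul_le_mul (h s hs) (ih _ (by omega)) measureReal_nonneg hA
      _ = A ^ (k + 1) := by ring

end

/-- Arms in a corner decay faster than linearly. -/
theorem corner_decay : ∃ α : ℝ, 0 < α ∧ ∃ C : ℝ, 1 ≤ C ∧ ∀ μ, IsBernoulliHalf μ →
    ∀ (s : ℤ), 1 ≤ s → ∀ (l : ℕ) (z : Site),
      μ.real (Arm (corner z) z (s + 1) (2 ^ l * s)) ≤ C * (2 : ℝ) ^ (-(1 + α) * l) := by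
  have hc := rswC_pos
  set D : ℝ := 256 / (rswC ^ 3) ^ 2 with hD
  have hDp : 0 < D := by positivity
  obtain ⟨L, hL⟩ := exists_nat_ge (2 * D / rswC ^ 7)
  rw [div_le_iff₀ (by positivity)] at hL
  set l0 := L + 5 with hl0
  have key : ∀ μ, IsBernoulliHalf μ → ∀ s : ℤ, 1 ≤ s →
      μ.real (Arm (corner (0, 0)) (0, 0) (s + 1) (2 ^ l0 * s)) ≤ (1 / 2) ^ (l0 + 1) := by
    intro μ hμ s hs
    have h1 := corner_gain_pow hμ hs L
    set x := μ.real (Arm (corner (0, 0)) (0, 0) (s + 1) (2 ^ (L + 5) * s)) with hx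
    have h2 : 2 * D * x ≤ L * rswC ^ 7 * x := mul_le_mul_of_nonneg_right hL measureReal_nonneg
    have h3 : D * (2 * x) ≤ D * (1 / 2) ^ (L + 5) := by linarith
    have h4 := le_of_mul_le_mul_left h3 hDp
    rw [pow_succ]
    linarith
  have hl0p : (0 : ℝ) < l0 := by rw [hl0]; positivity
  refine ⟨1 / l0, by positivity, 2 ^ (l0 + 1), one_le_pow₀ one_le_two, ?_⟩
  intro μ hμ s hs l z
  have := hμ.1
  refine (prob_arm_le_shift hμ transInv_corner (fun _ v hv => hv.1) z (0, 0) _ _).trans ?_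
  set k := l / l0 with hk
  have hkl : l0 * k ≤ l := Nat.mul_div_le l l0
  have hlk : l < l0 * (k + 1) := Nat.lt_mul_div_succ l (by omega)
  have h1 : μ.real (Arm (corner (0, 0)) (0, 0) (s + 1) (2 ^ l * s)) ≤
      ((1 / 2) ^ (l0 + 1)) ^ k := by
    rcases Nat.eq_zero_or_pos k with h0 | h0
    · rw [h0, pow_zero]; exact measureReal_le_one
    · refine le_trans (measureReal_mono (arm_subset _ _ le_rfl ?_ ?_))
        (corner_iterate hμ (by omega) (key μ hμ) k s hs)
      · have h3 : (2 : ℤ) ≤ 2 ^ (l0 * k) := by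
          calc (2 : ℤ) = 2 ^ 1 := (pow_one 2).symm
            _ ≤ 2 ^ (l0 * k) := pow_le_pow_right₀ one_le_two (Nat.mul_pos (by omega) h0)
        have := mul_le_mul_of_nonneg_right h3 (show 0 ≤ s by omega)
        omega
      · exact mul_le_mul_of_nonneg_right (pow_le_pow_right₀ one_le_two hkl) (by omega)
  refine h1.trans ?_
  rw [one_div, inv_pow, inv_pow, ← pow_mul, ← Real.rpow_natCast 2 (l0 + 1),
    ← Real.rpow_natCast 2 ((l0 + 1) * k), ← Real.rpow_neg zero_le_two,
    ← Real.rpow_add zero_lt_two]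
  refine Real.rpow_le_rpow_of_exponent_le one_le_two ?_
  have h5 : (l : ℝ) ≤ l0 * (k + 1) := by exact_mod_cast hlk.le
  have h6 : (1 + 1 / (l0 : ℝ)) * l ≤ (1 + 1 / (l0 : ℝ)) * (l0 * (k + 1)) :=
    mul_le_mul_of_nonneg_left h5 (by positivity)
  have h7 : (1 + 1 / (l0 : ℝ)) * (l0 * (k + 1)) = (l0 + 1) * (k + 1) := by
    field_simp
  push_cast
  linarith

/-! ### Pivotal sites create arms -/

theorem conn_of_isChain {p : List Site} (hp : p.IsChain Adj) {a : Site} (ha : p.head? = some a) :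
    ∀ v ∈ p, Conn {x | x ∈ p} a v := by
  induction p generalizing a with
  | nil => simp at ha
  | cons b t ih =>
    have hab : b = a := by simpa using ha
    subst hab
    intro v hv
    have h0 : b ∈ {x | x ∈ b :: t} := List.mem_cons_self
    rcases List.mem_cons.1 hv with rfl | hv
    · exact Conn.refl h0
    · cases t with
      | nil => simp at hv
      | cons c t =>
        rw [List.isChain_cons_cons] at hp
        have h1 := (ih hp.2 rfl v hv).mono (B := {x | x ∈ b :: c :: t})
          fun x hx => List.mem_cons_of_mem b hx
        exact (Conn.single h0 hp.1 h1.left_mem).trans h1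

theorem PathIn.conn {S A B T : Set Site} {p : List Site} (h : PathIn S p) (hT : ∀ v ∈ p, v ∈ T)
    (hA : FirstIn A p) (hB : LastIn B p) : ∃ a ∈ A, ∃ b ∈ B, Conn (T ∩ S) a b := by
  obtain ⟨a, ha, ha'⟩ := hA
  obtain ⟨b, hb, hb'⟩ := hB
  exact ⟨a, ha, b, hb, (conn_of_isChain h.1.2.2 ha' b (List.mem_of_getLast? hb')).mono
    fun x hx => ⟨hT x hx, h.2 x hx⟩⟩

theorem Pivotal.conn {n : ℤ} {ω : Config} {v : Site} (h : Pivotal n ω v) :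
    ∃ u w : Site, Adj v u ∧ w.2 = n ∧ Conn (cl ω ∩ rect (-n) n (-n) n) u w ∧
      ∀ t, Conn (cl ω ∩ rect (-n) n (-n) n) u t → -n < t.2 := by
  obtain ⟨⟨p, ⟨h1, h2, h3, h4⟩, -⟩, q, -, hq1, hq2, hq3, hq4, -⟩ := h
  obtain ⟨u, hu, w, hw, hc⟩ := hq1.conn (T := cl ω) hq2 hq3 hq4
  refine ⟨u, w, hu, hw.2, hc, fun t ht => ?_⟩
  obtain ⟨a, ha, b, hb, hab⟩ := h1.conn (T := op ω) h2 h3 h4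
  have h5 := ht.right_mem.2.2.2.1
  refine lt_of_le_of_ne h5 fun h6 => ?_
  have ha' : a.1 = -n := ha.2
  have hb' : b.1 = n := hb.2
  have hw' : w.2 = n := hw.2
  obtain ⟨x, hx, hx'⟩ := conn_cross hab (ht.symm.trans hc)
    (fun x hx => ⟨by have := hx.2.1; omega, by have := hx.2.2.1; omega⟩)
    (fun x hx => ⟨by have := hx.2.2.2.1; omega, by have := hx.2.2.2.2; omega⟩)
  exact not_mem_cl.2 hx.1 hx'.1

theorem Pivotal.half_arm {n x p q : ℤ} {ω : Config} {v : Site} (h : Pivotal n ω v) (hpq : p ≤ q)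
    (h1 : x + q ≤ n) (h2 : -n ≤ x - q) (hv : nrm (x, -n) v + 1 ≤ p) :
    ω ∈ Arm (half (x, -n)) (x, -n) p q := by
  obtain ⟨u, w, hu, hw, hc, ht⟩ := h.conn
  refine arm_of_conn hc ht ?_ ?_ hpq ((lip_nrm _ v u hu).trans hv) ?_
  · rintro y ⟨⟨h3, h4, h5, h6, h7⟩, _⟩
    exact ⟨h6, h3⟩
  · rintro y ⟨h3, h4, h5, h6⟩
    simp only [half, nrm, Set.mem_ofPred_eq] at h4 h5 h6
    refine ⟨h3, ?_, ?_, ?_, ?_⟩ <;> omega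
  · simp only [nrm]
    omega

theorem Pivotal.corner_arm {n p : ℤ} {ω : Config} {v : Site} (h : Pivotal n ω v) (hp : p ≤ 2 * n)
    (hv : nrm (n, -n) v + 1 ≤ p) : ω ∈ Arm (corner (n, -n)) (n, -n) p (2 * n) := by
  obtain ⟨u, w, hu, hw, hc, ht⟩ := h.conn
  refine arm_of_conn hc ht ?_ ?_ hp ((lip_nrm _ v u hu).trans hv) ?_
  · rintro y ⟨⟨h3, h4, h5, h6, h7⟩, _⟩
    exact ⟨⟨h6, h5⟩, h3⟩
  · rintro y ⟨h3, h4, h5, h6⟩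
    simp only [corner, nrm, Set.mem_ofPred_eq] at h4 h5 h6
    refine ⟨h3, ?_, ?_, ?_, ?_⟩ <;> omega
  · simp only [nrm]
    omega

section
variable {μ : Measure Config}

/-- An event with decay in the number of scales, depending only on an annulus around `z`. -/
theorem exists_event_half (hμ : IsBernoulliHalf μ) {C : ℝ} (hC1 : 1 ≤ C)
    (hC : ∀ j, ArmBound μ j (C * (1 / 4) ^ j)) {s : ℤ} (hs : 1 ≤ s) (z : Site) (e : ℕ)
    {S : Set Config} (h : 1 ≤ e → S ⊆ Arm (half z) z (s + 1) (2 ^ e * s)) :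
    ∃ E R, R.Finite ∧ Dep R E ∧ (∀ v ∈ R, 1 ≤ e ∧ s + 1 ≤ nrm z v ∧ nrm z v ≤ 2 ^ e * s) ∧
      S ⊆ E ∧ μ.real E ≤ C * (1 / 4) ^ e := by
  have := hμ.1
  rcases Nat.eq_zero_or_pos e with rfl | he
  · refine ⟨Set.univ, ∅, Set.finite_empty, Dep.univ, by simp, Set.subset_univ _, ?_⟩
    rw [pow_zero, mul_one]
    exact measureReal_le_one.trans hC1
  · exact ⟨_, _, half_ann_finite _ _ _, dep_arm _ _ _ _, fun v hv => ⟨he, hv.2.1, hv.2.2⟩, h he,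
      hC e s hs z⟩

theorem exists_event_corner (hμ : IsBernoulliHalf μ) {C α : ℝ} (hC1 : 1 ≤ C)
    (hC : ∀ s : ℤ, 1 ≤ s → ∀ (l : ℕ) (z : Site),
      μ.real (Arm (corner z) z (s + 1) (2 ^ l * s)) ≤ C * (2 : ℝ) ^ (-(1 + α) * l))
    {s : ℤ} (hs : 1 ≤ s) (z : Site) (e : ℕ)
    {S : Set Config} (h : 1 ≤ e → S ⊆ Arm (corner z) z (s + 1) (2 ^ e * s)) :
    ∃ E R, R.Finite ∧ Dep R E ∧ (∀ v ∈ R, 1 ≤ e ∧ s + 1 ≤ nrm z v ∧ nrm z v ≤ 2 ^ e * s) ∧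
      S ⊆ E ∧ μ.real E ≤ C * (2 : ℝ) ^ (-(1 + α) * e) := by
  have := hμ.1
  rcases Nat.eq_zero_or_pos e with rfl | he
  · refine ⟨Set.univ, ∅, Set.finite_empty, Dep.univ, by simp, Set.subset_univ _, ?_⟩
    rw [Nat.cast_zero, mul_zero, Real.rpow_zero, mul_one]
    exact measureReal_le_one.trans hC1
  · exact ⟨_, _, (half_ann_finite _ _ _).subset (Set.inter_subset_inter_left _ fun _ hv => hv.1),
      dep_arm _ _ _ _, fun v hv => ⟨he, hv.2.1, hv.2.2⟩, h he, hC s hs e z⟩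

theorem prob_le_of_subset_four (hμ : IsBernoulliHalf μ) {S E₁ E₂ E₃ E₄ : Set Config}
    {R₁ R₂ R₃ R₄ : Set Site} {a₁ a₂ a₃ a₄ : ℝ} (f₁ : R₁.Finite) (f₂ : R₂.Finite) (f₃ : R₃.Finite)
    (f₄ : R₄.Finite) (d₁ : Dep R₁ E₁) (d₂ : Dep R₂ E₂) (d₃ : Dep R₃ E₃) (d₄ : Dep R₄ E₄)
    (s₁ : S ⊆ E₁) (s₂ : S ⊆ E₂) (s₃ : S ⊆ E₃) (s₄ : S ⊆ E₄)
    (b₁ : μ.real E₁ ≤ a₁) (b₂ : μ.real E₂ ≤ a₂) (b₃ : μ.real E₃ ≤ a₃) (b₄ : μ.real E₄ ≤ a₄)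
    (h₁₂ : Disjoint R₁ R₂) (h₁₃ : Disjoint R₁ R₃) (h₁₄ : Disjoint R₁ R₄) (h₂₃ : Disjoint R₂ R₃)
    (h₂₄ : Disjoint R₂ R₄) (h₃₄ : Disjoint R₃ R₄) : μ.real S ≤ a₁ * (a₂ * (a₃ * a₄)) := by
  have := hμ.1
  have d34 : Dep (R₃ ∪ R₄) (E₃ ∩ E₄) :=
    (d₃.mono Set.subset_union_left).inter (d₄.mono Set.subset_union_right)
  have d234 : Dep (R₂ ∪ (R₃ ∪ R₄)) (E₂ ∩ (E₃ ∩ E₄)) :=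
    (d₂.mono Set.subset_union_left).inter (d34.mono Set.subset_union_right)
  have p₁ : 0 ≤ μ.real E₁ := measureReal_nonneg
  have p₂ : 0 ≤ μ.real E₂ := measureReal_nonneg
  have p₃ : 0 ≤ μ.real E₃ := measureReal_nonneg
  have p₄ : 0 ≤ μ.real E₄ := measureReal_nonneg
  calc μ.real S ≤ μ.real (E₁ ∩ (E₂ ∩ (E₃ ∩ E₄))) := measureReal_mono
        (Set.subset_inter s₁ (Set.subset_inter s₂ (Set.subset_inter s₃ s₄)))
    _ = μ.real E₁ * (μ.real E₂ * (μ.real E₃ * μ.real E₄)) := by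
        rw [prob_inter_of_disjoint hμ f₁ (f₂.union (f₃.union f₄))
            (Set.disjoint_union_right.2 ⟨h₁₂, Set.disjoint_union_right.2 ⟨h₁₃, h₁₄⟩⟩) d₁ d234,
          prob_inter_of_disjoint hμ f₂ (f₃.union f₄) (Set.disjoint_union_right.2 ⟨h₂₃, h₂₄⟩) d₂ d34,
          prob_inter_of_disjoint hμ f₃ f₄ h₃₄ d₃ d₄]
    _ ≤ _ := by
        have h3 : 0 ≤ a₃ := p₃.trans b₃
        have h2 : 0 ≤ a₂ := p₂.trans b₂
        have h1 : 0 ≤ a₁ := p₁.trans b₁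
        gcongr

end

theorem disjoint_of_nrm {z z' : Site} {R R' : Set Site} {a b a' b' : ℤ} {P P' : Prop}
    (h : ∀ v ∈ R, P ∧ a ≤ nrm z v ∧ nrm z v ≤ b) (h' : ∀ v ∈ R', P' ∧ a' ≤ nrm z' v ∧ nrm z' v ≤ b')
    (hd : P → P' → ∀ v, a ≤ nrm z v → nrm z v ≤ b → a' ≤ nrm z' v → nrm z' v ≤ b' → False) :
    Disjoint R R' := by
  rw [Set.disjoint_left]
  intro v hv hv'
  obtain ⟨p, h1, h2⟩ := h v hv
  obtain ⟨p', h3, h4⟩ := h' v hv'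
  exact hd p p' v h1 h2 h3 h4

theorem prob_two_pivotal {μ : Measure Config} (hμ : IsBernoulliHalf μ) {C C' α : ℝ} (hC1 : 1 ≤ C)
    (hC : ∀ j, ArmBound μ j (C * (1 / 4) ^ j)) (hC1' : 1 ≤ C')
    (hC' : ∀ s : ℤ, 1 ≤ s → ∀ (l : ℕ) (z : Site),
      μ.real (Arm (corner z) z (s + 1) (2 ^ l * s)) ≤ C' * (2 : ℝ) ^ (-(1 + α) * l))
    {n m x₁ x₂ d D : ℤ} {e₁ e₃ e₄ : ℕ} (hm : 1 ≤ m) (hmd : m ≤ d) (hdD : d ≤ D) (hDn : D ≤ n)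
    (g₁ : 1 ≤ e₁ → 64 * (2 ^ e₁ * m) = d) (g₃ : 1 ≤ e₃ → 16 * (2 ^ e₃ * d) = D)
    (g₄ : 1 ≤ e₄ → 2 * (2 ^ e₄ * D) = n) (hx₁ : D ≤ 2 * (n - x₁)) (hx₁' : n - D ≤ x₁ - m)
    (hx₂ : x₂ ≤ n) (hx₂' : 1 ≤ e₁ → D ≤ 32 * (n - x₂)) (hd : d ≤ x₂ - x₁) (hd' : x₂ - x₁ < 2 * d)
    {S : Set Config} (h₁ : ∀ ω ∈ S, ∃ v, Pivotal n ω v ∧ nrm (x₁, -n) v ≤ m)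
    (h₂ : ∀ ω ∈ S, ∃ v, Pivotal n ω v ∧ nrm (x₂, -n) v ≤ m) :
    μ.real S ≤ C * (1 / 4) ^ e₁ * (C * (1 / 4) ^ e₁ * (C * (1 / 4) ^ e₃ *
      (C' * (2 : ℝ) ^ (-(1 + α) * e₄)))) := by
  have two_le : ∀ (e : ℕ) (a : ℤ), 1 ≤ e → 0 ≤ a → 2 * a ≤ 2 ^ e * a := by
    intro e a he ha
    refine mul_le_mul_of_nonneg_right ?_ ha
    calc (2 : ℤ) = 2 ^ 1 := (pow_one 2).symm
      _ ≤ 2 ^ e := pow_le_pow_right₀ one_le_two he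
  have t₁ := fun he => two_le e₁ m he (by omega)
  have t₃ := fun he => two_le e₃ d he (by omega)
  have t₄ := fun he => two_le e₄ D he (by omega)
  obtain ⟨E₁, R₁, f₁, d₁, r₁, s₁, b₁⟩ := exists_event_half hμ hC1 hC (s := m) hm (x₁, -n) e₁ (S := S)
    fun he ω hω => by
      obtain ⟨v, hv, hv'⟩ := h₁ ω hω
      have := t₁ he
      have := g₁ he
      exact hv.half_arm (by omega) (by omega) (by omega) (by omega)
  obtain ⟨E₂, R₂, f₂, d₂, r₂, s₂, b₂⟩ := exists_event_half hμ hC1 hC (s := m) hm (x₂, -n) e₁ (S := S)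
    fun he ω hω => by
      obtain ⟨v, hv, hv'⟩ := h₂ ω hω
      have := t₁ he
      have := g₁ he
      have := hx₂' he
      exact hv.half_arm (by omega) (by omega) (by omega) (by omega)
  have q₃ : (2 : ℤ) ^ e₃ * (4 * d) = 4 * (2 ^ e₃ * d) := by ring
  have q₄ : (2 : ℤ) ^ e₄ * (4 * D) = 4 * (2 ^ e₄ * D) := by ring
  obtain ⟨E₃, R₃, f₃, d₃, r₃, s₃, b₃⟩ := exists_event_half hμ hC1 hC (s := 4 * d) (by omega)
    (x₁, -n) e₃ (S := S) fun he ω hω => by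
      obtain ⟨v, hv, hv'⟩ := h₁ ω hω
      have := t₃ he
      have := g₃ he
      rw [q₃]
      exact hv.half_arm (by omega) (by omega) (by omega) (by omega)
  obtain ⟨E₄, R₄, f₄, d₄, r₄, s₄, b₄⟩ := exists_event_corner hμ hC1' hC' (s := 4 * D) (by omega)
    (n, -n) e₄ (S := S) fun he ω hω => by
      obtain ⟨v, hv, hv'⟩ := h₁ ω hω
      have := t₄ he
      have := g₄ he
      rw [q₄, show 4 * (2 ^ e₄ * D) = 2 * n by omega]
      refine hv.corner_arm (by omega) ?_
      simp only [nrm] at hv' ⊢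
      omega
  refine prob_le_of_subset_four hμ f₁ f₂ f₃ f₄ d₁ d₂ d₃ d₄ s₁ s₂ s₃ s₄ b₁ b₂ b₃ b₄
    (disjoint_of_nrm r₁ r₂ ?_) (disjoint_of_nrm r₁ r₃ ?_) (disjoint_of_nrm r₁ r₄ ?_)
    (disjoint_of_nrm r₂ r₃ ?_) (disjoint_of_nrm r₂ r₄ ?_) (disjoint_of_nrm r₃ r₄ ?_)
  · intro he _ v k1 k2 k3 k4
    have := g₁ he
    simp only [nrm] at k1 k2 k3 k4
    omega
  · intro he _ v k1 k2 k3 k4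
    have := g₁ he
    omega
  · intro he _ v k1 k2 k3 k4
    have := g₁ he
    simp only [nrm] at k1 k2 k3 k4
    omega
  · intro he _ v k1 k2 k3 k4
    have := g₁ he
    simp only [nrm] at k1 k2 k3 k4
    omega
  · intro he _ v k1 k2 k3 k4
    have := g₁ he
    simp only [nrm] at k1 k2 k3 k4
    omega
  · intro he _ v k1 k2 k3 k4
    have := g₃ he
    rw [q₃] at k2
    simp only [nrm] at k1 k2 k3 k4
    omega

theorem two_rpow_exponent_bound {α : ℝ} (hα : 0 < α) {C C' : ℝ} (hC : 1 ≤ C) (hC' : 1 ≤ C')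
    {i₀ i j e₁ e₃ e₄ : ℕ} (h₁ : i₀ ≤ e₁ + (i + 6)) (h₃ : i ≤ e₃ + (j + 4)) (h₄ : j ≤ e₄ + 1) :
    C * (1 / 4) ^ e₁ * (C * (1 / 4) ^ e₁ * (C * (1 / 4) ^ e₃ *
      (C' * (2 : ℝ) ^ (-(1 + α) * e₄)))) ≤
    C ^ 3 * C' * (2 : ℝ) ^ (33 + α) * ((2 : ℝ) ^ (-(4 * i₀ : ℝ)) *
      (2 : ℝ) ^ (2 * (i : ℝ) + (1 - α) * j)) := by
  have q : ∀ e : ℕ, (1 / 4 : ℝ) ^ e = (2 : ℝ) ^ (-(2 * e : ℝ)) := by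
    intro e
    rw [Real.rpow_neg zero_le_two, Real.rpow_mul zero_le_two, Real.rpow_natCast, ← inv_pow]
    norm_num
  rw [q, q]
  have e : C * (2 : ℝ) ^ (-(2 * e₁ : ℝ)) * (C * (2 : ℝ) ^ (-(2 * e₁ : ℝ)) *
      (C * (2 : ℝ) ^ (-(2 * e₃ : ℝ)) * (C' * (2 : ℝ) ^ (-(1 + α) * e₄)))) =
      C ^ 3 * C' * (2 : ℝ) ^ (-(2 * e₁ : ℝ) + -(2 * e₁ : ℝ) + -(2 * e₃ : ℝ) + -(1 + α) * e₄) := by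
    rw [Real.rpow_add zero_lt_two, Real.rpow_add zero_lt_two, Real.rpow_add zero_lt_two]
    ring
  rw [e, mul_assoc (C ^ 3 * C'), ← Real.rpow_add zero_lt_two, ← Real.rpow_add zero_lt_two]
  refine mul_le_mul_of_nonneg_left (Real.rpow_le_rpow_of_exponent_le one_le_two ?_) (by positivity)
  have r₁ : (i₀ : ℝ) ≤ e₁ + (i + 6) := by exact_mod_cast h₁
  have r₃ : (i : ℝ) ≤ e₃ + (j + 4) := by exact_mod_cast h₃
  have r₄ : (j : ℝ) ≤ e₄ + 1 := by exact_mod_cast h₄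
  nlinarith [mul_le_mul_of_nonneg_left r₄ (show 0 ≤ 1 + α by linarith)]

theorem dyadic_mono {a b : ℕ} (h : a ≤ b) : (2 : ℤ) ^ a ≤ 2 ^ b := pow_le_pow_right₀ one_le_two h

/-- Second-moment estimate, case (i) `0 ≤ j₂ - j₁ ≤ 4`: if the `x`-coordinates
of the lower left vertices of `H_{k₁}`, `H_{k₂}` satisfy
`2^{-i}n ≤ x₂ - x₁ < 2^{-i+1}n` for some `j₁ ≤ i ≤ i₀`, then
`P(Q_n ∩ H_{k₁} ≠ ∅, Q_n ∩ H_{k₂} ≠ ∅) ≤ C·(m/n)⁴·2^{2i+(1-α)j₁}`.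
Note that `x₂ - x₁ = (k₂ - k₁)·m`. -/
theorem statement10 :
    ∃ α : ℝ, 0 < α ∧ ∃ C : ℝ≥0∞, C < ⊤ ∧
      ∀ μ : Measure Config, IsBernoulliHalf μ →
        ∀ j₀ i₀ : ℕ, i₀ ≤ j₀ →
          ∀ n m : ℕ, n = 2 ^ j₀ → m = 2 ^ (j₀ - i₀) →
            ∀ k₁ k₂ j₁ j₂ i : ℕ,
              1 ≤ k₁ → k₁ < k₂ → k₂ ≤ 2 ^ (i₀ + 1) →
              j₁ ≤ j₂ → j₂ ≤ j₁ + 4 → j₂ ≤ i₀ →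
              Set.Ioc (-(n : ℤ) + ((k₁ : ℤ) - 1) * (m : ℤ))
                  (-(n : ℤ) + (k₁ : ℤ) * (m : ℤ)) ⊆ Iset j₀ i₀ j₁ →
              Set.Ioc (-(n : ℤ) + ((k₂ : ℤ) - 1) * (m : ℤ))
                  (-(n : ℤ) + (k₂ : ℤ) * (m : ℤ)) ⊆ Iset j₀ i₀ j₂ →
              j₁ ≤ i → i ≤ i₀ →
              (2 : ℤ) ^ (j₀ - i) ≤ ((k₂ : ℤ) - (k₁ : ℤ)) * (m : ℤ) →
              ((k₂ : ℤ) - (k₁ : ℤ)) * (m : ℤ) < 2 ^ (j₀ - i + 1) →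
              μ {ω | (Qset (n : ℤ) ω ∩ Hblock (n : ℤ) (m : ℤ) k₁).Nonempty ∧
                  (Qset (n : ℤ) ω ∩ Hblock (n : ℤ) (m : ℤ) k₂).Nonempty} ≤
                C * ((m : ℝ≥0∞) / (n : ℝ≥0∞)) ^ 4 *
                  (2 : ℝ≥0∞) ^ (2 * (i : ℝ) + (1 - α) * (j₁ : ℝ)) := by
  obtain ⟨C, hC1, hC⟩ := half_quadratic
  obtain ⟨α, hα, C', hC1', hC'⟩ := corner_decay
  refine ⟨α, hα, ENNReal.ofReal (C ^ 3 * C' * (2 : ℝ) ^ (33 + α)), ENNReal.ofReal_lt_top, ?_⟩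
  intro μ hμ j₀ i₀ hij n m hn hm k₁ k₂ j₁ j₂ i hk₁ hk hk₂ hj hj4 hj₂ hI₁ hI₂ hji hii hd hd'
  have := hμ.1
  have hnz : (n : ℤ) = 2 ^ j₀ := by rw [hn]; push_cast; rfl
  have hmz : (m : ℤ) = 2 ^ (j₀ - i₀) := by rw [hm]; push_cast; rfl
  set S := {ω | (Qset (n : ℤ) ω ∩ Hblock (n : ℤ) (m : ℤ) k₁).Nonempty ∧
    (Qset (n : ℤ) ω ∩ Hblock (n : ℤ) (m : ℤ) k₂).Nonempty} with hS
  set x₁ : ℤ := -(n : ℤ) + (k₁ : ℤ) * m with hx₁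
  set x₂ : ℤ := -(n : ℤ) + (k₂ : ℤ) * m with hx₂
  have e₁ : -(n : ℤ) + ((k₁ : ℤ) - 1) * m = x₁ - m := by rw [hx₁]; ring
  have e₂ : -(n : ℤ) + ((k₂ : ℤ) - 1) * m = x₂ - m := by rw [hx₂]; ring
  have e₃ : ((k₂ : ℤ) - (k₁ : ℤ)) * (m : ℤ) = x₂ - x₁ := by rw [hx₁, hx₂]; ring
  rw [e₃] at hd hd'
  rw [e₁] at hI₁
  rw [e₂] at hI₂
  have hm1 : (1 : ℤ) ≤ m := by rw [hmz]; exact one_le_pow₀ one_le_two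
  have hd0 : (1 : ℤ) ≤ 2 ^ (j₀ - i) := one_le_pow₀ one_le_two
  have a₁ : x₁ ∈ Iset j₀ i₀ j₁ := hI₁ ⟨by omega, le_rfl⟩
  have a₂ : x₁ - m + 1 ∈ Iset j₀ i₀ j₁ := hI₁ ⟨by omega, by omega⟩
  have a₃ : x₂ ∈ Iset j₀ i₀ j₂ := hI₂ ⟨by omega, le_rfl⟩
  have a₄ : x₂ - m + 1 ∈ Iset j₀ i₀ j₂ := hI₂ ⟨by omega, by omega⟩
  have hlast : ∀ {x : ℤ}, x ∈ Iset j₀ i₀ i₀ → (n : ℤ) - m < x ∧ x ≤ n := by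
    intro x hx
    rw [Iset, if_pos rfl] at hx
    rw [hnz, hmz]
    exact hx
  have hnot : ∀ {x : ℤ} {j : ℕ}, j < i₀ → x ∈ Iset j₀ i₀ j →
      (n : ℤ) - 2 ^ (j₀ - j) < x ∧ 2 ^ (j₀ - j) ≤ 2 * (n - x) := by
    intro x j hj hx
    rw [Iset, if_neg (by omega)] at hx
    have : (2 : ℤ) ^ (j₀ - j) = 2 * 2 ^ (j₀ - j - 1) := by
      rw [← pow_succ']; congr 1; omega
    rw [hnz]
    have h1 := hx.1
    have h2 := hx.2
    constructor <;> omega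
  have hj₁ : j₁ < i₀ := by
    by_contra h
    have h1 : j₁ = i₀ := by omega
    have h2 : j₂ = i₀ := by omega
    rw [h1] at a₂
    rw [h2] at a₃
    have := hlast a₂
    have := hlast a₃
    omega
  have b₁ := hnot hj₁ a₁
  have b₂ := hnot hj₁ a₂
  have hx₂n : x₂ ≤ n := by
    rcases eq_or_lt_of_le hj₂ with h | h
    · rw [h] at a₃
      exact (hlast a₃).2
    · have := (hnot h a₃).2
      have : (0 : ℤ) < 2 ^ (j₀ - j₂) := by positivity
      omega
  have hSv : ∀ k : ℕ, ∀ ω, (Qset (n : ℤ) ω ∩ Hblock (n : ℤ) (m : ℤ) k).Nonempty →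
      ∃ v, Pivotal n ω v ∧ nrm (-(n : ℤ) + (k : ℤ) * m, -(n : ℤ)) v ≤ m := by
    rintro k ω ⟨v, hv, h1, h2, h3, h4⟩
    refine ⟨v, hv, ?_⟩
    have : -(n : ℤ) + ((k : ℤ) - 1) * m = -(n : ℤ) + (k : ℤ) * m - m := by ring
    simp only [nrm]
    omega
  have key : μ.real S ≤ _ := prob_two_pivotal hμ hC1 (hC μ hμ) hC1' (hC' μ hμ)
    (n := n) (m := m) (x₁ := x₁) (x₂ := x₂) (d := 2 ^ (j₀ - i)) (D := 2 ^ (j₀ - j₁))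
    (e₁ := i₀ - i - 6) (e₃ := i - j₁ - 4) (e₄ := j₁ - 1) hm1
    (by rw [hmz]; exact dyadic_mono (by omega)) (dyadic_mono (by omega))
    (by rw [hnz]; exact dyadic_mono (by omega))
    (fun he => by
      rw [hmz, show (64 : ℤ) = 2 ^ 6 by norm_num, ← pow_add, ← pow_add]
      congr 1; omega)
    (fun he => by
      rw [show (16 : ℤ) = 2 ^ 4 by norm_num, ← pow_add, ← pow_add]
      congr 1; omega)
    (fun he => by
      rw [hnz, ← pow_add, ← pow_succ']
      congr 1; omega)
    b₁.2 (by omega) hx₂n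
    (fun he => by
      have h1 := (hnot (by omega) a₃).2
      have h2 : (2 : ℤ) ^ (j₀ - j₁) ≤ 16 * 2 ^ (j₀ - j₂) := by
        rw [show (16 : ℤ) = 2 ^ 4 by norm_num, ← pow_add]
        exact dyadic_mono (by omega)
      omega)
    hd (by rwa [pow_succ'] at hd') (S := S) (fun ω hω => hSv k₁ ω hω.1)
    (fun ω hω => hSv k₂ ω hω.2)
  have key' := key.trans (two_rpow_exponent_bound hα hC1 hC1' (i₀ := i₀) (i := i) (j := j₁)
    (by omega) (by omega) (by omega))
  have hratio : ((m : ℝ≥0∞) / (n : ℝ≥0∞)) ^ 4 = ENNReal.ofReal ((2 : ℝ) ^ (-(4 * i₀ : ℝ))) := by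
    have h1 : (m : ℝ) / n = (2 ^ i₀ : ℝ)⁻¹ := by
      have h2 : (n : ℝ) = m * 2 ^ i₀ := by
        rw [hn, hm]; push_cast
        rw [← pow_add]; congr 1; omega
      have h3 : (m : ℝ) ≠ 0 := by rw [hm]; positivity
      rw [h2]; field_simp
    have h2 : (0 : ℝ) < n := by rw [hn]; positivity
    rw [← ENNReal.ofReal_natCast m, ← ENNReal.ofReal_natCast n, ← ENNReal.ofReal_div_of_pos h2,
      ← ENNReal.ofReal_pow (by positivity), h1]
    congr 1
    rw [Real.rpow_neg zero_le_two, show (4 * i₀ : ℝ) = ((i₀ * 4 : ℕ) : ℝ) by push_cast; ring,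
      Real.rpow_natCast, inv_pow, pow_mul]
  have hpow : (2 : ℝ≥0∞) ^ (2 * (i : ℝ) + (1 - α) * (j₁ : ℝ)) =
      ENNReal.ofReal ((2 : ℝ) ^ (2 * (i : ℝ) + (1 - α) * (j₁ : ℝ))) := by
    rw [← ENNReal.ofReal_rpow_of_pos zero_lt_two, ENNReal.ofReal_ofNat]
  rw [hratio, hpow, ← ENNReal.ofReal_mul (by positivity), ← ENNReal.ofReal_mul (by positivity),
    mul_assoc _ ((2 : ℝ) ^ (-(4 * i₀ : ℝ))), ← ofReal_measureReal]
  exact ENNReal.ofReal_le_ofReal key'
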